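/- arXiv:2007.00065 — 2 statements merged into one kernel-verified Lean document; each statement's English description precedes it below -/
import Mathlib

section
/- For every integer n ≥ 2, the remainder polynomial R_{n,2}(x) of the Wronskian Hermite polynomial He_{(n,2)} is irreducible in ℤ[x]. -/
open Polynomial Finset

/-- Probabilists' Hermite polynomials over `ℤ`:
`He 0 = 1`, `He 1 = X`, `He (n+1) = X * He n - n * He (n-1)`. -/
noncomputable def He : ℕ → Polynomial ℤ
  | 0 => 1
  | 1 => Polynomial.X
  | n + 2 => Polynomial.X * He (n + 1) - Polynomial.C ((n : ℤ) + 1) * He n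

/-- The Wronskian `Wr[He_{n_1}, …, He_{n_r}]` of the Hermite polynomials indexed by
a degree sequence `ns : Fin r → ℕ`; entry `(i,j)` is the `i`-th derivative of `He (ns j)`. -/
noncomputable def wronskHe {r : ℕ} (ns : Fin r → ℕ) : Polynomial ℤ :=
  Matrix.det (Matrix.of fun i j : Fin r =>
    (fun q : Polynomial ℤ => Polynomial.derivative q)^[(i : ℕ)] (He (ns j)))

/-- `Δ(n_λ) = ∏_{i<j} (n_j - n_i)`. -/
def vand {r : ℕ} (ns : Fin r → ℕ) : ℤ :=
  ∏ j : Fin r, ∏ i ∈ Finset.Iio j, ((ns j : ℤ) - (ns i : ℤ))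

/-- The degree sequence `n_λ` of a partition `λ = (λ_1 ≥ … ≥ λ_r)`,
`n_i = λ_{r+1-i} + (i-1)` (indices shifted to start at `0`). -/
def degSeq {r : ℕ} (lam : Fin r → ℕ) : Fin r → ℕ :=
  fun i => lam i.rev + (i : ℕ)

/-- `d_λ` = (number of odd entries of the degree sequence) − (number of even entries). -/
def dStat {r : ℕ} (ns : Fin r → ℕ) : ℤ :=
  ((Finset.univ.filter fun i => Odd (ns i)).card : ℤ) -
    ((Finset.univ.filter fun i => Even (ns i)).card : ℤ)

/-- `s_λ = d_λ(d_λ+1)/2`, the size of the 2-core of `λ`. -/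
def sStat {r : ℕ} (ns : Fin r → ℕ) : ℕ :=
  (dStat ns * (dStat ns + 1) / 2).toNat

open scoped Nat

theorem derivative_hermite_succ (n : ℕ) :
    derivative (hermite (n + 1)) = C ((n : ℤ) + 1) * hermite n := by
  induction n with
  | zero => simp
  | succ n ih =>
    rw [hermite_succ (n + 1)]
    simp only [derivative_sub, derivative_mul, derivative_X, ih, derivative_C]
    rw [hermite_succ n]
    simp
    ring

theorem He_eq_hermite (n : ℕ) : He n = hermite n := by
  induction n using Nat.twoStepInduction with
  | zero => simp [He]
  | one => simp [He]
  | more n h0 h1 =>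
    rw [He, h0, h1, hermite_succ (n + 1), derivative_hermite_succ]

theorem wronskHe_two_row (n : ℕ) : wronskHe (degSeq ![n, 2]) =
    (X ^ 2 - 1) * (C ((n : ℤ) + 1) * hermite n) - 2 * X * hermite (n + 1) := by
  rw [wronskHe, Matrix.det_fin_two]
  have h0 : degSeq ![n, 2] 0 = 2 := by simp [degSeq]
  have h1 : degSeq ![n, 2] 1 = n + 1 := by simp [degSeq]
  have h2 : He 2 = X ^ 2 - 1 := by simp [He]; ring
  simp only [Matrix.of_apply, h0, h1, h2, He_eq_hermite (n + 1), Fin.val_zero, Fin.val_one,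
    Function.iterate_zero, Function.iterate_one, id, derivative_hermite_succ]
  simp
  ring

theorem vand_two_row (n : ℕ) : vand (degSeq ![n, 2]) = (n : ℤ) - 1 := by
  have : (Finset.Iio (1 : Fin 2)) = {0} := by decide
  have h0 : (Finset.Iio (0 : Fin 2)) = ∅ := by decide
  simp [vand, degSeq, Fin.prod_univ_two, this, h0]
  ring

theorem sStat_two_row_even {n : ℕ} (h : Even n) : sStat (degSeq ![n, 2]) = 0 := by
  have h0 : degSeq ![n, 2] 0 = 2 := by simp [degSeq]
  have h1 : degSeq ![n, 2] 1 = n + 1 := by simp [degSeq]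
  have h2 : Odd (n + 1) := h.add_one
  rw [sStat, dStat, card_filter, card_filter, Fin.sum_univ_two, Fin.sum_univ_two, h0, h1]
  simp [h2, -Nat.not_even_iff_odd,
    Nat.not_even_iff_odd.2 h2, show ¬ Odd 2 by decide]

theorem sStat_two_row_odd {n : ℕ} (h : Odd n) : sStat (degSeq ![n, 2]) = 1 := by
  have h0 : degSeq ![n, 2] 0 = 2 := by simp [degSeq]
  have h1 : degSeq ![n, 2] 1 = n + 1 := by simp [degSeq]
  have h2 : Even (n + 1) := h.add_one
  rw [sStat, dStat, card_filter, card_filter, Fin.sum_univ_two, Fin.sum_univ_two, h0, h1]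
  simp [h2, -Nat.not_odd_iff_even,
    Nat.not_odd_iff_even.2 h2, show ¬ Odd 2 by decide]

theorem factorial_two_mul_eq (i : ℕ) : (2 * i)! = 2 ^ i * i ! * (2 * i - 1)‼ := by
  rcases i with _ | i
  · simp
  · rw [← Nat.doubleFactorial_two_mul, show 2 * (i + 1) = (2 * i + 1) + 1 by ring,
      Nat.factorial_eq_mul_doubleFactorial]
    rfl

theorem factorial_two_mul_add_one_eq (i : ℕ) : (2 * i + 1)! = 2 ^ i * i ! * (2 * i + 1)‼ := by
  rw [← Nat.doubleFactorial_two_mul, Nat.factorial_eq_mul_doubleFactorial, mul_comm]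

theorem choose_two_mul_mul_doubleFactorial (i l : ℕ) :
    (2 * i - 1)‼ * ((2 * l - 1)‼ * (2 * l + 2 * i).choose (2 * i)) =
      (2 * (l + i) - 1)‼ * (l + i).choose i := by
  have h1 := Nat.add_choose_mul_factorial_mul_factorial (2 * l) (2 * i)
  have h2 := Nat.add_choose_mul_factorial_mul_factorial l i
  rw [show 2 * l + 2 * i = 2 * (l + i) by ring] at h1 ⊢
  rw [factorial_two_mul_eq, factorial_two_mul_eq, factorial_two_mul_eq, ← h2] at h1
  have : 0 < 2 ^ (l + i) * l ! * i ! := by positivity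
  apply Nat.eq_of_mul_eq_mul_left this
  rw [pow_add] at h1 ⊢
  linarith

theorem choose_two_mul_add_one_mul_doubleFactorial (i l : ℕ) :
    (2 * i + 1)‼ * ((2 * l - 1)‼ * (2 * l + (2 * i + 1)).choose (2 * i + 1)) =
      (2 * (l + i) + 1)‼ * (l + i).choose i := by
  have h1 := Nat.add_choose_mul_factorial_mul_factorial (2 * l) (2 * i + 1)
  have h2 := Nat.add_choose_mul_factorial_mul_factorial l i
  rw [show 2 * l + (2 * i + 1) = 2 * (l + i) + 1 by ring] at h1 ⊢
  rw [factorial_two_mul_eq, factorial_two_mul_add_one_eq, factorial_two_mul_add_one_eq,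
    ← h2] at h1
  have : 0 < 2 ^ (l + i) * l ! * i ! := by positivity
  apply Nat.eq_of_mul_eq_mul_left this
  rw [pow_add] at h1 ⊢
  linarith

theorem coeff_hermite_even (a i : ℕ) : ((2 * i - 1)‼ : ℤ) * (hermite (2 * a)).coeff (2 * i) =
    (-1) ^ (a + i) * ((2 * a - 1)‼ * a.choose i : ℕ) := by
  rcases le_or_gt i a with h | h
  · obtain ⟨l, rfl⟩ := Nat.exists_eq_add_of_le' h
    rw [show 2 * (l + i) = 2 * l + 2 * i by ring, coeff_hermite_explicit,
      show 2 * l + 2 * i = 2 * (l + i) by ring, ← choose_two_mul_mul_doubleFactorial,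
      show l + i + i = l + 2 * i by ring, pow_add, pow_mul]
    push_cast
    rw [show 2 * l + 2 * i = 2 * (l + i) by ring]
    ring
  · rw [coeff_hermite_of_lt (by omega), Nat.choose_eq_zero_of_lt h]; simp

theorem coeff_hermite_odd (a i : ℕ) :
    ((2 * i + 1)‼ : ℤ) * (hermite (2 * a + 1)).coeff (2 * i + 1) =
    (-1) ^ (a + i) * ((2 * a + 1)‼ * a.choose i : ℕ) := by
  rcases le_or_gt i a with h | h
  · obtain ⟨l, rfl⟩ := Nat.exists_eq_add_of_le' h
    rw [show 2 * (l + i) + 1 = 2 * l + (2 * i + 1) by ring, coeff_hermite_explicit,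
      show 2 * l + (2 * i + 1) = 2 * (l + i) + 1 by ring,
      ← choose_two_mul_add_one_mul_doubleFactorial,
      show l + i + i = l + 2 * i by ring, pow_add, pow_mul]
    push_cast
    rw [show 2 * l + (2 * i + 1) = 2 * (l + i) + 1 by ring]
    ring
  · rw [coeff_hermite_of_lt (by omega), Nat.choose_eq_zero_of_lt h]; simp

theorem doubleFactorial_two_mul_add_one (a : ℕ) :
    (2 * a + 1)‼ = (2 * a + 1) * (2 * a - 1)‼ := by
  rcases a with _ | a
  · simp
  · rfl

theorem coeff_remainder_even (a : ℕ) (P : ℤ[X])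
    (hP : C ((2 * a : ℤ) - 1) * P = (X ^ 2 - 1) * (C ((2 * a : ℤ) + 1) * hermite (2 * a)) -
      2 * X * hermite (2 * a + 1)) (j : ℕ) :
    ∃ b : ℤ, (a + 1) * b = ((a + 1).choose j) * (2 * j ^ 2 - 4 * j + (a + 1)) ∧
      ((2 * j - 1)‼ : ℤ) * ((2 * a - 1) * P.coeff (2 * j)) =
        (-1) ^ (a + 1 + j) * ((2 * a + 1)‼ * b) := by
  have hd : ((2 * a + 1)‼ : ℤ) = (2 * a + 1) * (2 * a - 1)‼ := by
    rw [doubleFactorial_two_mul_add_one]; push_cast; rfl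
  rw [sub_one_mul, mul_assoc 2 X] at hP
  have hc := congrArg (fun q : ℤ[X] => q.coeff (2 * j)) hP
  simp only [coeff_sub, coeff_C_mul] at hc
  rcases j with _ | j
  · have h0 := coeff_hermite_even a 0
    have hx : (X ^ 2 * (C ((2 * a : ℤ) + 1) * hermite (2 * a))).coeff 0 = 0 := by simp
    have hy : (2 * (X * hermite (2 * a + 1)) : ℤ[X]).coeff 0 = 0 := by simp
    refine ⟨1, by simp, ?_⟩
    simp only [mul_zero] at hc h0 ⊢
    rw [hx, hy] at hc
    rw [hc, hd]
    simp at h0 ⊢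
    rw [h0, pow_succ]
    ring
  · have h1 := coeff_hermite_even a (j + 1)
    have h2 := coeff_hermite_even a j
    have h3 := coeff_hermite_odd a j
    have hx : (X ^ 2 * (C ((2 * a : ℤ) + 1) * hermite (2 * a))).coeff (2 * (j + 1)) =
        (2 * a + 1) * (hermite (2 * a)).coeff (2 * j) := by
      rw [show 2 * (j + 1) = 2 * j + 2 by ring, coeff_X_pow_mul, coeff_C_mul]
    have hy : (2 * (X * hermite (2 * a + 1)) : ℤ[X]).coeff (2 * (j + 1)) =
        2 * (hermite (2 * a + 1)).coeff (2 * j + 1) := by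
      rw [show (2 : ℤ[X]) = C 2 by rfl, coeff_C_mul,
        show 2 * (j + 1) = 2 * j + 1 + 1 by ring, coeff_X_mul]
    have hd2 : ((2 * j + 1)‼ : ℤ) = (2 * j + 1) * (2 * j - 1)‼ := by
      rw [doubleFactorial_two_mul_add_one]; push_cast; rfl
    rw [hx, hy] at hc
    refine ⟨a.choose (j + 1) + (2 * j - 1) * a.choose j, ?_, ?_⟩
    · have h4 := Nat.add_one_mul_choose_eq a j
      have h5 := Nat.choose_succ_succ' a j
      zify at h4 h5
      rw [h5] at h4 ⊢
      push_cast
      linear_combination (2 * (j : ℤ) - 2) * h4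
    · rw [hc, hd]
      rw [show 2 * (j + 1) - 1 = 2 * j + 1 by omega] at h1 ⊢
      push_cast at h1 h2 h3 ⊢
      rw [hd2] at h1 h3 ⊢
      rw [hd] at h3
      simp only [pow_add, pow_one] at h1 h2 h3 ⊢
      linear_combination (-(2 * a + 1 : ℤ)) * h1 + (2 * a + 1 : ℤ) * (2 * j + 1) * h2 - 2 * h3

theorem coeff_remainder_odd (a : ℕ) (P : ℤ[X])
    (hP : C ((2 * a : ℤ)) * P = (X ^ 2 - 1) * (C ((2 * a : ℤ) + 2) * hermite (2 * a + 1)) -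
      2 * X * hermite (2 * a + 2)) (ha : a ≠ 0) (j : ℕ) :
    ∃ b : ℤ, a * b = ((a + 1).choose j) * (2 * j ^ 2 - 2 * j + a) ∧
      ((2 * j + 1)‼ : ℤ) * P.coeff (2 * j + 1) =
        (-1) ^ (a + 1 + j) * ((2 * a + 1)‼ * b) := by
  have ha' : (2 * a : ℤ) ≠ 0 := by positivity
  have hd : ((2 * a + 1)‼ : ℤ) = (2 * a + 1) * (2 * a - 1)‼ := by
    rw [doubleFactorial_two_mul_add_one]; push_cast; rfl
  rw [sub_one_mul, mul_assoc 2 X] at hP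
  have hc := congrArg (fun q : ℤ[X] => q.coeff (2 * j + 1)) hP
  simp only [coeff_sub, coeff_C_mul] at hc
  have hd2 : ((2 * j + 1)‼ : ℤ) = (2 * j + 1) * (2 * j - 1)‼ := by
    rw [doubleFactorial_two_mul_add_one]; push_cast; rfl
  have hy : (2 * (X * hermite (2 * a + 2)) : ℤ[X]).coeff (2 * j + 1) =
      2 * (hermite (2 * (a + 1))).coeff (2 * j) := by
    rw [show (2 : ℤ[X]) = C 2 by rfl, coeff_C_mul, coeff_X_mul]
    rfl
  have h1 := coeff_hermite_odd a j
  have h2 := coeff_hermite_even (a + 1) j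
  rw [show 2 * (a + 1) - 1 = 2 * a + 1 by omega] at h2
  rcases j with _ | j
  · have hx : (X ^ 2 * (C ((2 * a : ℤ) + 2) * hermite (2 * a + 1))).coeff 1 = 0 := by
      rw [coeff_X_pow_mul']; simp
    refine ⟨1, by simp, ?_⟩
    simp only [mul_zero, zero_add] at hc h1 h2 hx hy ⊢
    rw [hx, hy] at hc
    apply mul_left_cancel₀ ha'
    simp only [Nat.doubleFactorial, Nat.cast_one, one_mul, Nat.choose_zero_right, mul_one,
      add_zero, zero_tsub] at h1 h2 ⊢
    rw [h1, h2] at hc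
    rw [hc, pow_succ]
    ring
  · have h3 := coeff_hermite_odd a j
    have hx : (X ^ 2 * (C ((2 * a : ℤ) + 2) * hermite (2 * a + 1))).coeff (2 * (j + 1) + 1) =
        (2 * a + 2) * (hermite (2 * a + 1)).coeff (2 * j + 1) := by
      rw [show 2 * (j + 1) + 1 = 2 * j + 1 + 2 by ring, coeff_X_pow_mul, coeff_C_mul]
    rw [hx, hy] at hc
    have h4 := Nat.add_one_mul_choose_eq a j
    have h5 := Nat.choose_succ_succ' a j
    obtain ⟨e, he⟩ : ∃ e : ℤ, a * e = j * a.choose j := by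
      rcases a with _ | a
      · exact absurd rfl ha
      rcases j with _ | j
      · exact ⟨0, by simp⟩
      · have := Nat.add_one_mul_choose_eq a j
        refine ⟨a.choose j, ?_⟩
        push_cast; zify at this; linarith
    zify at h4 h5
    have key : (a : ℤ) * ((a + 1).choose (j + 1) + 2 * (a + 1) * e) =
        ((a + 1).choose (j + 1)) * (2 * (j + 1) ^ 2 - 2 * (j + 1) + a) := by
      linear_combination 2 * ((a : ℤ) + 1) * he + 2 * (j : ℤ) * h4
    refine ⟨(a + 1).choose (j + 1) + 2 * (a + 1) * e, ?_, ?_⟩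
    · push_cast; exact key
    · apply mul_left_cancel₀ ha'
      rw [show 2 * (j + 1) - 1 = 2 * j + 1 by omega] at h2 hd2
      push_cast at h1 h2 h3 hd2 hc ⊢
      rw [show (2 * (a : ℤ)) * (((2 * (j + 1) + 1)‼ : ℤ) * P.coeff (2 * (j + 1) + 1)) =
        ((2 * (j + 1) + 1)‼ : ℤ) * ((2 * a) * P.coeff (2 * (j + 1) + 1)) by ring, hc]
      rw [hd2] at h1 ⊢
      rw [h5] at h2 h4 key ⊢
      simp only [pow_add, pow_one] at h1 h2 h3 ⊢
      linear_combination (2 * a + 2 : ℤ) * (2 * j + 3) * h3 - (2 * a + 2 : ℤ) * h1 -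
        2 * (2 * j + 3 : ℤ) * h2 -
        4 * (a + 1) * (-1) ^ a * (-1) ^ j * ((2 * a + 1)‼ : ℤ) * he +
        4 * (-1) ^ a * (-1) ^ j * ((2 * a + 1)‼ : ℤ) * h4

theorem prime_dvd_coeff_zero_of_factor {p : ℕ} [Fact p.Prime] {F G H : ℤ[X]} {k s : ℕ}
    (hF : F = G * H) (hG : G.Monic) (hH : H.Monic) (hk : F.natDegree = k)
    (hs : s < G.natDegree) (hdvd : ∀ j, j + s < k → (p : ℤ) ∣ F.coeff j) :
    (p : ℤ) ∣ G.coeff 0 := by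
  by_contra hcon
  have hXF : (X : (ZMod p)[X]) ^ (k - s) ∣ F.map (Int.castRingHom (ZMod p)) := by
    rw [X_pow_dvd_iff]
    intro j hj
    rw [coeff_map, eq_intCast, ZMod.intCast_zmod_eq_zero_iff_dvd]
    exact hdvd j (by omega)
  rw [hF, Polynomial.map_mul] at hXF
  have hco : IsCoprime ((X : (ZMod p)[X]) ^ (k - s)) (G.map (Int.castRingHom (ZMod p))) := by
    refine IsCoprime.pow_left ?_
    refine (irreducible_X.coprime_iff_not_dvd).2 ?_
    rw [X_dvd_iff, coeff_map, eq_intCast, ZMod.intCast_zmod_eq_zero_iff_dvd]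
    exact hcon
  have h1 := hco.dvd_of_dvd_mul_left hXF
  have h2 := natDegree_le_of_dvd h1 (hH.map _).ne_zero
  rw [natDegree_X_pow, hH.natDegree_map] at h2
  have h3 := hG.natDegree_mul hH
  rw [← hF, hk] at h3
  omega

theorem no_factor_of_slopes {p : ℕ} [hp : Fact p.Prime] {F G H : ℤ[X]} {k s : ℕ}
    (hF : F = G * H) (hG : G.Monic) (hH : H.Monic) (hk : F.natDegree = k)
    (hs : s < G.natDegree) (hdvd : ∀ j, j + s < k → (p : ℤ) ∣ F.coeff j)
    (h0 : F.coeff 0 ≠ 0)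
    (hsl : ∀ j, 1 ≤ j → ∃ (e : ℕ) (u : ℤ), ¬ (p : ℤ) ∣ u ∧ G.natDegree * e < j ∧
      F.coeff 0 ∣ u * (p : ℤ) ^ e * F.coeff j) : False := by
  have hpG := prime_dvd_coeff_zero_of_factor hF hG hH hk hs hdvd
  set d := G.natDegree with hd
  have hd0 : d ≠ 0 := by omega
  let v : AbsoluteValue ℤ ℝ := (Rat.AbsoluteValue.padic p).comp (f := Int.castRingHom ℚ)
    (RingHom.injective_int _)
  have hv : ∀ z : ℤ, v z = (padicNorm p (z : ℚ) : ℝ) := fun z => rfl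
  have hna : IsNonarchimedean v := by
    intro x y
    simp only [hv]
    push_cast
    exact_mod_cast padicNorm.nonarchimedean (p := p) (q := (x : ℚ)) (r := (y : ℚ))
  have hp1 : (1 : ℝ) < p := by exact_mod_cast hp.out.one_lt
  have hp0 : (0 : ℝ) < p := by linarith
  have hvp : v (p : ℤ) = (p : ℝ)⁻¹ := by
    rw [hv]; push_cast; rw [padicNorm.padicNorm_p hp.out.one_lt]; push_cast; rfl
  have hv1 : ∀ z : ℤ, v z ≤ 1 := fun z => by
    rw [hv]; exact_mod_cast padicNorm.of_int z
  have hv0 : 0 < v (F.coeff 0) := v.pos h0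
  let c : ℝ := (p : ℝ)⁻¹ ^ ((d : ℝ)⁻¹)
  have hc0 : 0 < c := Real.rpow_pos_of_pos (inv_pos.2 hp0) _
  have hcd : c ^ d = (p : ℝ)⁻¹ := Real.rpow_inv_natCast_pow (inv_pos.2 hp0).le hd0
  have hc1 : c < 1 := by
    refine Real.rpow_lt_one (inv_pos.2 hp0).le (inv_lt_one_of_one_lt₀ hp1) (by positivity)
  have hlt : ∀ j, 1 ≤ j → v (F.coeff j) * c ^ j < v (F.coeff 0) := by
    intro j hj
    obtain ⟨e, u, hu, he, w, hw⟩ := hsl j hj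
    have hvu : v u = 1 := by
      rw [hv]; exact_mod_cast (padicNorm.int_eq_one_iff (p := p) u).2 hu
    have h1 : (p : ℝ)⁻¹ ^ e * v (F.coeff j) ≤ v (F.coeff 0) := by
      have := congrArg v hw
      rw [map_mul, map_mul, map_mul, map_pow, hvu, hvp, one_mul] at this
      rw [this]
      exact mul_le_of_le_one_right hv0.le (hv1 w)
    rcases eq_or_ne (F.coeff j) 0 with hz | hz
    · rw [hz]; simpa using hv0
    · calc v (F.coeff j) * c ^ j < v (F.coeff j) * c ^ (d * e) := by
            refine mul_lt_mul_of_pos_left ?_ (v.pos hz)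
            exact pow_lt_pow_right_of_lt_one₀ hc0 hc1 he
        _ = (p : ℝ)⁻¹ ^ e * v (F.coeff j) := by rw [pow_mul, hcd, mul_comm]
        _ ≤ _ := h1
  obtain ⟨c', hcc, hc'⟩ : ∃ c', c < c' ∧ ∀ j ∈ Finset.Icc 1 k,
      v (F.coeff j) * c' ^ j < v (F.coeff 0) := by
    have : ∀ᶠ x in nhdsWithin c (Set.Ioi c), ∀ j ∈ Finset.Icc 1 k,
        v (F.coeff j) * x ^ j < v (F.coeff 0) := by
      refine Filter.Eventually.filter_mono nhdsWithin_le_nhds ?_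
      rw [Filter.eventually_all_finset]
      intro j hj
      have hcont : Continuous fun x : ℝ => v (F.coeff j) * x ^ j := by fun_prop
      exact hcont.continuousAt.eventually_lt continuousAt_const (hlt j (Finset.mem_Icc.1 hj).1)
    obtain ⟨x, hx1, hx2⟩ := (this.and self_mem_nhdsWithin).exists
    exact ⟨x, hx2, hx1⟩
  have hc'0 : 0 < c' := hc0.trans hcc
  have hFn : F.gaussNorm v c' ≤ v (F.coeff 0) := by
    obtain ⟨i, hi⟩ := F.exists_eq_gaussNorm v c'
    rw [hi]
    rcases Nat.eq_zero_or_pos i with rfl | hi0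
    · simp
    · by_cases hik : i ≤ k
      · exact (hc' i (Finset.mem_Icc.2 ⟨hi0, hik⟩)).le
      · rw [coeff_eq_zero_of_natDegree_lt (by omega)]; simp [hv0.le]
  have hGH : F.gaussNorm v c' = G.gaussNorm v c' * H.gaussNorm v c' := by
    rw [hF]; exact gaussNorm_mul hna hc'0 G H
  have hG0 : v (G.coeff 0) ≤ (p : ℝ)⁻¹ := by
    obtain ⟨w, hw⟩ := hpG
    rw [hw, map_mul, hvp]
    exact mul_le_of_le_one_right (inv_pos.2 hp0).le (hv1 w)
  have hGd : (p : ℝ)⁻¹ < G.gaussNorm v c' := by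
    have := le_gaussNorm v G hc'0.le d
    rw [show G.coeff d = 1 from hG, map_one, one_mul] at this
    refine lt_of_lt_of_le ?_ this
    rw [← hcd]
    exact pow_lt_pow_left₀ hcc hc0.le hd0
  have hH0 : v (H.coeff 0) ≤ H.gaussNorm v c' := by
    simpa using le_gaussNorm v H hc'0.le 0
  have hF0 : v (F.coeff 0) = v (G.coeff 0) * v (H.coeff 0) := by
    rw [hF, mul_coeff_zero, map_mul]
  have hHpos : 0 < v (H.coeff 0) := by
    rw [hF0] at hv0
    exact pos_of_mul_pos_right hv0 (v.nonneg _)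
  have : v (G.coeff 0) * v (H.coeff 0) < G.gaussNorm v c' * H.gaussNorm v c' :=
    mul_lt_mul (hG0.trans_lt hGd) hH0 hHpos (G.gaussNorm_nonneg v hc'0.le)
  linarith

/-- The properties of the polynomial `F` of degree `k` with `He_{n,2}(x) = x^ε F(x²)`,
`n + 2 = 2k + ε` and `ε ∈ {0, 1}`, on which the irreducibility proof rests. -/
structure IsTwoRowCore (ε k : ℕ) (F : ℤ[X]) : Prop where
  monic : F.Monic
  natDegree_eq : F.natDegree = k
  coeff_zero_ne : F.coeff 0 ≠ 0
  ratio : ∀ j, ∃ b : ℤ, (2 * k + ε - 3 * ε) * b =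
      k.choose j * ((2 * j + ε) ^ 2 - 4 * (2 * j + ε) + (2 * k + ε)) ∧
    ((2 * j + 2 * ε - 1)‼ : ℤ) * F.coeff j = (-1) ^ j * (F.coeff 0 * b)
  dvd : ∀ j ≤ k, (((2 * k + ε).choose (2 * j + ε) * (2 * (k - j) - 1)‼ : ℕ) : ℤ) ∣
    (2 * k + ε) * (2 * k + ε - 3) * F.coeff j

theorem isTwoRowCore_even {a : ℕ} (ha : 1 ≤ a) {P : ℤ[X]}
    (hP : C ((2 * a : ℤ) - 1) * P = (X ^ 2 - 1) * (C ((2 * a : ℤ) + 1) * hermite (2 * a)) -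
      2 * X * hermite (2 * a + 1)) :
    IsTwoRowCore 0 (a + 1) (contract 2 P) ∧ P = expand ℤ 2 (contract 2 P) ∧
      (contract 2 P).coeff 0 = (-1) ^ (a + 1) * ((2 * a + 1) * (2 * a - 3)‼) := by
  have hF : ∀ j, (contract 2 P).coeff j = P.coeff (2 * j) := fun j => by
    rw [coeff_contract two_ne_zero, mul_comm]
  have hc := coeff_remainder_even a P hP
  have ha2 : (2 * a - 1 : ℤ) ≠ 0 := by omega
  have h0 : (contract 2 P).coeff 0 = (-1) ^ (a + 1) * ((2 * a + 1) * (2 * a - 3)‼) := by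
    obtain ⟨b, hb1, hb2⟩ := hc 0
    have hb : b = 1 := by
      have : (a + 1 : ℤ) ≠ 0 := by omega
      apply mul_left_cancel₀ this
      simpa using hb1
    have h1 : ((2 * a + 1)‼ : ℤ) = (2 * a + 1) * ((2 * a - 1) * (2 * a - 3)‼) := by
      obtain ⟨c, rfl⟩ := Nat.exists_eq_add_of_le' ha
      rw [doubleFactorial_two_mul_add_one, show 2 * (c + 1) - 1 = 2 * c + 1 by omega,
        doubleFactorial_two_mul_add_one, show 2 * (c + 1) - 3 = 2 * c - 1 by omega]
      push_cast; ring
    rw [hF]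
    apply mul_left_cancel₀ ha2
    rw [hb, h1] at hb2
    simp only [mul_zero, zero_tsub, Nat.doubleFactorial, Nat.cast_one, one_mul, add_zero,
      mul_one] at hb2 ⊢
    rw [hb2]; ring
  have h00 : (2 * a - 1 : ℤ) * (contract 2 P).coeff 0 = (-1) ^ (a + 1) * (2 * a + 1)‼ := by
    obtain ⟨b, hb1, hb2⟩ := hc 0
    have hb : b = 1 := by
      have : (a + 1 : ℤ) ≠ 0 := by omega
      apply mul_left_cancel₀ this
      simpa using hb1
    rw [hF]
    simpa [hb] using hb2
  have hdvd : ∀ j ≤ a + 1, ∀ q : ℤ, q = 2 * j ^ 2 - 4 * j + (a + 1) →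
      (a + 1 : ℤ) * (2 * a - 1) * (contract 2 P).coeff j = (-1) ^ (a + 1 + j) * q *
      (((2 * (a + 1)).choose (2 * j) * (2 * (a + 1 - j) - 1)‼ : ℕ) : ℤ) := by
    intro j hj q hq
    obtain ⟨b, hb1, hb2⟩ := hc j
    obtain ⟨l, hl⟩ := Nat.exists_eq_add_of_le' hj
    have h1 := choose_two_mul_mul_doubleFactorial j l
    rw [← hl, show 2 * l + 2 * j = 2 * (a + 1) by omega,
      show 2 * (a + 1) - 1 = 2 * a + 1 by omega] at h1
    zify at h1
    have hpos : ((2 * j - 1)‼ : ℤ) ≠ 0 := by exact_mod_cast (Nat.doubleFactorial_pos _).ne'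
    apply mul_left_cancel₀ hpos
    rw [show a + 1 - j = l by omega, hF]
    rw [← hq] at hb1
    push_cast
    linear_combination (a + 1 : ℤ) * hb2 + (-1) ^ (a + 1 + j) * ((2 * a + 1)‼ : ℤ) * hb1 -
      (-1) ^ (a + 1 + j) * q * h1
  have hlead : (contract 2 P).coeff (a + 1) = 1 := by
    have := hdvd (a + 1) le_rfl _ rfl
    have h2 : (a + 1 : ℤ) * (2 * a - 1) ≠ 0 := mul_ne_zero (by omega) ha2
    apply mul_left_cancel₀ h2
    rw [this, ← two_mul, pow_mul]
    simp
    ring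
  have hbig : ∀ j, a + 1 < j → (contract 2 P).coeff j = 0 := by
    intro j hj
    obtain ⟨b, hb1, hb2⟩ := hc j
    rw [Nat.choose_eq_zero_of_lt hj] at hb1
    have hb : b = 0 := by
      have : (a + 1 : ℤ) ≠ 0 := by omega
      simpa [this] using hb1
    have hpos : ((2 * j - 1)‼ : ℤ) ≠ 0 := by exact_mod_cast (Nat.doubleFactorial_pos _).ne'
    rw [hF]
    rw [hb] at hb2
    rw [mul_zero, mul_zero] at hb2
    exact (mul_eq_zero.1 ((mul_eq_zero.1 hb2).resolve_left hpos)).resolve_left ha2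
  have hdeg : (contract 2 P).natDegree = a + 1 :=
    natDegree_eq_of_le_of_coeff_ne_zero
      (natDegree_le_iff_coeff_eq_zero.2 fun j hj => hbig j hj) (by rw [hlead]; exact one_ne_zero)
  refine ⟨⟨?_, hdeg, ?_, ?_, ?_⟩, ?_, h0⟩
  · rw [Monic.def, leadingCoeff, hdeg, hlead]
  · intro h
    rw [h] at h00
    simp [(Nat.doubleFactorial_pos (2 * a + 1)).ne'] at h00
  · intro j
    obtain ⟨b, hb1, hb2⟩ := hc j
    refine ⟨b, ?_, ?_⟩
    · push_cast; linear_combination 2 * hb1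
    · apply mul_left_cancel₀ ha2
      rw [hF, hF]
      rw [hF] at h00
      simp only [mul_zero, add_zero] at h00 ⊢
      rw [pow_add] at hb2
      linear_combination hb2 - (-1) ^ j * b * h00
  · intro j hj
    have := hdvd j hj _ rfl
    refine ⟨2 * ((-1) ^ (a + 1 + j) * (2 * j ^ 2 - 4 * j + (a + 1))), ?_⟩
    push_cast at this ⊢
    linear_combination 2 * this
  · ext m
    rw [coeff_expand two_pos]
    split_ifs with hm
    · rw [hF, Nat.mul_div_cancel' hm]
    · have hm' : ¬ Even m := fun h => hm h.two_dvd
      have hodd : Odd m := Nat.not_even_iff_odd.1 hm'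
      rw [sub_one_mul, mul_assoc 2 X] at hP
      have hcm := congrArg (fun q : ℤ[X] => q.coeff m) hP
      simp only [coeff_sub, coeff_C_mul] at hcm
      have e1 : (hermite (2 * a)).coeff m = 0 :=
        coeff_hermite_of_odd_add ((even_two_mul a).add_odd hodd)
      have e2 : (X ^ 2 * (C ((2 * a : ℤ) + 1) * hermite (2 * a))).coeff m = 0 := by
        rw [coeff_X_pow_mul']
        split_ifs with h
        · rw [coeff_C_mul, coeff_hermite_of_odd_add, mul_zero]
          obtain ⟨c, hc⟩ := hodd
          exact ⟨a + c - 1, by omega⟩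
        · rfl
      have e3 : (2 * (X * hermite (2 * a + 1)) : ℤ[X]).coeff m = 0 := by
        obtain ⟨c, rfl⟩ := hodd
        rw [show (2 : ℤ[X]) = C 2 by rfl, coeff_C_mul, coeff_X_mul,
          coeff_hermite_of_odd_add ⟨a + c, by omega⟩, mul_zero]
      rw [e1, e2, e3] at hcm
      simpa [ha2] using hcm

theorem isTwoRowCore_odd {a : ℕ} (ha : 1 ≤ a) {P R : ℤ[X]} (hR : P = X * R)
    (hP : C (2 * a : ℤ) * P = (X ^ 2 - 1) * (C ((2 * a : ℤ) + 2) * hermite (2 * a + 1)) -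
      2 * X * hermite (2 * a + 2)) :
    IsTwoRowCore 1 (a + 1) (contract 2 R) ∧ R = expand ℤ 2 (contract 2 R) ∧
      (contract 2 R).coeff 0 = (-1) ^ (a + 1) * (2 * a + 1)‼ := by
  have hPR : ∀ m, P.coeff (m + 1) = R.coeff m := fun m => by rw [hR, coeff_X_mul]
  have hF : ∀ j, (contract 2 R).coeff j = P.coeff (2 * j + 1) := fun j => by
    rw [coeff_contract two_ne_zero, mul_comm, hPR]
  have hc := coeff_remainder_odd a P hP (by omega)
  have ha2 : (a : ℤ) ≠ 0 := by omega
  have h0 : (contract 2 R).coeff 0 = (-1) ^ (a + 1) * (2 * a + 1)‼ := by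
    obtain ⟨b, hb1, hb2⟩ := hc 0
    have hb : b = 1 := by
      apply mul_left_cancel₀ ha2
      simpa using hb1
    rw [hF]
    simpa [hb] using hb2
  have hdvd : ∀ j ≤ a + 1, ∀ q : ℤ, q = 2 * j ^ 2 - 2 * j + a →
      (2 * a + 3 : ℤ) * a * (contract 2 R).coeff j = (-1) ^ (a + 1 + j) * q *
      (((2 * (a + 1) + 1).choose (2 * j + 1) * (2 * (a + 1 - j) - 1)‼ : ℕ) : ℤ) := by
    intro j hj q hq
    obtain ⟨b, hb1, hb2⟩ := hc j
    obtain ⟨l, hl⟩ := Nat.exists_eq_add_of_le' hj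
    have h1 := choose_two_mul_add_one_mul_doubleFactorial j l
    rw [← hl, show 2 * l + (2 * j + 1) = 2 * (a + 1) + 1 by omega,
      doubleFactorial_two_mul_add_one (a + 1), show 2 * (a + 1) - 1 = 2 * a + 1 by omega] at h1
    zify at h1
    have hpos : ((2 * j + 1)‼ : ℤ) ≠ 0 := by exact_mod_cast (Nat.doubleFactorial_pos _).ne'
    apply mul_left_cancel₀ hpos
    rw [show a + 1 - j = l by omega, hF]
    rw [← hq] at hb1
    push_cast
    linear_combination (2 * a + 3 : ℤ) * a * hb2 +
      (-1) ^ (a + 1 + j) * (2 * a + 3 : ℤ) * ((2 * a + 1)‼ : ℤ) * hb1 -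
      (-1) ^ (a + 1 + j) * q * h1
  have hlead : (contract 2 R).coeff (a + 1) = 1 := by
    have := hdvd (a + 1) le_rfl _ rfl
    have h2 : (2 * a + 3 : ℤ) * a ≠ 0 := mul_ne_zero (by omega) ha2
    apply mul_left_cancel₀ h2
    rw [this, ← two_mul, pow_mul]
    simp
    ring
  have hbig : ∀ j, a + 1 < j → (contract 2 R).coeff j = 0 := by
    intro j hj
    obtain ⟨b, hb1, hb2⟩ := hc j
    rw [Nat.choose_eq_zero_of_lt hj] at hb1
    have hb : b = 0 := by
      rw [Nat.cast_zero, zero_mul] at hb1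
      exact (mul_eq_zero.1 hb1).resolve_left ha2
    have hpos : ((2 * j + 1)‼ : ℤ) ≠ 0 := by exact_mod_cast (Nat.doubleFactorial_pos _).ne'
    rw [hF]
    rw [hb] at hb2
    rw [mul_zero, mul_zero] at hb2
    exact (mul_eq_zero.1 hb2).resolve_left hpos
  have hdeg : (contract 2 R).natDegree = a + 1 :=
    natDegree_eq_of_le_of_coeff_ne_zero
      (natDegree_le_iff_coeff_eq_zero.2 fun j hj => hbig j hj) (by rw [hlead]; exact one_ne_zero)
  refine ⟨⟨?_, hdeg, ?_, ?_, ?_⟩, ?_, h0⟩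
  · rw [Monic.def, leadingCoeff, hdeg, hlead]
  · rw [h0]
    simp [(Nat.doubleFactorial_pos (2 * a + 1)).ne']
  · intro j
    obtain ⟨b, hb1, hb2⟩ := hc j
    refine ⟨b, ?_, ?_⟩
    · push_cast; linear_combination 2 * hb1
    · rw [h0, hF, show 2 * j + 2 * 1 - 1 = 2 * j + 1 by omega, hb2]
      ring
  · intro j hj
    have := hdvd j hj _ rfl
    refine ⟨2 * ((-1) ^ (a + 1 + j) * (2 * j ^ 2 - 2 * j + a)), ?_⟩
    push_cast at this ⊢
    linear_combination 2 * this
  · ext m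
    rw [coeff_expand two_pos]
    split_ifs with hm
    · rw [hF, hPR, Nat.mul_div_cancel' hm]
    · have hm' : ¬ Even m := fun h => hm h.two_dvd
      obtain ⟨c, rfl⟩ : Odd m := Nat.not_even_iff_odd.1 hm'
      rw [← hPR]
      rw [sub_one_mul, mul_assoc 2 X] at hP
      have hcm := congrArg (fun q : ℤ[X] => q.coeff (2 * c + 1 + 1)) hP
      simp only [coeff_sub, coeff_C_mul] at hcm
      have e1 : (hermite (2 * a + 1)).coeff (2 * c + 1 + 1) = 0 :=
        coeff_hermite_of_odd_add ⟨a + c + 1, by omega⟩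
      have e2 :
          (X ^ 2 * (C ((2 * a : ℤ) + 2) * hermite (2 * a + 1))).coeff (2 * c + 1 + 1) = 0 := by
        rw [show 2 * c + 1 + 1 = 2 * c + 2 by rfl, coeff_X_pow_mul, coeff_C_mul,
          coeff_hermite_of_odd_add ⟨a + c, by omega⟩, mul_zero]
      have e3 : (2 * (X * hermite (2 * a + 2)) : ℤ[X]).coeff (2 * c + 1 + 1) = 0 := by
        rw [show (2 : ℤ[X]) = C 2 by rfl, coeff_C_mul, coeff_X_mul,
          coeff_hermite_of_odd_add ⟨a + c + 1, by omega⟩, mul_zero]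
      rw [e1, e2, e3] at hcm
      simp only [mul_zero, sub_zero, mul_eq_zero] at hcm
      omega

theorem Nat.Prime.dvd_choose_of_dvd_sub {p n t i : ℕ} (hp : p.Prime) (htp : t < p)
    (hit : i < t) (h : p ∣ n - i) : p ∣ n.choose t := by
  have h1 : p ∣ n.descFactorial t := by
    rw [Nat.descFactorial_eq_prod_range]
    exact h.trans (Finset.dvd_prod_of_mem (fun i => n - i) (Finset.mem_range.2 hit))
  rw [Nat.descFactorial_eq_factorial_mul_choose] at h1
  refine (hp.dvd_mul.1 h1).resolve_left fun h2 => ?_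
  have := (hp.dvd_factorial).1 h2
  omega

theorem dvd_doubleFactorial_of_le {c m : ℕ} (h : c ≤ m) : 2 * c + 1 ∣ (2 * m + 1)‼ := by
  induction m, h using Nat.le_induction with
  | base => rw [doubleFactorial_two_mul_add_one]; exact dvd_mul_right _ _
  | succ m _ ih =>
    rw [doubleFactorial_two_mul_add_one]
    exact ih.trans (dvd_mul_left _ _)

theorem Nat.Prime.sub_one_mul_lt_of_pow_dvd_factorial {p e n : ℕ} (hp : p.Prime) (hn : n ≠ 0)
    (h : p ^ e ∣ n !) : (p - 1) * e < n := by
  have : Fact p.Prime := ⟨hp⟩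
  have h1 : e ≤ padicValNat p (n !) := (padicValNat_dvd_iff_le (Nat.factorial_ne_zero n)).1 h
  exact (Nat.mul_le_mul_left _ h1).trans_lt (sub_one_mul_padicValNat_factorial_lt_of_ne_zero p hn)

theorem Nat.Prime.not_sq_dvd_factorial {p : ℕ} (hp : p.Prime) : ¬ p ^ 2 ∣ (2 * p - 1)! := by
  have h2 := hp.two_le
  have hlog : Nat.log p (2 * p - 1) < 2 := Nat.log_lt_of_lt_pow (by omega) (by
    nlinarith [Nat.sub_lt (show 0 < 2 * p by omega) one_pos])
  rw [hp.pow_dvd_factorial_iff hlog]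
  have : (2 * p - 1) / p = 1 := Nat.div_eq_of_lt_le (by omega) (by omega)
  simp [this]

theorem IsTwoRowCore.false_of_factor {ε k : ℕ} {F G H : ℤ[X]} (hF : IsTwoRowCore ε k F)
    (hε : ε ≤ 1) (hGH : F = G * H) (hG : G.Monic) (hH : H.Monic) {p i d : ℕ} (hp : p.Prime)
    (hd : G.natDegree = d) (hdk : 2 * d ≤ k) (hi1 : 1 ≤ i) (hid : i < 2 * d) (hi3 : i ≠ 3)
    (hpi : p ∣ 2 * k + ε - i) (hdp : 2 * d + 1 ≤ p) (hcase : ε = 0 ∨ 2 * d + 1 < p ∨ Odd i) :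
    False := by
  have : Fact p.Prime := ⟨hp⟩
  have hodd : Odd p := hp.odd_of_ne_two (by omega)
  obtain ⟨c, hc⟩ := hodd
  have hpZ : Prime (p : ℤ) := Nat.prime_iff_prime_int.1 hp
  have hpiZ : (p : ℤ) ∣ (2 * k + ε) - i := by
    have := Int.natCast_dvd_natCast.2 hpi
    rwa [Nat.cast_sub (by omega)] at this
  have hpN : ¬ (p : ℤ) ∣ 2 * k + ε := by
    intro h
    have h1 := (Int.dvd_iff_dvd_of_dvd_sub hpiZ).1 h
    have := Nat.le_of_dvd (by omega) (Int.natCast_dvd_natCast.1 h1)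
    omega
  have hpN3 : ¬ (p : ℤ) ∣ 2 * k + ε - 3 := by
    intro h
    have h1 : (p : ℤ) ∣ (i : ℤ) - 3 := by
      have := dvd_sub h hpiZ
      rwa [show (2 * k + ε - 3 : ℤ) - ((2 * k + ε) - i) = i - 3 by ring] at this
    have := Int.eq_zero_of_abs_lt_dvd h1 (by rw [abs_lt]; omega)
    omega
  refine no_factor_of_slopes (p := p) (s := i / 2) hGH hG hH hF.natDegree_eq (by omega) ?_
    hF.coeff_zero_ne ?_
  · intro j hj
    have h1 : p ∣ (2 * k + ε).choose (2 * j + ε) * (2 * (k - j) - 1)‼ := by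
      by_cases ht : p + 1 ≤ 2 * (k - j)
      · refine Dvd.dvd.mul_left ?_ _
        obtain ⟨m, hm⟩ : ∃ m, 2 * (k - j) - 1 = 2 * m + 1 := ⟨k - j - 1, by omega⟩
        rw [hm, hc]
        exact dvd_doubleFactorial_of_le (by omega)
      · refine Dvd.dvd.mul_right ?_ _
        rw [← Nat.choose_symm (by omega)]
        exact hp.dvd_choose_of_dvd_sub (i := i) (by omega) (by omega) hpi
    have h2 := (Int.natCast_dvd_natCast.2 h1).trans (hF.dvd j (by omega))
    rcases hpZ.dvd_or_dvd h2 with h3 | h3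
    · exact absurd h3 fun h => (hpZ.dvd_or_dvd h).elim hpN hpN3
    · exact h3
  · intro j hj
    rw [hd]
    obtain ⟨b, hb1, hb2⟩ := hF.ratio j
    set n := 2 * j + 2 * ε - 1 with hn
    obtain ⟨e, u, hu, heu⟩ := Nat.exists_eq_pow_mul_and_not_dvd
      (Nat.doubleFactorial_pos n).ne' p hp.ne_one
    have huZ : ¬ (p : ℤ) ∣ u := fun h => hu (Int.natCast_dvd_natCast.1 h)
    have hen : p ^ e ∣ n ! := by
      rw [show n = (n - 1) + 1 by omega, Nat.factorial_eq_mul_doubleFactorial,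
        show n - 1 + 1 = n by omega, heu, mul_assoc]
      exact dvd_mul_right _ _
    have hbound := hp.sub_one_mul_lt_of_pow_dvd_factorial (by omega) hen
    have hgen : F.coeff 0 ∣ (u : ℤ) * (p : ℤ) ^ e * F.coeff j := by
      rw [heu] at hb2
      push_cast at hb2
      rw [mul_comm (u : ℤ), hb2]
      exact Dvd.dvd.mul_left (dvd_mul_right _ _) _
    by_cases hlt : d * e < j
    · exact ⟨e, u, huZ, hlt, hgen⟩
    have hmul : 2 * d * e ≤ (p - 1) * e := Nat.mul_le_mul_right _ (by omega)
    have hε1 : ε = 1 := by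
      by_contra h
      have : ε = 0 := by omega
      rw [mul_assoc] at hmul
      omega
    subst hε1
    have he0 : e ≠ 0 := by rintro rfl; omega
    have hp2 : p = 2 * d + 1 := by
      by_contra h
      have h2 : (2 * d + 2) * e ≤ (p - 1) * e := Nat.mul_le_mul_right _ (by omega)
      rw [add_mul, mul_assoc] at h2
      omega
    have hi : Odd i := by
      rcases hcase with h | h | h
      · omega
      · omega
      · exact h
    have hde : d * e = j := by
      rw [mul_assoc] at hmul
      omega
    have hjp : j < p := by
      by_contra h
      have h1 : p ^ (e + 1) ∣ n ! := by
        rw [show n = 2 * j + 1 by omega, factorial_two_mul_add_one_eq,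
          show 2 * j + 1 = n by omega, heu, pow_succ]
        obtain ⟨w, hw⟩ := (hp.dvd_factorial).2 (not_lt.1 h)
        rw [hw]
        exact ⟨2 ^ j * w * u, by ring⟩
      have h2 := hp.sub_one_mul_lt_of_pow_dvd_factorial (by omega) h1
      rw [hp2, Nat.add_sub_cancel, mul_add, mul_assoc, hde] at h2
      omega
    have he1 : e = 1 := by
      have he3 : e < 3 := by
        by_contra h
        have : d * 3 ≤ d * e := Nat.mul_le_mul_left _ (by omega)
        omega
      by_contra h
      have he2 : e = 2 := by omega
      subst he2
      rw [show n = 2 * p - 1 by omega] at hen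
      exact hp.not_sq_dvd_factorial hen
    subst he1
    have hjd : j = d := by omega
    have hpb : (p : ℤ) ∣ b := by
      have h1 : p ∣ k.choose d := by
        obtain ⟨r, hr⟩ := hi
        refine hp.dvd_choose_of_dvd_sub (i := r) (by omega) (by omega) ?_
        rw [show 2 * k + 1 - i = 2 * (k - r) by omega] at hpi
        refine (hp.dvd_mul.1 hpi).resolve_left fun h => ?_
        have := Nat.le_of_dvd two_pos h
        omega
      have h2 : (p : ℤ) ∣ (2 * k + (1 : ℕ) - 3 * (1 : ℕ)) * b := by
        rw [hb1, hjd]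
        exact Dvd.dvd.mul_right (Int.natCast_dvd_natCast.2 h1) _
      refine (hpZ.dvd_or_dvd h2).resolve_left ?_
      simpa using hpN3
    obtain ⟨b', rfl⟩ := hpb
    refine ⟨0, u, huZ, by omega, ?_⟩
    have hp0 : (p : ℤ) ≠ 0 := hpZ.ne_zero
    refine ⟨(-1) ^ j * b', ?_⟩
    apply mul_left_cancel₀ hp0
    rw [heu] at hb2
    push_cast at hb2
    linear_combination hb2

/-- The polynomials `(e_j, o_j)` with `He_{2j}(x) = e_j(x²)` and `He_{2j+1}(x) = x o_j(x²)`. -/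
noncomputable def hermiteParts : ℕ → ℤ[X] × ℤ[X]
  | 0 => (1, 1)
  | j + 1 =>
    (X * (hermiteParts j).2 - C (2 * j + 1 : ℤ) * (hermiteParts j).1,
      X * (hermiteParts j).2 - C (2 * j + 1 : ℤ) * (hermiteParts j).1 -
        C (2 * j + 2 : ℤ) * (hermiteParts j).2)

theorem hermite_add_two (n : ℕ) :
    hermite (n + 2) = X * hermite (n + 1) - C ((n : ℤ) + 1) * hermite n := by
  rw [hermite_succ (n + 1), derivative_hermite_succ]

theorem hermite_eq_expand_hermiteParts (j : ℕ) :
    hermite (2 * j) = expand ℤ 2 (hermiteParts j).1 ∧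
      hermite (2 * j + 1) = X * expand ℤ 2 (hermiteParts j).2 := by
  induction j with
  | zero => simp [hermiteParts]
  | succ j ih =>
    have h1 : hermite (2 * (j + 1)) = expand ℤ 2 (hermiteParts (j + 1)).1 := by
      rw [show 2 * (j + 1) = 2 * j + 2 by ring, hermite_add_two, ih.1, ih.2, hermiteParts]
      simp only [map_sub, map_mul, expand_X, expand_C]
      push_cast
      ring
    refine ⟨h1, ?_⟩
    rw [show 2 * (j + 1) + 1 = 2 * j + 1 + 2 by ring, hermite_add_two,
      show 2 * j + 1 + 1 = 2 * (j + 1) by ring, h1, ih.2, hermiteParts]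
    simp only [map_sub, map_mul, expand_X, expand_C]
    push_cast
    rw [show (2 * j + 1 + 1 : ℤ) = 2 * j + 2 by ring]
    ring

theorem eval_hermiteParts (c : ℤ) (j : ℕ) :
    (hermiteParts (j + 1)).1.eval c =
      c * (hermiteParts j).2.eval c - (2 * j + 1) * (hermiteParts j).1.eval c ∧
    (hermiteParts (j + 1)).2.eval c =
      (hermiteParts (j + 1)).1.eval c - (2 * j + 2) * (hermiteParts j).2.eval c := by
  simp [hermiteParts]

theorem eval_hermiteParts_two_adic (m : ℤ) (t : ℕ) : ∃ u w : ℤ, Odd u ∧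
    (hermiteParts (2 * t)).1.eval (2 * m + 1) = 2 ^ t * u ∧
    (hermiteParts (2 * t)).2.eval (2 * m + 1) = 2 ^ t * (u + 4 * w) ∧
    (hermiteParts (2 * t + 1)).2.eval (2 * m + 1) = 2 ^ (t + 1) *
      (m * u - 2 * t * u + 2 * w * (2 * m + 1) - (2 * t + 1) * (u + 4 * w)) := by
  have hlast : ∀ (t : ℕ) (u w : ℤ), (hermiteParts (2 * t)).1.eval (2 * m + 1) = 2 ^ t * u →
      (hermiteParts (2 * t)).2.eval (2 * m + 1) = 2 ^ t * (u + 4 * w) →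
      (hermiteParts (2 * t + 1)).2.eval (2 * m + 1) = 2 ^ (t + 1) *
      (m * u - 2 * t * u + 2 * w * (2 * m + 1) - (2 * t + 1) * (u + 4 * w)) := by
    intro t u w h1 h2
    rw [(eval_hermiteParts _ _).2, (eval_hermiteParts _ _).1, h1, h2]
    push_cast
    ring
  induction t with
  | zero => exact ⟨1, 0, odd_one, by simp [hermiteParts], by simp [hermiteParts],
      hlast 0 1 0 (by simp [hermiteParts]) (by simp [hermiteParts])⟩
  | succ t ih =>
    obtain ⟨u, w, hu, h1, h2, h3⟩ := ih
    have h4 : (hermiteParts (2 * (t + 1))).1.eval (2 * m + 1) = 2 ^ (t + 1) *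
        ((2 * m - 4 * t - 2) * (m * u - 2 * t * u + 2 * w * (2 * m + 1)) -
          (2 * m + 1) * (2 * t + 1) * (u + 4 * w)) := by
      rw [show 2 * (t + 1) = 2 * t + 1 + 1 by ring, (eval_hermiteParts _ _).1, h3,
        (eval_hermiteParts _ _).1, h1, h2]
      push_cast
      ring
    have h5 : (hermiteParts (2 * (t + 1))).2.eval (2 * m + 1) = 2 ^ (t + 1) *
        ((2 * m - 4 * t - 2) * (m * u - 2 * t * u + 2 * w * (2 * m + 1)) -
          (2 * m + 1) * (2 * t + 1) * (u + 4 * w) + 4 * (-(t + 1) *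
        (m * u - 2 * t * u + 2 * w * (2 * m + 1) - (2 * t + 1) * (u + 4 * w)))) := by
      rw [show 2 * (t + 1) = 2 * t + 1 + 1 by ring, (eval_hermiteParts _ _).2,
        show 2 * t + 1 + 1 = 2 * (t + 1) by ring, h4, h3]
      push_cast
      ring
    refine ⟨_, _, ?_, h4, h5, hlast _ _ _ h4 h5⟩
    obtain ⟨v, rfl⟩ := hu
    refine ⟨(m - 2 * t - 1) * (m * (2 * v + 1) - 2 * t * (2 * v + 1) + 2 * w * (2 * m + 1)) -
      ((2 * m * t + m + t) * (2 * v + 1 + 4 * w) + v + 2 * w) - 1, by ring⟩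

theorem eval_ne_zero_of_odd {t : ℕ} {a : ℕ} (hat : a = 2 * t + 1) {P R F : ℤ[X]} (hR : P = X * R)
    (hF : R = expand ℤ 2 F)
    (hP : C (2 * a : ℤ) * P = (X ^ 2 - 1) * (C ((2 * a : ℤ) + 2) * hermite (2 * a + 1)) -
      2 * X * hermite (2 * a + 2)) {c : ℤ} (hc : Odd c) : F.eval c ≠ 0 := by
  intro h0
  obtain ⟨m, rfl⟩ := hc
  have h1 : C (2 * a : ℤ) * F = (X - 1) * (C ((2 * a : ℤ) + 2) * (hermiteParts a).2) -
      2 * (hermiteParts (a + 1)).1 := by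
    apply expand_injective two_pos
    apply mul_left_cancel₀ (X_ne_zero (R := ℤ))
    simp only [map_sub, map_mul (expand ℤ 2), expand_X, expand_C, map_one]
    rw [(hermite_eq_expand_hermiteParts a).2, show 2 * a + 2 = 2 * (a + 1) by ring,
      (hermite_eq_expand_hermiteParts (a + 1)).1, hR, hF] at hP
    have h2 : expand ℤ 2 (2 : ℤ[X]) = 2 := by
      rw [show (2 : ℤ[X]) = C 2 by rfl, expand_C]
    rw [h2]
    rw [C_mul] at hP ⊢
    linear_combination hP
  have h2 := congrArg (eval (2 * m + 1)) h1
  obtain ⟨u, w, hu, e1, e2, e3⟩ := eval_hermiteParts_two_adic m t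
  obtain ⟨u', w', hu', e1', e2', e3'⟩ := eval_hermiteParts_two_adic m (t + 1)
  simp only [eval_sub, eval_mul, eval_C, eval_X, eval_one, eval_ofNat, h0, mul_zero] at h2
  rw [hat, e3, show 2 * t + 1 + 1 = 2 * (t + 1) by ring, e1'] at h2
  obtain ⟨v, rfl⟩ := hu'
  have h3 : (2 : ℤ) ^ (t + 1) ≠ 0 := by positivity
  have h4 : 2 * (2 * v + 1) = 2 * m * ((2 * (2 * t + 1) + 2) *
      (m * u - 2 * t * u + 2 * w * (2 * m + 1) - (2 * t + 1) * (u + 4 * w))) := by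
    apply mul_left_cancel₀ h3
    push_cast at h2
    linear_combination h2
  generalize (m * u - 2 * t * u + 2 * w * (2 * m + 1) - (2 * t + 1) * (u + 4 * w)) = B at h4
  have h5 : 2 * v + 1 = 2 * (2 * (m * (t + 1) * B)) := by linarith
  omega

theorem coeff_comp_neg_X (g : ℤ[X]) (m : ℕ) : (g.comp (-X)).coeff m = (-1) ^ m * g.coeff m := by
  have h : (-X : ℤ[X]) = C (-1) * X := by simp
  rw [h, comp_C_mul_X_coeff, mul_comm]

theorem exists_expand_two_eq_mul_comp_neg_X (g : ℤ[X]) :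
    ∃ G : ℤ[X], expand ℤ 2 G = g * g.comp (-X) := by
  have hsymm : (g * g.comp (-X)).comp (-X) = g * g.comp (-X) := by
    rw [mul_comp, comp_assoc]
    simp [mul_comm]
  refine ⟨contract 2 (g * g.comp (-X)), ?_⟩
  ext m
  rw [coeff_expand two_pos]
  split_ifs with hm
  · rw [coeff_contract two_ne_zero, Nat.div_mul_cancel hm]
  · have h1 := congrArg (fun q : ℤ[X] => q.coeff m) hsymm
    simp only [coeff_comp_neg_X] at h1
    have hodd : Odd m := Nat.not_even_iff_odd.1 fun h => hm h.two_dvd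
    rw [hodd.neg_one_pow] at h1
    omega

theorem irreducible_expand_two {F : ℤ[X]} (hF : Irreducible F) (hm : F.Monic)
    (hsq : ¬ IsSquare (F.coeff 0).natAbs) : Irreducible (expand ℤ 2 F) := by
  have hcomp : (expand ℤ 2 F).comp (-X) = expand ℤ 2 F := by
    rw [expand_eq_comp_X_pow, comp_assoc]
    simp
  refine ⟨fun hu => ?_, ?_⟩
  · have h1 := natDegree_eq_zero_of_isUnit hu
    rw [natDegree_expand] at h1
    have h2 : F.natDegree = 0 := by omega
    exact hF.not_isUnit (by rw [eq_one_of_monic_natDegree_zero hm h2]; exact isUnit_one)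
  intro g h hgh
  obtain ⟨G, hG⟩ := exists_expand_two_eq_mul_comp_neg_X g
  obtain ⟨H, hH⟩ := exists_expand_two_eq_mul_comp_neg_X h
  have hGH : G * H = F ^ 2 := by
    apply expand_injective two_pos
    rw [map_mul, hG, hH, map_pow, sq]
    nth_rw 2 [← hcomp]
    rw [hgh, mul_comp]
    ring
  obtain ⟨i, hi, hass⟩ := (dvd_prime_pow hF.prime 2).1 (Dvd.intro H hGH)
  have hunit : ∀ g G : ℤ[X], expand ℤ 2 G = g * g.comp (-X) → IsUnit G → IsUnit g := by
    intro g G hG hGu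
    refine isUnit_of_mul_isUnit_left (y := g.comp (-X)) ?_
    rw [← hG]
    exact hGu.map (expand ℤ 2)
  interval_cases i
  · left
    exact hunit g G hG (by simpa using hass)
  · exfalso
    rw [pow_one] at hass
    obtain ⟨u, hu⟩ := hass
    obtain ⟨r, hr, hru⟩ := Polynomial.isUnit_iff.1 u.isUnit
    apply hsq
    have h1 : G.coeff 0 = g.coeff 0 * g.coeff 0 := by
      have := congrArg (fun q : ℤ[X] => q.coeff 0) hG
      simpa [coeff_comp_neg_X, coeff_expand two_pos, mul_coeff_zero] using this
    refine ⟨(g.coeff 0).natAbs, ?_⟩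
    rw [← Int.natAbs_mul, ← h1, ← hu, ← hru, mul_coeff_zero, coeff_C_zero, Int.natAbs_mul,
      Int.natAbs_of_isUnit hr, mul_one]
  · right
    refine hunit h H hH ?_
    obtain ⟨u, hu⟩ := hass
    have h0 : G ≠ 0 := by
      rintro rfl
      rw [zero_mul] at hGH
      exact pow_ne_zero 2 hF.ne_zero hGH.symm
    have h1 : G * H = G * u := by rw [hGH, hu]
    rw [mul_left_cancel₀ h0 h1]
    exact u.isUnit

theorem irreducible_of_no_small_factor {F : ℤ[X]} {k : ℕ} (hm : F.Monic) (hk : F.natDegree = k)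
    (hk0 : k ≠ 0) (h : ∀ G H : ℤ[X], F = G * H → G.Monic → H.Monic → 1 ≤ G.natDegree →
      2 * G.natDegree ≤ k → False) : Irreducible F := by
  have h1 : F ≠ 1 := by rintro rfl; simp at hk; omega
  refine hm.irreducible_iff_natDegree'.2 ⟨h1, ?_⟩
  intro f g hf hg hfg hmem
  rw [Finset.mem_Ioc, hk] at hmem
  exact h g f (by rw [← hfg, mul_comm]) hg hf hmem.1 (by omega)

theorem Nat.Prime.not_isSquare_of_not_sq_dvd {p m : ℕ} (hp : p.Prime) (h1 : p ∣ m)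
    (h2 : ¬ p ^ 2 ∣ m) : ¬ IsSquare m := by
  rintro ⟨r, rfl⟩
  have h3 : p ∣ r := (hp.dvd_mul.1 h1).elim id id
  exact h2 (by rw [sq]; exact mul_dvd_mul h3 h3)

theorem exists_prime_dvd_doubleFactorial {c : ℕ} (hc : 2 ≤ c) : ∃ p, p.Prime ∧ Odd p ∧ c < p ∧
    p ≤ 2 * c ∧ p ∣ (2 * c + 1)‼ ∧ ¬ p ^ 2 ∣ (2 * c + 1)‼ := by
  obtain ⟨p, hp, hcp, hpc⟩ := Nat.exists_prime_lt_and_le_two_mul c (by omega)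
  have hodd := hp.odd_of_ne_two (by omega)
  refine ⟨p, hp, hodd, hcp, hpc, ?_, fun h => hp.not_sq_dvd_factorial ?_⟩
  · obtain ⟨e, rfl⟩ := hodd
    exact dvd_doubleFactorial_of_le (by omega)
  · refine (h.trans ?_).trans (Nat.factorial_dvd_factorial (show 2 * c + 1 ≤ 2 * p - 1 by omega))
    rw [factorial_two_mul_add_one_eq]
    exact dvd_mul_left _ _

theorem not_isSquare_doubleFactorial {a : ℕ} (ha : 1 ≤ a) : ¬ IsSquare ((2 * a + 1)‼) := by
  obtain rfl | ha := ha.eq_or_lt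
  · exact Nat.prime_three.not_isSquare_of_not_sq_dvd (by decide) (by decide)
  · obtain ⟨p, hp, -, -, -, h1, h2⟩ := exists_prime_dvd_doubleFactorial ha
    exact hp.not_isSquare_of_not_sq_dvd h1 h2

theorem not_isSquare_mul_doubleFactorial {a : ℕ} (ha : 1 ≤ a) :
    ¬ IsSquare ((2 * a + 1) * (2 * a - 3)‼) := by
  obtain h | h := lt_or_ge a 5
  · interval_cases a
    · exact Nat.prime_three.not_isSquare_of_not_sq_dvd (by decide) (by decide)
    · exact Nat.prime_five.not_isSquare_of_not_sq_dvd (by decide) (by decide)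
    · exact Nat.prime_three.not_isSquare_of_not_sq_dvd (by decide) (by decide)
    · exact Nat.prime_five.not_isSquare_of_not_sq_dvd (by decide) (by decide)
  · obtain ⟨c, rfl⟩ := Nat.exists_eq_add_of_le' (show 2 ≤ a by omega)
    rw [show 2 * (c + 2) - 3 = 2 * c + 1 by omega]
    obtain ⟨p, hp, hodd, hcp, hpc, h1, h2⟩ := exists_prime_dvd_doubleFactorial (show 2 ≤ c by omega)
    refine hp.not_isSquare_of_not_sq_dvd (h1.mul_left _) fun h3 => h2 ?_
    refine (Nat.Coprime.pow_left 2 ((hp.coprime_iff_not_dvd).2 ?_)).dvd_of_dvd_mul_left h3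
    rintro ⟨m, hm⟩
    obtain ⟨e, rfl⟩ := hodd
    have hm3 : m < 3 := by
      by_contra! h
      nlinarith
    interval_cases m <;> omega

theorem coeff_quadratic_mul {G H : ℤ[X]} (hG : G.Monic) (h2 : G.natDegree = 2) :
    (G * H).coeff 0 = G.coeff 0 * H.coeff 0 ∧
    (G * H).coeff 1 = G.coeff 1 * H.coeff 0 + G.coeff 0 * H.coeff 1 ∧
    ∀ j, (G * H).coeff (j + 2) = H.coeff j + G.coeff 1 * H.coeff (j + 1) +
      G.coeff 0 * H.coeff (j + 2) := by
  have h3 : G = X ^ 2 + (C (G.coeff 1) * X + C (G.coeff 0)) := by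
    have h4 := hG.as_sum
    rw [h2] at h4
    conv_lhs => rw [h4]
    simp [Finset.sum_range_succ, add_comm]
  generalize G.coeff 1 = A at h3
  generalize G.coeff 0 = B at h3
  subst h3
  simp only [add_mul, coeff_add, mul_assoc, coeff_C_mul, coeff_X_pow_mul, coeff_X_mul]
  refine ⟨?_, ?_, fun j => ?_⟩
  · simp
  · simp [coeff_X_pow_mul']
  · ring

theorem IsTwoRowCore.coeff_eq {ε k : ℕ} {F : ℤ[X]} (hF : IsTwoRowCore ε k F) {c : ℤ}
    (h0 : F.coeff 0 = c) (j : ℕ) {x : ℤ}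
    (hx : k.choose j * ((2 * j + ε) ^ 2 - 4 * (2 * j + ε) + (2 * k + ε)) * (-1) ^ j * c =
      (2 * k + ε - 3 * ε) * (2 * j + 2 * ε - 1)‼ * x) (hk : (2 * k + ε - 3 * ε : ℤ) ≠ 0) :
    F.coeff j = x := by
  obtain ⟨b, hb1, hb2⟩ := hF.ratio j
  have h1 : ((2 * j + 2 * ε - 1)‼ : ℤ) ≠ 0 := by
    exact_mod_cast (Nat.doubleFactorial_pos _).ne'
  apply mul_left_cancel₀ (mul_ne_zero hk h1)
  rw [← hx, ← hb1, mul_assoc, hb2, h0]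
  ring

theorem IsTwoRowCore.no_quadratic_factor_ten {F G H : ℤ[X]} (hF : IsTwoRowCore 0 5 F)
    (h0 : F.coeff 0 = -135) (hGH : F = G * H) (hG : G.Monic) (hH : H.Monic)
    (h2 : G.natDegree = 2) : False := by
  have hd : H.natDegree = 3 := by
    have := hF.natDegree_eq
    rw [hGH, hG.natDegree_mul hH, h2] at this
    omega
  have hz : ∀ j, 3 < j → H.coeff j = 0 := fun j hj => coeff_eq_zero_of_natDegree_lt (by omega)
  have h3 : H.coeff 3 = 1 := by rw [← hd]; exact hH.coeff_natDegree
  obtain ⟨e0, e1, e⟩ := coeff_quadratic_mul (H := H) hG h2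
  rw [← hGH] at e0 e1 e
  have f1 := hF.coeff_eq h0 1 (x := 405) (by decide) (by decide)
  have f2 := hF.coeff_eq h0 2 (x := -450) (by decide) (by decide)
  have f3 := hF.coeff_eq h0 3 (x := 198) (by decide) (by decide)
  have f4 := hF.coeff_eq h0 4 (x := -27) (by decide) (by decide)
  have e2 := e 0
  have e3 := e 1
  have e4 := e 2
  simp only [Nat.reduceAdd, h3, hz 4 (by norm_num), f2, f3, f4] at e2 e3 e4
  rw [f1] at e1
  rw [h0] at e0
  generalize H.coeff 0 = u0 at *
  generalize H.coeff 1 = u1 at *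
  generalize H.coeff 2 = u2 at *
  generalize G.coeff 0 = B at *
  generalize G.coeff 1 = A at *
  have key : ∀ A B : ZMod 13, let u2 := -27 - A; let u1 := 198 - A * u2 - B;
      let u0 := -450 - A * u1 - B * u2; ¬ (405 = A * u0 + B * u1 ∧ -135 = B * u0) := by
    decide +kernel
  have g2 : u2 = -27 - A := by linarith
  have g1 : u1 = 198 - A * u2 - B := by linarith
  have g0 : u0 = -450 - A * u1 - B * u2 := by linarith
  subst g2
  subst g1
  subst g0
  refine key A B ⟨?_, ?_⟩
  · exact_mod_cast congrArg (Int.cast : ℤ → ZMod 13) e1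
  · exact_mod_cast congrArg (Int.cast : ℤ → ZMod 13) e0

theorem IsTwoRowCore.no_quadratic_factor_seventeen {F G H : ℤ[X]} (hF : IsTwoRowCore 1 8 F)
    (h0 : F.coeff 0 = 2027025) (hGH : F = G * H) (hG : G.Monic) (hH : H.Monic)
    (h2 : G.natDegree = 2) : False := by
  have hd : H.natDegree = 6 := by
    have := hF.natDegree_eq
    rw [hGH, hG.natDegree_mul hH, h2] at this
    omega
  have hz : ∀ j, 6 < j → H.coeff j = 0 := fun j hj => coeff_eq_zero_of_natDegree_lt (by omega)
  have h6 : H.coeff 6 = 1 := by rw [← hd]; exact hH.coeff_natDegree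
  obtain ⟨e0, e1, e⟩ := coeff_quadratic_mul (H := H) hG h2
  rw [← hGH] at e0 e1 e
  have f1 := hF.coeff_eq h0 1 (x := -5405400) (by decide) (by decide)
  have f2 := hF.coeff_eq h0 2 (x := 5945940) (by decide) (by decide)
  have f3 := hF.coeff_eq h0 3 (x := -2934360) (by decide) (by decide)
  have f4 := hF.coeff_eq h0 4 (x := 664950) (by decide) (by decide)
  have f5 := hF.coeff_eq h0 5 (x := -73320) (by decide) (by decide)
  have f6 := hF.coeff_eq h0 6 (x := 4020) (by decide) (by decide)
  have f7 := hF.coeff_eq h0 7 (x := -104) (by decide) (by decide)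
  have e2 := e 0
  have e3 := e 1
  have e4 := e 2
  have e5 := e 3
  have e6 := e 4
  have e7 := e 5
  simp only [Nat.reduceAdd, h6, hz 7 (by norm_num), f2, f3, f4, f5, f6, f7] at e2 e3 e4 e5 e6 e7
  rw [f1] at e1
  rw [h0] at e0
  generalize H.coeff 0 = u0 at *
  generalize H.coeff 1 = u1 at *
  generalize H.coeff 2 = u2 at *
  generalize H.coeff 3 = u3 at *
  generalize H.coeff 4 = u4 at *
  generalize H.coeff 5 = u5 at *
  generalize G.coeff 0 = B at *
  generalize G.coeff 1 = A at *
  have key : ∀ A B : ZMod 23, let u5 := -104 - A; let u4 := 4020 - A * u5 - B;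
      let u3 := -73320 - A * u4 - B * u5; let u2 := 664950 - A * u3 - B * u4;
      let u1 := -2934360 - A * u2 - B * u3; let u0 := 5945940 - A * u1 - B * u2;
      ¬ (-5405400 = A * u0 + B * u1 ∧ 2027025 = B * u0) := by
    decide +kernel
  have g5 : u5 = -104 - A := by linarith
  have g4 : u4 = 4020 - A * u5 - B := by linarith
  have g3 : u3 = -73320 - A * u4 - B * u5 := by linarith
  have g2 : u2 = 664950 - A * u3 - B * u4 := by linarith
  have g1 : u1 = -2934360 - A * u2 - B * u3 := by linarith
  have g0 : u0 = 5945940 - A * u1 - B * u2 := by linarith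
  subst g5
  subst g4
  subst g3
  subst g2
  subst g1
  subst g0
  refine key A B ⟨?_, ?_⟩
  · exact_mod_cast congrArg (Int.cast : ℤ → ZMod 23) e1
  · exact_mod_cast congrArg (Int.cast : ℤ → ZMod 23) e0

theorem exists_eq_pow_mul_of_prime_le_seven {M : ℕ} (hM : M ≠ 0)
    (h : ∀ p, p.Prime → p ∣ M → p ≤ 7) :
    ∃ a b c d, M = 2 ^ a * 3 ^ b * 5 ^ c * 7 ^ d := by
  obtain ⟨a, m₁, h2, rfl⟩ := Nat.exists_eq_pow_mul_and_not_dvd hM 2 (by norm_num)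
  have hm₁ : m₁ ≠ 0 := by rintro rfl; simp at hM
  obtain ⟨b, m₂, h3, rfl⟩ := Nat.exists_eq_pow_mul_and_not_dvd hm₁ 3 (by norm_num)
  have hm₂ : m₂ ≠ 0 := by rintro rfl; simp at hM
  obtain ⟨c, m₃, h5, rfl⟩ := Nat.exists_eq_pow_mul_and_not_dvd hm₂ 5 (by norm_num)
  have hm₃ : m₃ ≠ 0 := by rintro rfl; simp at hM
  obtain ⟨d, m₄, h7, rfl⟩ := Nat.exists_eq_pow_mul_and_not_dvd hm₃ 7 (by norm_num)
  refine ⟨a, b, c, d, ?_⟩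
  have h1 : m₄ = 1 := by
    by_contra hne
    obtain ⟨p, hp, hpm⟩ := Nat.exists_prime_and_dvd hne
    have hp7 : p ≤ 7 := h p hp (hpm.mul_left _ |>.mul_left _ |>.mul_left _ |>.mul_left _)
    have := hp.two_le
    interval_cases p
    · exact h2 (hpm.mul_left _ |>.mul_left _ |>.mul_left _)
    · exact h3 (hpm.mul_left _ |>.mul_left _)
    · exact absurd hp (by decide)
    · exact h5 (hpm.mul_left _)
    · exact absurd hp (by decide)
    · exact h7 hpm
  rw [h1]
  ring

theorem exists_eq_pow_mul_of_forall_prime {M : ℕ} (hM : M ≠ 0)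
    (h : ∀ p, p.Prime → p ∣ M → p = 2 ∨ p = 3 ∨ p = 5 ∨ p = 7) :
    ∃ a b c d, M = 2 ^ a * 3 ^ b * 5 ^ c * 7 ^ d ∧ 2 ^ a ∣ M ∧ 3 ^ b ∣ M ∧
      5 ^ c ∣ M ∧ 7 ^ d ∣ M := by
  obtain ⟨a, b, c, d, rfl⟩ := exists_eq_pow_mul_of_prime_le_seven hM
    fun p hp hpM => by have := h p hp hpM; omega
  refine ⟨a, b, c, d, rfl, ?_, ?_, ?_, ?_⟩
  · exact ((dvd_mul_right _ _).mul_right _).mul_right _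
  · exact ((dvd_mul_left _ _).mul_right _).mul_right _
  · exact (dvd_mul_left _ _).mul_right _
  · exact dvd_mul_left _ _

theorem eq_zero_or_dvd_of_pow_dvd {p b M : ℕ} (h : p ^ b ∣ M) : b = 0 ∨ p ∣ M :=
  or_iff_not_imp_left.2 fun h0 => (dvd_pow_self p h0).trans h

theorem eq_zero_of_pow_dvd {p b M : ℕ} (h : p ^ b ∣ M) (hn : ¬ p ∣ M) : b = 0 :=
  (eq_zero_or_dvd_of_pow_dvd h).resolve_right hn

theorem three_pow_ne_two_pow_add_one {a b : ℕ} (hb : 4 ≤ b) : 3 ^ a ≠ 2 ^ b + 1 := by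
  intro h
  have h3 : 3 ^ a % 80 = 1 ∨ 3 ^ a % 80 = 3 ∨ 3 ^ a % 80 = 9 ∨ 3 ^ a % 80 = 27 := by
    clear h
    induction a with
    | zero => simp
    | succ a ih => rw [pow_succ]; omega
  have h2 : 16 ∣ 2 ^ b := pow_dvd_pow 2 hb
  have h5 : ¬ 5 ∣ 2 ^ b := fun h => absurd (Nat.prime_five.dvd_of_dvd_pow h) (by decide)
  omega

theorem five_pow_add_one_ne {b c : ℕ} (hb : 2 ≤ b) : 5 ^ c + 1 ≠ 2 * 3 ^ b := by
  intro h
  have h5 : 5 ^ c % 63 = 1 ∨ 5 ^ c % 63 = 5 ∨ 5 ^ c % 63 = 25 ∨ 5 ^ c % 63 = 62 ∨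
      5 ^ c % 63 = 58 ∨ 5 ^ c % 63 = 38 := by
    clear h
    induction c with
    | zero => simp
    | succ a ih => rw [pow_succ]; omega
  have h9 : 9 ∣ 3 ^ b := pow_dvd_pow 3 hb
  have h7 : ¬ 7 ∣ 3 ^ b := fun h =>
    absurd (Nat.Prime.dvd_of_dvd_pow (by norm_num : Nat.Prime 7) h) (by decide)
  omega

theorem two_pow_sub_one_smooth {a b c : ℕ} (h : 2 ^ a = 3 ^ b * 5 ^ c + 1) : b ≤ 1 ∧ c ≤ 1 := by
  have hnd : ∀ p : ℕ, p.Prime → p ≠ 3 → p ≠ 5 → ¬ p ∣ 3 ^ b * 5 ^ c := by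
    intro p hp h3 h5 hd
    obtain hd | hd := hp.dvd_mul.1 hd
    · exact h3 ((Nat.prime_dvd_prime_iff_eq hp Nat.prime_three).1 (hp.dvd_of_dvd_pow hd))
    · exact h5 ((Nat.prime_dvd_prime_iff_eq hp Nat.prime_five).1 (hp.dvd_of_dvd_pow hd))
  constructor
  · by_contra! hb
    have h9 : 9 ∣ 3 ^ b * 5 ^ c := (pow_dvd_pow 3 hb).mul_right _
    have h7 := hnd 7 (by norm_num) (by norm_num) (by norm_num)
    have h2 : 2 ^ a % 63 = 1 ∨ 2 ^ a % 63 = 2 ∨ 2 ^ a % 63 = 4 ∨ 2 ^ a % 63 = 8 ∨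
        2 ^ a % 63 = 16 ∨ 2 ^ a % 63 = 32 := by
      clear * -
      induction a with
      | zero => simp
      | succ a ih => rw [pow_succ]; omega
    omega
  · by_contra! hc
    have h25 : 25 ∣ 3 ^ b * 5 ^ c := (pow_dvd_pow 5 hc).mul_left _
    have h11 := hnd 11 (by norm_num) (by norm_num) (by norm_num)
    have h2 : ∃ r < 20, 2 ^ a % 275 = 2 ^ r % 275 := by
      refine ⟨a % 20, Nat.mod_lt _ (by norm_num), ?_⟩
      conv_lhs => rw [← Nat.div_add_mod a 20, pow_add, pow_mul, Nat.mul_mod, Nat.pow_mod]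
      norm_num
    obtain ⟨r, hr, h2⟩ := h2
    interval_cases r <;> omega

theorem eq_ten_of_smooth {N a b b' : ℕ} (hN : 8 ≤ N) (e1 : N - 1 = 3 ^ b)
    (e2 : N - 2 = 2 ^ a * 3 ^ b') : N = 10 := by
  have hb : b ≠ 0 := by rintro rfl; rw [pow_zero] at e1; omega
  have h3 : 3 ∣ N - 1 := e1 ▸ dvd_pow_self 3 hb
  have hb' : b' = 0 := by
    by_contra h
    have : 3 ∣ N - 2 := e2 ▸ (dvd_pow_self 3 h).mul_left _
    omega
  rw [hb', pow_zero, mul_one] at e2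
  have ha4 : a < 4 := by
    by_contra! h
    exact three_pow_ne_two_pow_add_one (a := b) h (by omega)
  interval_cases a <;> omega

theorem eq_seventeen_of_smooth {N a b b' c' : ℕ} (hN : 8 ≤ N) (hodd : N % 2 = 1)
    (e1 : N - 1 = 2 ^ a * 3 ^ b) (e2 : N - 2 = 3 ^ b' * 5 ^ c') : N = 17 := by
  obtain rfl | hb := Nat.eq_zero_or_pos b
  · rw [pow_zero, mul_one] at e1
    obtain ⟨hb', hc'⟩ := two_pow_sub_one_smooth (a := a) (b := b') (c := c') (by omega)
    interval_cases b' <;> interval_cases c' <;> omega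
  · have h3 : 3 ∣ N - 1 := e1 ▸ (dvd_pow_self 3 hb.ne').mul_left _
    have hb' : b' = 0 := by
      by_contra h
      have : 3 ∣ N - 2 := e2 ▸ (dvd_pow_self 3 h).mul_right _
      omega
    rw [hb', pow_zero, one_mul] at e2
    have h4 : 5 ^ c' % 4 = 1 := by rw [Nat.pow_mod]; simp
    have ha2 : a < 2 := by
      by_contra! h
      have : 4 ∣ N - 1 := e1 ▸ (pow_dvd_pow 2 h).mul_right _
      omega
    have ha0 : a ≠ 0 := by
      rintro rfl
      have : Odd (N - 1) := by rw [e1, pow_zero, one_mul]; exact Odd.pow (by decide)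
      rw [Nat.odd_iff] at this
      omega
    have ha1 : a = 1 := by omega
    rw [ha1, pow_one] at e1
    have hb2 : 2 ≤ b := by
      by_contra! h
      interval_cases b
      omega
    exact absurd (show 5 ^ c' + 1 = 2 * 3 ^ b by omega) (five_pow_add_one_ne hb2)

theorem exists_prime_dvd_sub_four {N : ℕ} (hN : 8 ≤ N) (h10 : N ≠ 10) (h17 : N ≠ 17) :
    ∃ p i, p.Prime ∧ 1 ≤ i ∧ i < 4 ∧ i ≠ 3 ∧ p ∣ N - i ∧ 4 + 1 ≤ p ∧
      (Even N ∨ 4 + 1 < p ∨ Odd i) := by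
  by_contra! hbad
  have small : ∀ p, p.Prime → p ≤ 5 → p = 2 ∨ p = 3 ∨ p = 5 := by
    intro p hp h
    have := hp.two_le
    interval_cases p <;> first | omega | exact absurd hp (by decide)
  have h1 : ∀ p, p.Prime → p ∣ N - 1 → p = 2 ∨ p = 3 := by
    intro p hp hd
    have h5 : p < 5 := by
      by_contra! h
      exact (hbad p 1 hp (by norm_num) (by norm_num) (by norm_num) hd h).2.2 (by decide)
    have := small p hp h5.le
    omega
  have h2 : ∀ p, p.Prime → p ∣ N - 2 → p = 2 ∨ p = 3 ∨ p = 5 ∧ Odd N := by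
    intro p hp hd
    by_cases h5 : 5 ≤ p
    · obtain ⟨e1, e2, -⟩ := hbad p 2 hp (by norm_num) (by norm_num) (by norm_num) hd h5
      exact Or.inr (Or.inr ⟨by omega, Nat.not_even_iff_odd.1 e1⟩)
    · have := small p hp (by omega)
      omega
  obtain ⟨a, b, c, d, e1, a1, b1, c1, d1⟩ := exists_eq_pow_mul_of_forall_prime
    (show N - 1 ≠ 0 by omega) fun p hp hd => by have := h1 p hp hd; tauto
  obtain ⟨a', b', c', d', e2, a2, b2, c2, d2⟩ := exists_eq_pow_mul_of_forall_prime
    (show N - 2 ≠ 0 by omega) fun p hp hd => by have := h2 p hp hd; tauto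
  have hc : c = 0 := eq_zero_of_pow_dvd c1 fun h => by simpa using h1 5 Nat.prime_five h
  have hd : d = 0 := eq_zero_of_pow_dvd d1 fun h => by simpa using h1 7 (by norm_num) h
  have hd' : d' = 0 := eq_zero_of_pow_dvd d2 fun h => by simpa using h2 7 (by norm_num) h
  rw [hc, hd, pow_zero, pow_zero, mul_one, mul_one] at e1
  rw [hd', pow_zero, mul_one] at e2
  obtain hN2 | hN2 := Nat.even_or_odd N
  · have hc' : c' = 0 := eq_zero_of_pow_dvd c2 fun h => by
      simpa [Nat.not_odd_iff_even.2 hN2] using h2 5 Nat.prime_five h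
    rw [hc', pow_zero, mul_one] at e2
    rw [Nat.even_iff] at hN2
    have ha : a = 0 := eq_zero_of_pow_dvd a1 (by clear e1 e2; omega)
    rw [ha, pow_zero, one_mul] at e1
    exact h10 (eq_ten_of_smooth hN e1 e2)
  · rw [Nat.odd_iff] at hN2
    have ha : a' = 0 := eq_zero_of_pow_dvd a2 (by clear e1 e2; omega)
    rw [ha, pow_zero, one_mul] at e2
    exact h17 (eq_seventeen_of_smooth hN hN2 e1 e2)

theorem pow_dvd_of_eq_pow {p b M : ℕ} (k : ℕ) (hp : 1 < p) (h : M = p ^ b) (hk : p ^ k < M) :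
    p ^ k ∣ M := by
  subst h
  exact pow_dvd_pow p ((Nat.pow_lt_pow_iff_right hp).1 hk).le

theorem exponent_le_of_not_dvd {p a M R : ℕ} (k : ℕ) (h : M = p ^ a * R)
    (hk : ¬ p ^ (k + 1) ∣ M) : a ≤ k := by
  by_contra! hlt
  exact hk (h ▸ (pow_dvd_pow p hlt).mul_right R)

theorem three_pow_mod_eight (b : ℕ) : 3 ^ b % 8 = 1 ∨ 3 ^ b % 8 = 3 := by
  induction b with
  | zero => simp
  | succ b ih => rw [pow_succ]; omega

theorem seven_pow_mod (b : ℕ) : 7 ^ b % 160 = 1 ∨ 7 ^ b % 160 = 7 ∨ 7 ^ b % 160 = 49 ∨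
    7 ^ b % 160 = 23 := by
  induction b with
  | zero => simp
  | succ b ih => rw [pow_succ]; omega

theorem two_pow_mod_seven (b : ℕ) : 2 ^ b % 7 = 1 ∨ 2 ^ b % 7 = 2 ∨ 2 ^ b % 7 = 4 := by
  induction b with
  | zero => simp
  | succ b ih => rw [pow_succ]; omega

theorem false_of_five_smooth {N b₁ c₁ b₅ c₅ a₂ b₂ c₂ a₄ b₄ c₄ : ℕ} (hN : 1000 ≤ N)
    (e₁ : N - 1 = 3 ^ b₁ * 5 ^ c₁) (e₅ : N - 5 = 3 ^ b₅ * 5 ^ c₅)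
    (e₂ : N - 2 = 2 ^ a₂ * 3 ^ b₂ * 5 ^ c₂) (e₄ : N - 4 = 2 ^ a₄ * 3 ^ b₄ * 5 ^ c₄)
    (hc₁ : 5 ^ c₁ ∣ N - 1) (hb₅ : 3 ^ b₅ ∣ N - 5) (hc₅ : 5 ^ c₅ ∣ N - 5)
    (hb₂ : 3 ^ b₂ ∣ N - 2) (hc₂ : 5 ^ c₂ ∣ N - 2)
    (hb₄ : 3 ^ b₄ ∣ N - 4) (hc₄ : 5 ^ c₄ ∣ N - 4) : False := by
  obtain rfl | h5 := eq_zero_or_dvd_of_pow_dvd hc₁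
  · rw [pow_zero, mul_one] at e₁
    have h9 := pow_dvd_of_eq_pow 2 (by norm_num) e₁ (by clear e₁ e₂ e₄ e₅; omega)
    have h0 : b₅ = 0 := eq_zero_of_pow_dvd hb₅ (by clear e₁ e₂ e₄ e₅; omega)
    rw [h0, pow_zero, one_mul] at e₅
    have h5 := pow_dvd_of_eq_pow 1 (by norm_num) e₅ (by clear e₁ e₂ e₄ e₅; omega)
    have h0 : c₂ = 0 := eq_zero_of_pow_dvd hc₂ (by clear e₁ e₂ e₄ e₅; omega)
    have h0' : b₂ = 0 := eq_zero_of_pow_dvd hb₂ (by clear e₁ e₂ e₄ e₅; omega)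
    rw [h0, h0', pow_zero, pow_zero, mul_one, mul_one] at e₂
    have h4 := pow_dvd_of_eq_pow 2 (by norm_num) e₂ (by clear e₁ e₂ e₄ e₅; omega)
    have h0 : c₄ = 0 := eq_zero_of_pow_dvd hc₄ (by clear e₁ e₂ e₄ e₅; omega)
    rw [h0, pow_zero, mul_one] at e₄
    have ha := exponent_le_of_not_dvd 1 e₄ (by clear e₁ e₂ e₄ e₅; norm_num; omega)
    have hb := exponent_le_of_not_dvd 1 (e₄.trans (mul_comm _ _))
      (by clear e₁ e₂ e₄ e₅; norm_num; omega)
    interval_cases a₄ <;> interval_cases b₄ <;> omega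
  · have h0 : c₅ = 0 := eq_zero_of_pow_dvd hc₅ (by clear e₁ e₂ e₄ e₅; omega)
    rw [h0, pow_zero, mul_one] at e₅
    have h9 := pow_dvd_of_eq_pow 2 (by norm_num) e₅ (by clear e₁ e₂ e₄ e₅; omega)
    have h0 : c₄ = 0 := eq_zero_of_pow_dvd hc₄ (by clear e₁ e₂ e₄ e₅; omega)
    have h0' : b₄ = 0 := eq_zero_of_pow_dvd hb₄ (by clear e₁ e₂ e₄ e₅; omega)
    rw [h0, h0', pow_zero, pow_zero, mul_one, mul_one] at e₄
    have h4 := pow_dvd_of_eq_pow 2 (by norm_num) e₄ (by clear e₁ e₂ e₄ e₅; omega)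
    have h0 : c₂ = 0 := eq_zero_of_pow_dvd hc₂ (by clear e₁ e₂ e₄ e₅; omega)
    rw [h0, pow_zero, mul_one] at e₂
    have ha := exponent_le_of_not_dvd 1 e₂ (by clear e₁ e₂ e₄ e₅; norm_num; omega)
    have hb := exponent_le_of_not_dvd 1 (e₂.trans (mul_comm _ _))
      (by clear e₁ e₂ e₄ e₅; norm_num; omega)
    interval_cases a₂ <;> interval_cases b₂ <;> omega

theorem false_of_seven_smooth_mod_three_eq_zero {N a₁ b₁ c₁ a₅ b₅ c₅ b₂ c₂ d₂ b₄ c₄ d₄ : ℕ}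
    (hN : 1000 ≤ N)
    (h3 : N % 3 = 0)
    (e₁ : N - 1 = 2 ^ a₁ * 3 ^ b₁ * 5 ^ c₁) (e₅ : N - 5 = 2 ^ a₅ * 3 ^ b₅ * 5 ^ c₅)
    (e₂ : N - 2 = 3 ^ b₂ * 5 ^ c₂ * 7 ^ d₂) (e₄ : N - 4 = 3 ^ b₄ * 5 ^ c₄ * 7 ^ d₄)
    (hb₁ : 3 ^ b₁ ∣ N - 1) (hc₁ : 5 ^ c₁ ∣ N - 1)
    (hb₅ : 3 ^ b₅ ∣ N - 5) (hc₅ : 5 ^ c₅ ∣ N - 5)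
    (hb₂ : 3 ^ b₂ ∣ N - 2) (hc₂ : 5 ^ c₂ ∣ N - 2)
    (hb₄ : 3 ^ b₄ ∣ N - 4) (hc₄ : 5 ^ c₄ ∣ N - 4) :
    False := by
  have g₁ : b₁ = 0 := eq_zero_of_pow_dvd hb₁ (by clear e₁ e₂ e₄ e₅; omega)
  have g₅ : b₅ = 0 := eq_zero_of_pow_dvd hb₅ (by clear e₁ e₂ e₄ e₅; omega)
  have g₂ : b₂ = 0 := eq_zero_of_pow_dvd hb₂ (by clear e₁ e₂ e₄ e₅; omega)
  have g₄ : b₄ = 0 := eq_zero_of_pow_dvd hb₄ (by clear e₁ e₂ e₄ e₅; omega)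
  rw [g₁, pow_zero, mul_one] at e₁
  rw [g₅, pow_zero, mul_one] at e₅
  rw [g₂, pow_zero, one_mul] at e₂
  rw [g₄, pow_zero, one_mul] at e₄
  have h5 : 5 ∣ N - 1 ∨ 5 ∣ N - 5 := by
    obtain rfl | h := eq_zero_or_dvd_of_pow_dvd hc₁
    · refine Or.inr ((eq_zero_or_dvd_of_pow_dvd hc₅).resolve_left ?_)
      rintro rfl
      rw [pow_zero, mul_one] at e₁ e₅
      have h8 := pow_dvd_of_eq_pow 3 (by norm_num) e₁ (by clear e₁ e₂ e₄ e₅; omega)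
      have h8' := pow_dvd_of_eq_pow 3 (by norm_num) e₅ (by clear e₁ e₂ e₄ e₅; omega)
      omega
    · exact Or.inl h
  have g₂ : c₂ = 0 := eq_zero_of_pow_dvd hc₂ (by clear e₁ e₂ e₄ e₅; omega)
  have g₄ : c₄ = 0 := eq_zero_of_pow_dvd hc₄ (by clear e₁ e₂ e₄ e₅; omega)
  rw [g₂, pow_zero, one_mul] at e₂
  rw [g₄, pow_zero, one_mul] at e₄
  have h7 := pow_dvd_of_eq_pow 1 (by norm_num) e₂ (by clear e₁ e₂ e₄ e₅; omega)
  have h7' := pow_dvd_of_eq_pow 1 (by norm_num) e₄ (by clear e₁ e₂ e₄ e₅; omega)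
  omega

theorem false_of_seven_smooth_mod_three_eq_one {N a₁ b₁ c₁ a₅ b₅ c₅ b₂ c₂ d₂ b₄ c₄ d₄ : ℕ}
    (hN : 1000 ≤ N)
    (h3 : N % 3 = 1)
    (e₁ : N - 1 = 2 ^ a₁ * 3 ^ b₁ * 5 ^ c₁) (e₅ : N - 5 = 2 ^ a₅ * 3 ^ b₅ * 5 ^ c₅)
    (e₂ : N - 2 = 3 ^ b₂ * 5 ^ c₂ * 7 ^ d₂) (e₄ : N - 4 = 3 ^ b₄ * 5 ^ c₄ * 7 ^ d₄)
    (hb₁ : 3 ^ b₁ ∣ N - 1) (hc₁ : 5 ^ c₁ ∣ N - 1)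
    (hb₅ : 3 ^ b₅ ∣ N - 5) (hc₅ : 5 ^ c₅ ∣ N - 5)
    (hb₂ : 3 ^ b₂ ∣ N - 2) (hc₂ : 5 ^ c₂ ∣ N - 2)
    (hc₄ : 5 ^ c₄ ∣ N - 4) (hd₄ : 7 ^ d₄ ∣ N - 4) :
    False := by
  have g₅ : b₅ = 0 := eq_zero_of_pow_dvd hb₅ (by clear e₁ e₂ e₄ e₅; omega)
  have g₂ : b₂ = 0 := eq_zero_of_pow_dvd hb₂ (by clear e₁ e₂ e₄ e₅; omega)
  rw [g₅, pow_zero, mul_one] at e₅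
  rw [g₂, pow_zero, one_mul] at e₂
  obtain rfl | h5 := eq_zero_or_dvd_of_pow_dvd hc₅
  · rw [pow_zero, mul_one] at e₅
    have h16 := pow_dvd_of_eq_pow 4 (by norm_num) e₅ (by clear e₁ e₂ e₄ e₅; omega)
    have h7 := two_pow_mod_seven a₅
    rw [← e₅] at h7
    have g₄ : d₄ = 0 := eq_zero_of_pow_dvd hd₄ (by clear e₁ e₂ e₄ e₅; omega)
    rw [g₄, pow_zero, mul_one] at e₄
    obtain rfl | h5 := eq_zero_or_dvd_of_pow_dvd hc₄
    · rw [pow_zero, mul_one] at e₄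
      have ha : 4 ≤ a₅ := by
        by_contra! h
        interval_cases a₅ <;> omega
      exact three_pow_ne_two_pow_add_one (a := b₄) ha (by omega)
    · have g₂ : c₂ = 0 := eq_zero_of_pow_dvd hc₂ (by clear e₁ e₂ e₄ e₅; omega)
      rw [g₂, pow_zero, one_mul] at e₂
      have := seven_pow_mod d₂
      rw [← e₂] at this
      clear e₁ e₂ e₄ e₅
      omega
  · have g₁ : c₁ = 0 := eq_zero_of_pow_dvd hc₁ (by clear e₁ e₂ e₄ e₅; omega)
    have g₂ : c₂ = 0 := eq_zero_of_pow_dvd hc₂ (by clear e₁ e₂ e₄ e₅; omega)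
    have g₄ : c₄ = 0 := eq_zero_of_pow_dvd hc₄ (by clear e₁ e₂ e₄ e₅; omega)
    rw [g₁, pow_zero, mul_one] at e₁
    rw [g₂, pow_zero, one_mul] at e₂
    rw [g₄, pow_zero, mul_one] at e₄
    have h7 := pow_dvd_of_eq_pow 1 (by norm_num) e₂ (by clear e₁ e₂ e₄ e₅; omega)
    have g₄ : d₄ = 0 := eq_zero_of_pow_dvd hd₄ (by clear e₁ e₂ e₄ e₅; omega)
    rw [g₄, pow_zero, mul_one] at e₄
    have h9 := pow_dvd_of_eq_pow 2 (by norm_num) e₄ (by clear e₁ e₂ e₄ e₅; omega)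
    have hb := exponent_le_of_not_dvd 1 (e₁.trans (mul_comm _ _))
      (by clear e₁ e₂ e₄ e₅; norm_num; omega)
    have ha : 4 ≤ a₁ := by
      by_contra! h
      clear e₂ e₄ e₅
      interval_cases a₁ <;> interval_cases b₁ <;> omega
    have h16 : 2 ^ 4 ∣ N - 1 := e₁ ▸ (pow_dvd_pow 2 ha).mul_right _
    have := seven_pow_mod d₂
    rw [← e₂] at this
    clear e₁ e₂ e₄ e₅
    omega

theorem false_of_seven_smooth_mod_three_eq_two {N a₁ b₁ c₁ a₅ b₅ c₅ b₂ c₂ d₂ b₄ c₄ d₄ : ℕ}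
    (hN : 1000 ≤ N)
    (h3 : N % 3 = 2)
    (e₁ : N - 1 = 2 ^ a₁ * 3 ^ b₁ * 5 ^ c₁) (e₅ : N - 5 = 2 ^ a₅ * 3 ^ b₅ * 5 ^ c₅)
    (e₂ : N - 2 = 3 ^ b₂ * 5 ^ c₂ * 7 ^ d₂) (e₄ : N - 4 = 3 ^ b₄ * 5 ^ c₄ * 7 ^ d₄)
    (hb₁ : 3 ^ b₁ ∣ N - 1) (hc₁ : 5 ^ c₁ ∣ N - 1)
    (hb₅ : 3 ^ b₅ ∣ N - 5) (hc₅ : 5 ^ c₅ ∣ N - 5)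
    (hc₂ : 5 ^ c₂ ∣ N - 2) (hd₂ : 7 ^ d₂ ∣ N - 2)
    (hb₄ : 3 ^ b₄ ∣ N - 4) (hc₄ : 5 ^ c₄ ∣ N - 4) :
    False := by
  have g₁ : b₁ = 0 := eq_zero_of_pow_dvd hb₁ (by clear e₁ e₂ e₄ e₅; omega)
  have g₄ : b₄ = 0 := eq_zero_of_pow_dvd hb₄ (by clear e₁ e₂ e₄ e₅; omega)
  rw [g₁, pow_zero, mul_one] at e₁
  rw [g₄, pow_zero, one_mul] at e₄
  obtain rfl | h5 := eq_zero_or_dvd_of_pow_dvd hc₁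
  · rw [pow_zero, mul_one] at e₁
    have h32 := pow_dvd_of_eq_pow 5 (by norm_num) e₁ (by clear e₁ e₂ e₄ e₅; omega)
    obtain rfl | h5 := eq_zero_or_dvd_of_pow_dvd hc₄
    · rw [pow_zero, one_mul] at e₄
      have := seven_pow_mod d₄
      rw [← e₄] at this
      clear e₁ e₂ e₄ e₅
      omega
    · have g₅ : c₅ = 0 := eq_zero_of_pow_dvd hc₅ (by clear e₁ e₂ e₄ e₅; omega)
      rw [g₅, pow_zero, mul_one] at e₅
      have ha := exponent_le_of_not_dvd 2 e₅ (by clear e₁ e₂ e₄ e₅; norm_num; omega)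
      have := three_pow_mod_eight b₅
      clear e₁ e₂ e₄
      interval_cases a₅ <;> omega
  · have g₅ : c₅ = 0 := eq_zero_of_pow_dvd hc₅ (by clear e₁ e₂ e₄ e₅; omega)
    have g₂ : c₂ = 0 := eq_zero_of_pow_dvd hc₂ (by clear e₁ e₂ e₄ e₅; omega)
    have g₄ : c₄ = 0 := eq_zero_of_pow_dvd hc₄ (by clear e₁ e₂ e₄ e₅; omega)
    rw [g₅, pow_zero, mul_one] at e₅
    rw [g₂, pow_zero, mul_one] at e₂
    rw [g₄, pow_zero, one_mul] at e₄
    have h7 := pow_dvd_of_eq_pow 1 (by norm_num) e₄ (by clear e₁ e₂ e₄ e₅; omega)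
    have g₂ : d₂ = 0 := eq_zero_of_pow_dvd hd₂ (by clear e₁ e₂ e₄ e₅; omega)
    rw [g₂, pow_zero, mul_one] at e₂
    have h9 := pow_dvd_of_eq_pow 2 (by norm_num) e₂ (by clear e₁ e₂ e₄ e₅; omega)
    have hb := exponent_le_of_not_dvd 1 (e₅.trans (mul_comm _ _))
      (by clear e₁ e₂ e₄ e₅; norm_num; omega)
    have ha : 5 ≤ a₅ := by
      by_contra! h
      clear e₁ e₂ e₄
      interval_cases a₅ <;> interval_cases b₅ <;> omega
    have h32 : 2 ^ 5 ∣ N - 5 := e₅ ▸ (pow_dvd_pow 2 ha).mul_right _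
    have := seven_pow_mod d₄
    rw [← e₄] at this
    clear * - hN h32 h5 this
    omega

theorem exists_prime_dvd_sub_six {N : ℕ} (hN : 1000 ≤ N) :
    ∃ p i, p.Prime ∧ 1 ≤ i ∧ i < 6 ∧ i ≠ 3 ∧ p ∣ N - i ∧ 6 + 1 ≤ p ∧
      (Even N ∨ 6 + 1 < p ∨ Odd i) := by
  by_contra! hbad
  have small : ∀ p, p.Prime → p < 11 → p = 2 ∨ p = 3 ∨ p = 5 ∨ p = 7 := by
    intro p hp h
    have := hp.two_le
    interval_cases p <;> first | omega | exact absurd hp (by decide)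
  have key : ∀ i, 1 ≤ i → i < 6 → i ≠ 3 → ∃ a b c d, N - i = 2 ^ a * 3 ^ b * 5 ^ c * 7 ^ d ∧
      2 ^ a ∣ N - i ∧ 3 ^ b ∣ N - i ∧ 5 ^ c ∣ N - i ∧ 7 ^ d ∣ N - i := by
    intro i h1 h6 h3
    refine exists_eq_pow_mul_of_forall_prime (by omega) fun p hp hd => small p hp ?_
    by_contra! h
    exact absurd (hbad p i hp h1 h6 h3 hd (by omega)).2.1 (by omega)
  have h7 : ∀ i, 1 ≤ i → i < 6 → i ≠ 3 → (Even N ∨ Odd i) → ¬ 7 ∣ N - i := by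
    intro i h1 h6 h3 h hd
    obtain ⟨k1, -, k2⟩ := hbad 7 i (by norm_num) h1 h6 h3 hd (by norm_num)
    tauto
  obtain ⟨a₁, b₁, c₁, d₁, e₁, ha₁, hb₁, hc₁, hd₁⟩ := key 1 (by norm_num) (by norm_num) (by norm_num)
  obtain ⟨a₂, b₂, c₂, d₂, e₂, ha₂, hb₂, hc₂, hd₂⟩ := key 2 (by norm_num) (by norm_num) (by norm_num)
  obtain ⟨a₄, b₄, c₄, d₄, e₄, ha₄, hb₄, hc₄, hd₄⟩ := key 4 (by norm_num) (by norm_num) (by norm_num)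
  obtain ⟨a₅, b₅, c₅, d₅, e₅, ha₅, hb₅, hc₅, hd₅⟩ := key 5 (by norm_num) (by norm_num) (by norm_num)
  have g₁ : d₁ = 0 := eq_zero_of_pow_dvd hd₁
      (h7 1 (by norm_num) (by norm_num) (by norm_num) (Or.inr (by decide)))
  have g₅ : d₅ = 0 := eq_zero_of_pow_dvd hd₅
      (h7 5 (by norm_num) (by norm_num) (by norm_num) (Or.inr (by decide)))
  rw [g₁, pow_zero, mul_one] at e₁
  rw [g₅, pow_zero, mul_one] at e₅
  clear hd₁ hd₅ key small hbad
  obtain h2 | h2 := Nat.even_or_odd N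
  · have g₂ : d₂ = 0 := eq_zero_of_pow_dvd hd₂
      (h7 2 (by norm_num) (by norm_num) (by norm_num) (Or.inl h2))
    have g₄ : d₄ = 0 := eq_zero_of_pow_dvd hd₄
      (h7 4 (by norm_num) (by norm_num) (by norm_num) (Or.inl h2))
    rw [Nat.even_iff] at h2
    have g₁ : a₁ = 0 := eq_zero_of_pow_dvd ha₁ (by clear * - h2 hN; omega)
    have g₅ : a₅ = 0 := eq_zero_of_pow_dvd ha₅ (by clear * - h2 hN; omega)
    rw [g₁, pow_zero, one_mul] at e₁
    rw [g₅, pow_zero, one_mul] at e₅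
    rw [g₂, pow_zero, mul_one] at e₂
    rw [g₄, pow_zero, mul_one] at e₄
    exact false_of_five_smooth hN e₁ e₅ e₂ e₄ hc₁ hb₅ hc₅ hb₂ hc₂ hb₄ hc₄
  · rw [Nat.odd_iff] at h2
    have g₂ : a₂ = 0 := eq_zero_of_pow_dvd ha₂ (by clear * - h2 hN; omega)
    have g₄ : a₄ = 0 := eq_zero_of_pow_dvd ha₄ (by clear * - h2 hN; omega)
    rw [g₂, pow_zero, one_mul] at e₂
    rw [g₄, pow_zero, one_mul] at e₄
    obtain h3 | h3 | h3 : N % 3 = 0 ∨ N % 3 = 1 ∨ N % 3 = 2 := by clear * -; omega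
    · exact false_of_seven_smooth_mod_three_eq_zero hN h3 e₁ e₅ e₂ e₄ hb₁ hc₁ hb₅ hc₅ hb₂ hc₂
        hb₄ hc₄
    · exact false_of_seven_smooth_mod_three_eq_one hN h3 e₁ e₅ e₂ e₄ hb₁ hc₁ hb₅ hc₅ hb₂ hc₂
        hc₄ hd₄
    · exact false_of_seven_smooth_mod_three_eq_two hN h3 e₁ e₅ e₂ e₄ hb₁ hc₁ hb₅ hc₅ hc₂
        hd₂ hb₄ hc₄

theorem choose_le_sq_mul_prod {N D : ℕ} (hD : 4 ≤ D) (hDN : D + 1 ≤ N)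
    (hbad : ∀ p i, p.Prime → D + 2 ≤ p → 1 ≤ i → i < D → i ≠ 3 → ¬ p ∣ N - i) :
    N.choose D ≤ N ^ 2 * ∏ p ∈ (range (D + 2)).filter Nat.Prime,
      p ^ (N.choose D).factorization p := by
  have h1 : ∏ p ∈ ((range (N + 1)).filter Nat.Prime).filter (fun p => ¬ p < D + 2),
      p ^ (N.choose D).factorization p ∣ N * (N - 3) := by
    refine Finset.prod_dvd_of_isRelPrime (fun p hp q hq hpq => ?_) fun p hp => ?_
    · simp only [coe_filter, mem_filter, Set.mem_ofPred_eq] at hp hq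
      exact Nat.coprime_iff_isRelPrime.1
        (Nat.coprime_pow_primes _ _ hp.1.2 hq.1.2 hpq)
    · simp only [mem_filter, not_lt] at hp
      have h2 : p ^ (N.choose D).factorization p ∣ ∏ i ∈ range D, (N - i) := by
        rw [← Nat.descFactorial_eq_prod_range, Nat.descFactorial_eq_factorial_mul_choose]
        exact (Nat.ordProj_dvd _ _).mul_left _
      have h3 : ∏ i ∈ range D, (N - i) =
          (∏ i ∈ ((range D).erase 3).erase 0, (N - i)) * (N * (N - 3)) := by
        rw [← Finset.mul_prod_erase (range D) _ (mem_range.2 (show 3 < D by omega)),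
          ← Finset.mul_prod_erase ((range D).erase 3) _ (a := 0) (by simp; omega), Nat.sub_zero]
        ring
      rw [h3] at h2
      refine (Nat.Coprime.pow_left _ ?_).dvd_of_dvd_mul_left h2
      refine Nat.Coprime.prod_right fun i hi => ?_
      simp only [mem_erase, mem_range] at hi
      exact (hp.1.2.coprime_iff_not_dvd).2
        (hbad p i hp.1.2 hp.2 (Nat.pos_of_ne_zero hi.1) hi.2.2 hi.2.1)
  have h2 := Nat.le_of_dvd (Nat.mul_pos (by omega) (by omega)) h1
  have h3 : ((range (N + 1)).filter Nat.Prime).filter (fun p => p < D + 2) =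
      (range (D + 2)).filter Nat.Prime := by
    ext p
    simp only [mem_filter, mem_range]
    constructor
    · rintro ⟨⟨-, h⟩, h'⟩; exact ⟨h', h⟩
    · rintro ⟨h', h⟩; exact ⟨⟨by omega, h⟩, h'⟩
  calc N.choose D = ∏ p ∈ range (N + 1), p ^ (N.choose D).factorization p :=
        (Nat.prod_pow_factorization_choose N D (by omega)).symm
    _ = ∏ p ∈ (range (N + 1)).filter Nat.Prime, p ^ (N.choose D).factorization p := by
        refine (Finset.prod_filter_of_ne fun p _ hp => ?_).symm
        by_contra h
        exact hp (by rw [Nat.factorization_eq_zero_of_not_prime _ h, pow_zero])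
    _ ≤ _ := by
        rw [← Finset.prod_filter_mul_prod_filter_not _ (fun p => p < D + 2), h3, mul_comm]
        refine Nat.mul_le_mul_right _ (h2.trans ?_)
        rw [sq]
        exact Nat.mul_le_mul_left _ (Nat.sub_le _ _)

theorem prod_pow_factorization_choose_le {N D : ℕ} (hN : 0 < N) (s : Finset ℕ) :
    ∏ p ∈ s, p ^ (N.choose D).factorization p ≤ N ^ s.card :=
  Finset.prod_le_pow_card _ _ _ fun _ _ => Nat.pow_factorization_choose_le hN

theorem choose_le_pow_primeCounting {N D : ℕ} (hD : 4 ≤ D) (hDN : D + 1 ≤ N)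
    (hbad : ∀ p i, p.Prime → D + 2 ≤ p → 1 ≤ i → i < D → i ≠ 3 → ¬ p ∣ N - i) :
    N.choose D ≤ N ^ (Nat.primeCounting (D + 1) + 2) := by
  refine (choose_le_sq_mul_prod hD hDN hbad).trans ?_
  rw [pow_add, Nat.primeCounting, Nat.primeCounting', Nat.count_eq_card_filter_range]
  exact (Nat.mul_le_mul_left _ (prod_pow_factorization_choose_le (show 0 < N by omega) _)).trans_eq
    (mul_comm _ _)

theorem choose_le_pow_mul_four_pow {N D s : ℕ} (hD : 4 ≤ D) (hDN : 2 * D ≤ N) (hs : 2 ≤ s)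
    (hsD : s ≤ D) (hsN : N < (s + 1) ^ 2)
    (hbad : ∀ p i, p.Prime → D + 2 ≤ p → 1 ≤ i → i < D → i ≠ 3 → ¬ p ∣ N - i) :
    N.choose D ≤ N ^ (Nat.primeCounting s + 3) * 4 ^ (min D (N / 3)) := by
  refine (choose_le_sq_mul_prod hD (by omega) hbad).trans ?_
  set g : ℕ → ℕ := fun p => p ^ (N.choose D).factorization p with hg
  have hN : 0 < N := by omega
  have h1 : ∏ p ∈ (range (D + 2)).filter Nat.Prime, g p ≤
      (∏ p ∈ (range (D + 1)).filter Nat.Prime, g p) * N := by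
    rw [range_add_one (n := D + 1), filter_insert]
    split_ifs with h
    · rw [prod_insert (by simp), mul_comm]
      exact Nat.mul_le_mul_left _ (Nat.pow_factorization_choose_le hN)
    · exact Nat.le_mul_of_pos_right _ hN
  have h2 : ∏ p ∈ (range (D + 1)).filter Nat.Prime, g p =
      (∏ p ∈ (range (s + 1)).filter Nat.Prime, g p) *
      ∏ p ∈ ((range (D + 1)).filter Nat.Prime).filter (fun p => ¬ p < s + 1), g p := by
    rw [← Finset.prod_filter_mul_prod_filter_not _ (fun p => p < s + 1)]
    congr 1
    refine Finset.prod_congr ?_ fun _ _ => rfl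
    ext p
    simp only [mem_filter, mem_range]
    constructor
    · rintro ⟨⟨-, h⟩, h'⟩; exact ⟨h', h⟩
    · rintro ⟨h', h⟩; exact ⟨⟨by omega, h⟩, h'⟩
  have h3 : ∏ p ∈ (range (s + 1)).filter Nat.Prime, g p ≤ N ^ Nat.primeCounting s := by
    rw [Nat.primeCounting, Nat.primeCounting', Nat.count_eq_card_filter_range]
    exact prod_pow_factorization_choose_le hN _
  have h4 : ∏ p ∈ ((range (D + 1)).filter Nat.Prime).filter (fun p => ¬ p < s + 1), g p ≤
      primorial (min D (N / 3)) := by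
    rw [primorial]
    have h5 : ∏ p ∈ ((range (D + 1)).filter Nat.Prime).filter (fun p => ¬ p < s + 1), g p =
        ∏ p ∈ (((range (D + 1)).filter Nat.Prime).filter (fun p => ¬ p < s + 1)).filter
          (fun p => p ≤ N / 3), g p := by
      refine (Finset.prod_filter_of_ne fun p hp hp1 => ?_).symm
      simp only [mem_filter, mem_range, not_lt] at hp
      by_contra! h
      refine hp1 ?_
      rw [hg]
      simp only
      rw [Nat.factorization_choose_of_lt_three_mul (by omega) (by omega) (by omega) (by omega),
        pow_zero]
    rw [h5]
    calc _ ≤ ∏ p ∈ (((range (D + 1)).filter Nat.Prime).filter (fun p => ¬ p < s + 1)).filter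
          (fun p => p ≤ N / 3), p := by
          refine Finset.prod_le_prod' fun p hp => ?_
          simp only [mem_filter, mem_range, not_lt] at hp
          have h6 : (N.choose D).factorization p ≤ 1 :=
            Nat.factorization_choose_le_one (hsN.trans_le (Nat.pow_le_pow_left hp.1.2 2))
          calc g p ≤ p ^ 1 := Nat.pow_le_pow_right hp.1.1.2.pos h6
            _ = p := pow_one p
      _ ≤ _ := by
          refine Finset.prod_le_prod_of_subset_of_one_le' (fun p hp => ?_) fun p hp _ => ?_
          · simp only [mem_filter, mem_range, not_lt] at hp ⊢
            exact ⟨by omega, hp.1.1.2⟩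
          · exact (mem_filter.1 hp).2.one_le
  calc _ ≤ N ^ 2 * (N ^ Nat.primeCounting s * 4 ^ (min D (N / 3)) * N) := by
        refine Nat.mul_le_mul_left _ (h1.trans (Nat.mul_le_mul_right _ ?_))
        rw [h2]
        exact Nat.mul_le_mul h3 (h4.trans (primorial_le_four_pow _))
    _ = _ := by ring

theorem pow_le_choose_mul_pow {N D : ℕ} (h : D ≤ N) : N ^ D ≤ N.choose D * D ^ D := by
  refine Nat.le_of_mul_le_mul_left ?_ (Nat.factorial_pos D)
  rw [← mul_assoc, ← Nat.descFactorial_eq_factorial_mul_choose, ← Nat.descFactorial_self,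
    Nat.descFactorial_eq_prod_range, Nat.descFactorial_eq_prod_range]
  have hp : ∀ x : ℕ, x ^ D = ∏ _i ∈ range D, x := fun x => by simp
  rw [hp N, hp D, ← prod_mul_distrib, ← prod_mul_distrib]
  refine Finset.prod_le_prod' fun i hi => ?_
  obtain ⟨u, rfl⟩ := Nat.exists_eq_add_of_le (mem_range.1 hi).le
  obtain ⟨v, rfl⟩ := Nat.exists_eq_add_of_le h
  rw [Nat.add_sub_cancel_left, show i + u + v - i = u + v by omega]
  nlinarith [Nat.zero_le (i * v)]

theorem pow_le_choose_sq {N D : ℕ} (hD : 0 < D) (h : D ^ 2 ≤ N) : N ^ D ≤ N.choose D ^ 2 := by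
  have h1 := pow_le_choose_mul_pow (N := N) (D := D) (by nlinarith)
  have hN : 0 < N := (Nat.pow_pos hD).trans_le h
  refine Nat.le_of_mul_le_mul_right ?_ (Nat.pow_pos (n := D) hN)
  calc N ^ D * N ^ D ≤ (N.choose D * D ^ D) * (N.choose D * D ^ D) := Nat.mul_le_mul h1 h1
    _ = N.choose D ^ 2 * (D ^ 2) ^ D := by rw [← pow_mul, mul_comm 2 D, pow_mul]; ring
    _ ≤ _ := Nat.mul_le_mul_left _ (Nat.pow_le_pow_left h D)

theorem three_mul_primeCounting_le {s : ℕ} (hs : 100 ≤ s) : 3 * Nat.primeCounting s + 19 ≤ s := by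
  obtain ⟨t, rfl⟩ := Nat.exists_eq_add_of_le hs
  have h1 := Nat.primeCounting_add_le (a := 6) (k := 100) (by norm_num) (by norm_num) t
  have h2 : Nat.primeCounting 100 = 25 := by decide +kernel
  have h3 : Nat.totient 6 = 2 := by decide +kernel
  rw [h2, h3] at h1
  omega

theorem false_of_sq_le {N D : ℕ} (hD : 8 ≤ D) (hDN : D ^ 2 ≤ N) (hN : 10000 ≤ N)
    (hbad : ∀ p i, p.Prime → D + 2 ≤ p → 1 ≤ i → i < D → i ≠ 3 → ¬ p ∣ N - i) : False := by
  have h1 := choose_le_pow_primeCounting (by omega) (by nlinarith) hbad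
  obtain h | h := lt_or_ge D 24
  · have h2 := (pow_le_choose_mul_pow (N := N) (D := D) (by nlinarith)).trans
      (Nat.mul_le_mul_right _ h1)
    have h3 : ∀ D < 24, 8 ≤ D → Nat.primeCounting (D + 1) + 2 ≤ D ∧
        D ^ D < 10000 ^ (D - (Nat.primeCounting (D + 1) + 2)) := by decide +kernel
    obtain ⟨h4, h5⟩ := h3 D h hD
    obtain ⟨e, he⟩ := Nat.exists_eq_add_of_le h4
    generalize Nat.primeCounting (D + 1) + 2 = c at *
    rw [he, Nat.add_sub_cancel_left, ← he] at h5
    have h6 : N ^ D = N ^ c * N ^ e := by rw [he, pow_add]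
    rw [h6] at h2
    have h7 := Nat.le_of_mul_le_mul_left h2 (Nat.pow_pos (by omega))
    exact absurd (h5.trans_le ((Nat.pow_le_pow_left hN e).trans h7)) (lt_irrefl _)
  · have h2 : N ^ D ≤ N ^ (2 * (Nat.primeCounting (D + 1) + 2)) := by
      refine (pow_le_choose_sq (by omega) hDN).trans ((Nat.pow_le_pow_left h1 2).trans_eq ?_)
      rw [← pow_mul, mul_comm]
    have h3 := (Nat.pow_le_pow_iff_right (show 1 < N by omega)).1 h2
    obtain h4 | h4 := lt_or_ge D 36
    · have h5 : ∀ D < 36, 24 ≤ D → 2 * (Nat.primeCounting (D + 1) + 2) < D := by decide +kernel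
      exact absurd (h5 D h4 h) (by omega)
    · obtain ⟨t, rfl⟩ := Nat.exists_eq_add_of_le h
      have h5 := Nat.primeCounting_add_le (a := 6) (k := 25) (by norm_num) (by norm_num) t
      have h6 : Nat.primeCounting 25 = 9 := by decide +kernel
      have h7 : Nat.totient 6 = 2 := by decide +kernel
      rw [h6, h7] at h5
      rw [show 24 + t + 1 = 25 + t by ring] at h3
      omega

theorem five_pow_le_choose (m : ℕ) (hm : 1 ≤ m) : 3 * 5 ^ m ≤ 5 * (3 * m).choose m := by
  induction m, hm using Nat.le_induction with
  | base => decide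
  | succ m hm ih =>
    have e1 : (3 * (m + 1)).choose (m + 1) * (m + 1) = (3 * m + 3) * (3 * m + 2).choose m := by
      have := Nat.add_one_mul_choose_eq (3 * m + 2) m
      rw [show 3 * (m + 1) = 3 * m + 2 + 1 by ring]
      linarith
    have e2 : (3 * m + 2).choose m * (2 * m + 2) = (3 * m + 2) * (3 * m + 1).choose m := by
      have := Nat.choose_mul_succ_eq (3 * m + 1) m
      rw [show 3 * m + 1 + 1 - m = 2 * m + 2 by omega] at this
      linarith
    have e3 : (3 * m + 1).choose m * (2 * m + 1) = (3 * m + 1) * (3 * m).choose m := by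
      have := Nat.choose_mul_succ_eq (3 * m) m
      rw [show 3 * m + 1 - m = 2 * m + 1 by omega] at this
      linarith
    refine Nat.le_of_mul_le_mul_right ?_
      (show 0 < (m + 1) * ((2 * m + 2) * (2 * m + 1)) by positivity)
    have e4 : (3 * (m + 1)).choose (m + 1) * ((m + 1) * ((2 * m + 2) * (2 * m + 1))) =
        (3 * m + 3) * (3 * m + 2) * (3 * m + 1) * (3 * m).choose m := by
      calc _ = ((3 * (m + 1)).choose (m + 1) * (m + 1)) * ((2 * m + 2) * (2 * m + 1)) := by ring
        _ = (3 * m + 3) * ((3 * m + 2).choose m * (2 * m + 2)) * (2 * m + 1) := by rw [e1]; ring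
        _ = (3 * m + 3) * (3 * m + 2) * ((3 * m + 1).choose m * (2 * m + 1)) := by rw [e2]; ring
        _ = _ := by rw [e3]; ring
    have e5 : 5 * ((m + 1) * ((2 * m + 2) * (2 * m + 1))) ≤
        (3 * m + 3) * (3 * m + 2) * (3 * m + 1) := by
      have h : 5 * ((2 * m + 2) * (2 * m + 1)) ≤ 3 * ((3 * m + 2) * (3 * m + 1)) := by nlinarith
      calc _ = (m + 1) * (5 * ((2 * m + 2) * (2 * m + 1))) := by ring
        _ ≤ (m + 1) * (3 * ((3 * m + 2) * (3 * m + 1))) := Nat.mul_le_mul_left _ h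
        _ = _ := by ring
    calc 3 * 5 ^ (m + 1) * ((m + 1) * ((2 * m + 2) * (2 * m + 1)))
        = (3 * 5 ^ m) * (5 * ((m + 1) * ((2 * m + 2) * (2 * m + 1)))) := by ring
      _ ≤ (5 * (3 * m).choose m) * ((3 * m + 3) * (3 * m + 2) * (3 * m + 1)) :=
        Nat.mul_le_mul ih e5
      _ = _ := by rw [mul_assoc 5 _ ((m + 1) * _), e4]; ring

theorem succ_pow_eight_le_two_pow {s : ℕ} (hs : 100 ≤ s) : (s + 1) ^ 8 ≤ 2 ^ s := by
  induction s, hs using Nat.le_induction with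
  | base => norm_num
  | succ s hs ih =>
    have h1 : 100 ^ 8 * (s + 1 + 1) ^ 8 ≤ 101 ^ 8 * (s + 1) ^ 8 := by
      rw [← mul_pow, ← mul_pow]
      exact Nat.pow_le_pow_left (by omega) 8
    rw [pow_succ 2]
    omega

theorem pow_mul_four_pow_lt_choose_sqrt {N s : ℕ} (hs : 100 ≤ s) (hsN : s ^ 2 ≤ N) :
    N ^ (Nat.primeCounting s + 3) * 4 ^ s < N.choose s := by
  have h0 := three_mul_primeCounting_le hs
  by_contra! h
  have hN : 10000 ≤ N := by nlinarith
  have h1 : N ^ (3 * s) ≤ N ^ (6 * (Nat.primeCounting s + 3) + s) := by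
    calc N ^ (3 * s) = (N ^ s) ^ 3 := by rw [← pow_mul, mul_comm]
      _ ≤ (N.choose s ^ 2) ^ 3 := Nat.pow_le_pow_left (pow_le_choose_sq (by omega) hsN) 3
      _ = N.choose s ^ 6 := by rw [← pow_mul]
      _ ≤ (N ^ (Nat.primeCounting s + 3) * 4 ^ s) ^ 6 := Nat.pow_le_pow_left h 6
      _ = N ^ (6 * (Nat.primeCounting s + 3)) * (4 ^ 6) ^ s := by
        rw [mul_pow, ← pow_mul, ← pow_mul, ← pow_mul, mul_comm s 6, mul_comm _ 6]
      _ ≤ _ := by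
        rw [pow_add]
        exact Nat.mul_le_mul_left _ (Nat.pow_le_pow_left (by omega) s)
  have h2 := (Nat.pow_le_pow_iff_right (show 1 < N by omega)).1 h1
  omega

theorem pow_mul_four_pow_lt_choose_third {N s : ℕ} (hs : 100 ≤ s) (hsN : s ^ 2 ≤ N)
    (hNs : N < (s + 1) ^ 2) :
    N ^ (Nat.primeCounting s + 3) * 4 ^ (N / 3) < N.choose (N / 3) := by
  have h0 := three_mul_primeCounting_le hs
  by_contra! h
  have hN : 10000 ≤ N := by nlinarith
  set m := N / 3 with hm
  obtain ⟨e, he⟩ : ∃ e, e = Nat.primeCounting s + 3 := ⟨_, rfl⟩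
  rw [← he] at h
  have h1 := (five_pow_le_choose m (by omega)).trans
    (Nat.mul_le_mul_left 5 ((Nat.choose_le_choose m (show 3 * m ≤ N by omega)).trans h))
  have h2 : 2 ^ m ≤ 8 * N ^ (4 * e) := by
    have h3 : 81 * 5 ^ (4 * m) ≤ 625 * (N ^ (4 * e) * 4 ^ (4 * m)) := by
      have := Nat.pow_le_pow_left h1 4
      calc 81 * 5 ^ (4 * m) = (3 * 5 ^ m) ^ 4 := by rw [mul_pow, ← pow_mul, mul_comm m]; norm_num
        _ ≤ _ := this
        _ = _ := by
          rw [mul_pow, mul_pow, ← pow_mul, ← pow_mul, mul_comm e, mul_comm m]; norm_num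
    have h4 : 2 ^ m * 4 ^ (4 * m) ≤ 5 ^ (4 * m) := by
      rw [pow_mul 4, pow_mul 5, ← mul_pow]
      exact Nat.pow_le_pow_left (by norm_num) m
    have h5 : 0 < 4 ^ (4 * m) := by positivity
    refine Nat.le_of_mul_le_mul_right ?_ h5
    rw [mul_assoc]
    omega
  have h3 : 2 ^ (s * s) ≤ 2048 * (s + 1) ^ (24 * e) := by
    calc 2 ^ (s * s) ≤ 2 ^ (m * 3 + 2) := Nat.pow_le_pow_right two_pos (by rw [← sq]; omega)
      _ = (2 ^ m) ^ 3 * 4 := by rw [pow_add, pow_mul]; norm_num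
      _ ≤ (8 * N ^ (4 * e)) ^ 3 * 4 := Nat.mul_le_mul_right _ (Nat.pow_le_pow_left h2 3)
      _ = 2048 * N ^ (12 * e) := by
        rw [mul_pow, ← pow_mul, show 4 * e * 3 = 12 * e by ring]; ring
      _ ≤ 2048 * ((s + 1) ^ 2) ^ (12 * e) :=
        Nat.mul_le_mul_left _ (Nat.pow_le_pow_left hNs.le _)
      _ = _ := by rw [← pow_mul, show 2 * (12 * e) = 24 * e by ring]
  have h4 : (s + 1) ^ 80 * (s + 1) ^ (24 * e) ≤ 2 ^ (s * s) := by
    calc _ = (s + 1) ^ (80 + 24 * e) := by rw [pow_add]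
      _ ≤ (s + 1) ^ (8 * s) := Nat.pow_le_pow_right (by omega) (by omega)
      _ = ((s + 1) ^ 8) ^ s := by rw [pow_mul]
      _ ≤ (2 ^ s) ^ s := Nat.pow_le_pow_left (succ_pow_eight_le_two_pow hs) s
      _ = _ := by rw [← pow_mul]
  have h5 := Nat.le_of_mul_le_mul_right (h4.trans h3) (by positivity)
  have h6 : 101 ^ 80 ≤ (s + 1) ^ 80 := Nat.pow_le_pow_left (by omega) 80
  norm_num at h6
  omega

theorem mul_four_pow_lt_choose_of_le {N T a D : ℕ} (haD : a ≤ D) (hD : 5 * D ≤ N + 1)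
    (h : T * 4 ^ a < N.choose a) : T * 4 ^ D < N.choose D := by
  induction D, haD using Nat.le_induction with
  | base => exact h
  | succ D _ ih =>
    have h1 := ih (by omega)
    refine lt_of_mul_lt_mul_right ?_ (Nat.zero_le (D + 1))
    calc T * 4 ^ (D + 1) * (D + 1) = T * 4 ^ D * (4 * (D + 1)) := by ring
      _ < N.choose D * (4 * (D + 1)) := Nat.mul_lt_mul_of_pos_right h1 (by omega)
      _ ≤ N.choose D * (N - D) := Nat.mul_le_mul_left _ (by omega)
      _ = _ := (Nat.choose_succ_right_eq N D).symm

theorem mul_four_pow_lt_choose_of_ge {N T m : ℕ} (h : T * 4 ^ m < N.choose m) (j : ℕ)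
    (hj : j ≤ m) (hD : N ≤ 5 * (m - j) + 4) : T * 4 ^ (m - j) < N.choose (m - j) := by
  induction j with
  | zero => exact h
  | succ j ih =>
    have h1 := ih (by omega) (by omega)
    obtain ⟨D, hD1⟩ : ∃ D, m - (j + 1) = D := ⟨_, rfl⟩
    rw [show m - j = D + 1 by omega] at h1
    rw [hD1] at hD ⊢
    have h2 := Nat.choose_succ_right_eq N D
    have h3 : N.choose D * (N - D) ≤ N.choose D * (4 * (D + 1)) :=
      Nat.mul_le_mul_left _ (by omega)
    have h4 : N.choose (D + 1) ≤ 4 * N.choose D := by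
      refine Nat.le_of_mul_le_mul_right ?_ (Nat.succ_pos D)
      rw [Nat.succ_eq_add_one, h2]
      linarith
    rw [pow_succ, ← mul_assoc] at h1
    omega

theorem choose_le_choose_of_le_half {N a D : ℕ} (haD : a ≤ D) (hD : 2 * D ≤ N) :
    N.choose a ≤ N.choose D := by
  induction D, haD using Nat.le_induction with
  | base => exact le_rfl
  | succ D _ ih => exact (ih (by omega)).trans (Nat.choose_le_succ_of_lt_half_left (by omega))

theorem exists_prime_dvd_sub_of_large {N D : ℕ} (hD : 8 ≤ D) (hDN : 2 * D ≤ N)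
    (hN : 10000 ≤ N) :
    ∃ p i, p.Prime ∧ D + 2 ≤ p ∧ 1 ≤ i ∧ i < D ∧ i ≠ 3 ∧ p ∣ N - i := by
  by_contra! hbad
  obtain h | h := le_or_gt (D ^ 2) N
  · exact false_of_sq_le hD h hN hbad
  set s := Nat.sqrt N with hs
  have hsN : s ^ 2 ≤ N := Nat.sqrt_le' N
  have hNs : N < (s + 1) ^ 2 := Nat.lt_succ_sqrt' N
  have hs100 : 100 ≤ s := Nat.le_sqrt.2 (by omega)
  have hsD : s ≤ D := by
    by_contra! h'
    nlinarith
  refine absurd (choose_le_pow_mul_four_pow (by omega) hDN (by omega) hsD hNs hbad) (not_le.2 ?_)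
  have hA := pow_mul_four_pow_lt_choose_sqrt hs100 hsN
  have hB := pow_mul_four_pow_lt_choose_third hs100 hsN hNs
  obtain hm | hm := le_or_gt D (N / 3)
  · rw [min_eq_left hm]
    obtain h5 | h5 := le_or_gt N (5 * D + 4)
    · have := mul_four_pow_lt_choose_of_ge hB (N / 3 - D) (by omega) (by omega)
      rwa [show N / 3 - (N / 3 - D) = D by omega] at this
    · exact mul_four_pow_lt_choose_of_le hsD (by omega) hA
  · rw [min_eq_right hm.le]
    exact hB.trans_le (choose_le_choose_of_le_half hm.le hDN)

theorem exists_prime_gt_dvd_of_pow_mod_ne {M m k : ℕ} (hM0 : M ≠ 0) (hM : M < 2 ^ k)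
    (h : (m ! % M) ^ k % M ≠ 0) : ∃ p, p.Prime ∧ m + 1 ≤ p ∧ p ∣ M := by
  by_contra! hp
  refine h ((Nat.pow_mod _ _ _).symm.trans (Nat.mod_eq_zero_of_dvd ?_))
  refine (Nat.factorization_le_iff_dvd hM0 (pow_ne_zero _ (Nat.factorial_ne_zero m))).1 fun p => ?_
  by_cases hpM : p ∈ M.primeFactors
  · have hpp := Nat.prime_of_mem_primeFactors hpM
    have hpd := Nat.dvd_of_mem_primeFactors hpM
    have hle : p ≤ m := by
      by_contra! h'
      exact hp p hpp h' hpd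
    have h1 : 1 ≤ (m !).factorization p :=
      (hpp.dvd_iff_one_le_factorization (Nat.factorial_ne_zero m)).1
        (Nat.dvd_factorial hpp.pos hle)
    have h2 : M.factorization p < k := by
      by_contra! h'
      have h3 : p ^ k ∣ M := (pow_dvd_pow p h').trans (Nat.ordProj_dvd M p)
      exact absurd ((Nat.pow_le_pow_left hpp.two_le k).trans (Nat.le_of_dvd (by omega) h3))
        (not_le.2 hM)
    rw [Nat.factorization_pow, Finsupp.smul_apply, smul_eq_mul]
    nlinarith
  · rw [Finsupp.notMem_support_iff.1 hpM]
    exact Nat.zero_le _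

theorem prime_of_coprime_factorial {M m : ℕ} (h1 : 1 < M) (hM : M < (m + 1) ^ 2)
    (h : M.gcd (m !) = 1) : M.Prime := by
  by_contra hp
  have h2 := Nat.minFac_sq_le_self (by omega) hp
  have h3 : M.minFac ≤ m := by
    have := lt_of_pow_lt_pow_left₀ 2 (Nat.zero_le _) (h2.trans_lt hM)
    omega
  have h4 : M.minFac ∣ M.gcd (m !) :=
    Nat.dvd_gcd M.minFac_dvd (Nat.dvd_factorial M.minFac_pos h3)
  rw [h, Nat.dvd_one, Nat.minFac_eq_one_iff] at h4
  omega

theorem exists_prime_ge_nineteen {N : ℕ} (hN : 300 ≤ N) (hN' : N < 10000) :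
    ∃ p i, p.Prime ∧ 19 ≤ p ∧ 1 ≤ i ∧ i < 6 ∧ i ≠ 3 ∧ p ∣ N - i := by
  have key : ∀ a < 97, ∀ b < 100, ∃ i ∈ [1, 2, 4, 5],
      (18 ! % (300 + 100 * a + b - i)) ^ 14 % (300 + 100 * a + b - i) ≠ 0 := by decide +kernel
  obtain ⟨i, hi, h⟩ := key ((N - 300) / 100) (by omega) ((N - 300) % 100) (by omega)
  rw [show 300 + 100 * ((N - 300) / 100) + (N - 300) % 100 = N by omega] at h
  have hi' : 1 ≤ i ∧ i < 6 ∧ i ≠ 3 := by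
    simp only [List.mem_cons, List.not_mem_nil, or_false] at hi
    omega
  obtain ⟨p, hp, hp1, hp2⟩ := exists_prime_gt_dvd_of_pow_mod_ne (by omega)
    (show N - i < 2 ^ 14 by omega) h
  exact ⟨p, i, hp, hp1, hi'.1, hi'.2.1, hi'.2.2, hp2⟩

theorem exists_prime_gt_hundred {N : ℕ} (hN : 300 ≤ N) (hN' : N < 10000) :
    ∃ p i, p.Prime ∧ 101 ≤ p ∧ 1 ≤ i ∧ i < 18 ∧ i ≠ 3 ∧ p ∣ N - i := by
  have key : ∀ a < 97, ∀ b < 100, ∃ i ∈ [1, 2, 4, 5, 6, 7, 8, 9, 10, 11, 12, 13, 14, 15, 16, 17],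
      (100 ! % (300 + 100 * a + b - i)) ^ 14 % (300 + 100 * a + b - i) ≠ 0 := by decide +kernel
  obtain ⟨i, hi, h⟩ := key ((N - 300) / 100) (by omega) ((N - 300) % 100) (by omega)
  rw [show 300 + 100 * ((N - 300) / 100) + (N - 300) % 100 = N by omega] at h
  have hi' : 1 ≤ i ∧ i < 18 ∧ i ≠ 3 := by
    simp only [List.mem_cons, List.not_mem_nil, or_false] at hi
    omega
  obtain ⟨p, hp, hp1, hp2⟩ := exists_prime_gt_dvd_of_pow_mod_ne (by omega)
    (show N - i < 2 ^ 14 by omega) h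
  exact ⟨p, i, hp, hp1, hi'.1, hi'.2.1, hi'.2.2, hp2⟩

theorem exists_prime_sub {N : ℕ} (hN : 300 ≤ N) (hN' : N < 10000) :
    ∃ i, (N - i).Prime ∧ 1 ≤ i ∧ i < 42 ∧ i ≠ 3 := by
  have key : ∀ a < 97, ∀ b < 100, ∃ i ∈ List.range 42,
      (i ≠ 0 ∧ i ≠ 3) ∧ (300 + 100 * a + b - i).gcd (100 !) = 1 := by decide +kernel
  obtain ⟨i, hi, ⟨h0, h3⟩, h⟩ := key ((N - 300) / 100) (by omega) ((N - 300) % 100) (by omega)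
  rw [show 300 + 100 * ((N - 300) / 100) + (N - 300) % 100 = N by omega] at h
  have hi' := List.mem_range.1 hi
  exact ⟨i, prime_of_coprime_factorial (by omega) (by omega) h, by omega, hi', h3⟩

theorem exists_prime_dvd_sub_of_lt_three_hundred {N D : ℕ} (hD : 6 ≤ D) (hev : Even D)
    (hDN : 2 * D ≤ N) (hN : N < 300) (h29 : N = 29 → D ≠ 6) :
    ∃ p i, p.Prime ∧ D + 2 ≤ p ∧ 1 ≤ i ∧ i < D ∧ i ≠ 3 ∧ p ∣ N - i := by
  have key : ∀ d < 75, ∀ N < 300, (d < 3 ∨ N < 4 * d ∨ N = 29 ∧ d = 3) ∨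
      ∃ i ∈ List.range (2 * d), (i ≠ 0 ∧ i ≠ 3) ∧
        ((2 * d + 1)! % (N - i)) ^ 9 % (N - i) ≠ 0 := by decide +kernel
  obtain ⟨d, rfl⟩ := hev
  rw [← two_mul] at *
  obtain ⟨i, hi, ⟨h0, h3⟩, h⟩ :=
    (key d (by omega) N hN).resolve_left (by omega)
  have hi' := List.mem_range.1 hi
  obtain ⟨p, hp, hp1, hp2⟩ := exists_prime_gt_dvd_of_pow_mod_ne (by omega)
    (show N - i < 2 ^ 9 by omega) h
  exact ⟨p, i, hp, hp1, by omega, hi', h3, hp2⟩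

theorem exists_prime_dvd_sub {N D : ℕ} (hD : 6 ≤ D) (hev : Even D) (hDN : 2 * D ≤ N)
    (h29 : N = 29 → D ≠ 6) (hN : N < 10000 ∨ 8 ≤ D) :
    ∃ p i, p.Prime ∧ D + 2 ≤ p ∧ 1 ≤ i ∧ i < D ∧ i ≠ 3 ∧ p ∣ N - i := by
  obtain h1 | h1 := lt_or_ge N 300
  · exact exists_prime_dvd_sub_of_lt_three_hundred hD hev hDN h1 h29
  obtain h2 | h2 := le_or_gt 10000 N
  · exact exists_prime_dvd_sub_of_large (by omega) hDN h2
  obtain h3 | h3 := lt_or_ge D 18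
  · obtain ⟨p, i, hp, hp1, hi⟩ := exists_prime_ge_nineteen h1 h2
    exact ⟨p, i, hp, by omega, hi.1, by omega, hi.2.2⟩
  obtain h4 | h4 := lt_or_ge D 99
  · obtain ⟨p, i, hp, hp1, hi⟩ := exists_prime_gt_hundred h1 h2
    exact ⟨p, i, hp, by omega, hi.1, by omega, hi.2.2⟩
  · obtain ⟨i, hp, hi⟩ := exists_prime_sub h1 h2
    exact ⟨N - i, i, hp, by omega, hi.1, by omega, hi.2.2, dvd_rfl⟩

theorem exists_prime_dvd_sub_two_mul {N d : ℕ} (hd : 2 ≤ d) (hdN : 4 * d ≤ N)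
    (h10 : N = 10 → d ≠ 2) (h17 : N = 17 → d ≠ 2) :
    ∃ p i, p.Prime ∧ 1 ≤ i ∧ i < 2 * d ∧ i ≠ 3 ∧ p ∣ N - i ∧ 2 * d + 1 ≤ p ∧
      (Even N ∨ 2 * d + 1 < p ∨ Odd i) := by
  obtain rfl | h2 := eq_or_ne d 2
  · exact exists_prime_dvd_sub_four (by omega) (by omega) (by omega)
  by_cases h3 : d = 3 ∧ (1000 ≤ N)
  · obtain ⟨rfl, h⟩ := h3
    exact exists_prime_dvd_sub_six h
  by_cases h29 : N = 29 ∧ d = 3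
  · obtain ⟨rfl, rfl⟩ := h29
    exact ⟨7, 1, by norm_num, le_rfl, by norm_num, by norm_num, by norm_num, by norm_num,
      .inr (.inr odd_one)⟩
  obtain ⟨p, i, hp, hp1, hi⟩ := exists_prime_dvd_sub (D := 2 * d) (by omega) (even_two_mul d)
    (by omega) (by omega) (show N < 10000 ∨ 8 ≤ 2 * d by omega)
  exact ⟨p, i, hp, hi.1, hi.2.1, hi.2.2.1, hi.2.2.2, by omega, .inr (.inl (by omega))⟩

theorem exists_prime_ge_three_dvd_of_odd {m : ℕ} (hm : Odd m) (h1 : 1 < m) :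
    ∃ p, p.Prime ∧ 3 ≤ p ∧ p ∣ m := by
  refine ⟨m.minFac, Nat.minFac_prime (by omega), ?_, m.minFac_dvd⟩
  have h2 := (Nat.minFac_prime (show m ≠ 1 by omega)).two_le
  have h3 : m.minFac ≠ 2 := fun h => by
    have := h ▸ m.minFac_dvd
    obtain ⟨c, rfl⟩ := hm
    omega
  omega

theorem IsTwoRowCore.irreducible {ε k : ℕ} {F : ℤ[X]} (hF : IsTwoRowCore ε k F) (hε : ε ≤ 1)
    (hk : 2 ≤ k) (h10 : 2 * k + ε = 10 → F.coeff 0 = -135)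
    (h17 : 2 * k + ε = 17 → F.coeff 0 = 2027025)
    (hroot : ε = 1 → Even k → Odd (F.coeff 0) ∧ ∀ c, Odd c → F.eval c ≠ 0) :
    Irreducible F := by
  refine irreducible_of_no_small_factor hF.monic hF.natDegree_eq (by omega) ?_
  intro G H hGH hG hH hd1 hdk
  obtain ⟨d, hd⟩ : ∃ d, G.natDegree = d := ⟨_, rfl⟩
  rw [hd] at hd1 hdk
  obtain rfl | hd2 := hd1.eq_or_lt
  · by_cases hk2 : ε = 1 ∧ Even k
    · obtain ⟨h0, hne⟩ := hroot hk2.1 hk2.2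
      have hGX : G = X + C (G.coeff 0) := hG.eq_X_add_C hd
      have h3 : F.coeff 0 = G.coeff 0 * H.coeff 0 := by rw [hGH, mul_coeff_zero]
      rw [h3] at h0
      refine hne (-G.coeff 0) (Int.odd_mul.1 h0).1.neg ?_
      rw [hGH, eval_mul, hGX]
      simp
    · have h3 : ∃ p, p.Prime ∧ 3 ≤ p ∧ p ∣ 2 * k + ε - 1 := by
        obtain rfl | rfl : ε = 0 ∨ ε = 1 := by omega
        · exact exists_prime_ge_three_dvd_of_odd ⟨k - 1, by omega⟩ (by omega)
        · obtain ⟨p, hp, hp3, hpk⟩ := exists_prime_ge_three_dvd_of_odd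
            (Nat.not_even_iff_odd.1 fun h => hk2 ⟨rfl, h⟩) (show 1 < k by omega)
          exact ⟨p, hp, hp3, hpk.mul_left 2⟩
      obtain ⟨p, hp, hp3, hpN⟩ := h3
      exact hF.false_of_factor hε hGH hG hH hp hd hdk le_rfl (by norm_num) (by norm_num) hpN hp3
        (.inr (.inr odd_one))
  · by_cases e10 : 2 * k + ε = 10 ∧ d = 2
    · obtain ⟨h, rfl⟩ := e10
      have h0 := h10 h
      obtain rfl : ε = 0 := by omega
      obtain rfl : k = 5 := by omega
      exact hF.no_quadratic_factor_ten h0 hGH hG hH hd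
    by_cases e17 : 2 * k + ε = 17 ∧ d = 2
    · obtain ⟨h, rfl⟩ := e17
      have h0 := h17 h
      obtain rfl : ε = 1 := by omega
      obtain rfl : k = 8 := by omega
      exact hF.no_quadratic_factor_seventeen h0 hGH hG hH hd
    obtain ⟨p, i, hp, hi1, hid, hi3, hpi, hdp, hc⟩ :=
      exists_prime_dvd_sub_two_mul (N := 2 * k + ε) hd2 (by omega) (by omega) (by omega)
    refine hF.false_of_factor hε hGH hG hH hp hd hdk hi1 hid hi3 hpi hdp (hc.imp_left fun h => ?_)
    obtain ⟨c, hc⟩ := h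
    omega

theorem odd_doubleFactorial (a : ℕ) : Odd (2 * a + 1)‼ := by
  induction a with
  | zero => decide
  | succ a ih =>
    rw [show 2 * (a + 1) + 1 = 2 * a + 1 + 2 by ring, Nat.doubleFactorial_add_two]
    exact (show Odd (2 * a + 1 + 2) from ⟨a + 1, by ring⟩).mul ih

theorem irreducible_of_even {a : ℕ} (ha : 1 ≤ a) {P : ℤ[X]}
    (hP : C ((2 * a : ℤ) - 1) * P = (X ^ 2 - 1) * (C ((2 * a : ℤ) + 1) * hermite (2 * a)) -
      2 * X * hermite (2 * a + 1)) : Irreducible P := by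
  obtain ⟨hF, hPF, h0⟩ := isTwoRowCore_even ha hP
  rw [hPF]
  refine irreducible_expand_two (hF.irreducible zero_le_one (by omega) (fun h => ?_)
    (by omega) (by omega)) hF.monic ?_
  · obtain rfl : a = 4 := by omega
    rw [h0]
    decide
  · rw [h0, Int.natAbs_mul, Int.natAbs_pow, Int.natAbs_neg, Int.natAbs_one, one_pow, one_mul]
    exact_mod_cast not_isSquare_mul_doubleFactorial ha

theorem irreducible_of_odd {a : ℕ} (ha : 1 ≤ a) {P R : ℤ[X]} (hR : P = X * R)
    (hP : C (2 * a : ℤ) * P = (X ^ 2 - 1) * (C ((2 * a : ℤ) + 2) * hermite (2 * a + 1)) -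
      2 * X * hermite (2 * a + 2)) : Irreducible R := by
  obtain ⟨hF, hRF, h0⟩ := isTwoRowCore_odd ha hR hP
  have key : Irreducible (contract 2 R) := by
    refine hF.irreducible le_rfl (by omega) (by omega) (fun h => ?_) fun _ hev => ⟨?_, ?_⟩
    · obtain rfl : a = 7 := by omega
      rw [h0]
      decide
    · rw [h0]
      exact (Odd.pow (by decide)).mul ((Int.odd_coe_nat _).2 (odd_doubleFactorial a))
    · obtain ⟨c, hc⟩ := hev
      obtain ⟨t, rfl⟩ := Nat.exists_eq_add_of_le' (show 1 ≤ c by omega)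
      exact fun c hc => eval_ne_zero_of_odd (t := t) (by omega) hR hRF hP hc
  rw [hRF]
  refine irreducible_expand_two key hF.monic ?_
  rw [h0, Int.natAbs_mul, Int.natAbs_pow, Int.natAbs_neg, Int.natAbs_one, one_pow, one_mul,
    Int.natAbs_natCast]
  exact not_isSquare_doubleFactorial ha

/-- For every `n ≥ 2`, the remainder polynomial `R_{n,2}` of the
Wronskian Hermite polynomial `He_{(n,2)}` is irreducible in `ℤ[X]`. -/
theorem stmt2 (n : ℕ) (hn : 2 ≤ n)
    (HeL RL : Polynomial ℤ)
    (hHe : Polynomial.C (vand (degSeq ![n, 2])) * HeL = wronskHe (degSeq ![n, 2]))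
    (hR : HeL = Polynomial.X ^ sStat (degSeq ![n, 2]) * RL)
    (hR0 : RL.coeff 0 ≠ 0) :
    Irreducible RL := by
  obtain ⟨a, rfl | rfl⟩ := n.even_or_odd'
  · rw [sStat_two_row_even (even_two_mul a), pow_zero, one_mul] at hR
    rw [vand_two_row, wronskHe_two_row, hR] at hHe
    push_cast at hHe
    exact irreducible_of_even (by omega) hHe
  · rw [sStat_two_row_odd (odd_two_mul_add_one a), pow_one] at hR
    rw [vand_two_row, wronskHe_two_row] at hHe
    push_cast at hHe
    rw [add_sub_cancel_right, show (2 * a + 1 + 1 : ℤ) = 2 * a + 2 by ring] at hHe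
    exact irreducible_of_odd (by omega) hR hHe
end

section
/- Let λ be a partition of n whose 2-core has size m(m+1)/2 (that is, m_λ = m), and let p be a prime with p > max{2, 2m−1} that does not divide Δ(n_λ). Write R_λ(x) = Σ_{i=0}^{N} a_i x^i with N = n − s_λ. Then: (i) if m = 0, for every 1 ≤ j ≤ N one has ν_p(a_0) − ν_p(a_j) < j/(p−1), and if moreover n < p² then ν_p(a_0) − ν_p(a_j) ≤ j/p for every 1 ≤ j ≤ N; (ii) if m ≥ 1, for every 1 ≤ j ≤ N one has ν_p(a_0) − ν_p(a_j) ≤ j/(p−(2m−1)). Equivalently, the slope of the right-most edge of the Newton polygon of R_λ with respect to p is strictly less than 1/(p−1) when m = 0 (and at most 1/p if in addition n < p²), and at most 1/(p−(2m−1)) when m ≥ 1. -/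
open Polynomial Finset

/-- The product of the first `M` odd numbers. -/
def oddProd (M : ℕ) : ℕ := ∏ i ∈ range M, (2 * i + 1)

lemma oddProd_succ (M : ℕ) : oddProd (M + 1) = oddProd M * (2 * M + 1) :=
  prod_range_succ _ _

lemma oddProd_pos (M : ℕ) : 0 < oddProd M :=
  prod_pos fun _ _ => by omega

/-- The odd part `t! / (2 ^ (t / 2) * (t / 2)!)` of a factorial. -/
def oddFact (t : ℕ) : ℕ := oddProd ((t + 1) / 2)

lemma oddFact_two_mul (N : ℕ) : oddFact (2 * N) = oddProd N := by
  rw [oddFact]; congr 1; omega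

lemma oddFact_two_mul_add_one (N : ℕ) : oddFact (2 * N + 1) = oddProd (N + 1) := by
  rw [oddFact]; congr 1; omega

lemma factorial_two_mul_eq_s3 (N : ℕ) :
    (2 * N).factorial = oddProd N * (2 ^ N * N.factorial) := by
  induction N with
  | zero => simp [oddProd]
  | succ N ih =>
    rw [show 2 * (N + 1) = 2 * N + 1 + 1 by ring, Nat.factorial_succ, Nat.factorial_succ, ih,
      oddProd_succ, Nat.factorial_succ]
    ring

lemma factorial_eq_oddFact_mul (t : ℕ) :
    t.factorial = oddFact t * (2 ^ (t / 2) * (t / 2).factorial) := by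
  obtain ⟨N, rfl | rfl⟩ := Nat.even_or_odd' t
  · rw [oddFact_two_mul, factorial_two_mul_eq_s3]; congr <;> omega
  · rw [oddFact_two_mul_add_one, Nat.factorial_succ, factorial_two_mul_eq_s3, oddProd_succ,
      show (2 * N + 1) / 2 = N by omega]
    ring

/-- Extracting the multiples of `p` from a product of consecutive odd numbers. -/
lemma oddProd_eq_pow_mul {p : ℕ} (hp : p.Prime) (hp2 : 2 < p) (M : ℕ) :
    ∃ w, ¬ p ∣ w ∧
      oddProd M = p ^ ((2 * M + p - 1) / (2 * p)) * oddProd ((2 * M + p - 1) / (2 * p)) * w := by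
  have hodd : p % 2 = 1 := Nat.odd_iff.mp (hp.odd_of_ne_two (by omega))
  induction M with
  | zero =>
    refine ⟨1, by simpa using hp.one_lt.ne', ?_⟩
    rw [show (2 * 0 + p - 1) / (2 * p) = 0 from Nat.div_eq_of_lt (by omega)]
    simp [oddProd]
  | succ M ih =>
    obtain ⟨w, hw, h⟩ := ih
    set q := (2 * M + p - 1) / (2 * p) with hq
    have h1 : 2 * p * q ≤ 2 * M + p - 1 := Nat.mul_div_le _ _
    have h2 : 2 * M + p - 1 < 2 * p * (q + 1) := Nat.lt_mul_div_succ _ (by omega)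
    by_cases hd : p ∣ 2 * M + 1
    · obtain ⟨k, hk⟩ := hd
      have hk1 : k = 2 * q + 1 := by
        have hko : k % 2 = 1 := by
          have : (p * k) % 2 = 1 := by omega
          rcases Nat.mod_two_eq_zero_or_one k with h0 | h0
          · simp [Nat.mul_mod, h0] at this
          · exact h0
        have ha : 2 * q ≤ k := by
          have : p * (2 * q) < p * (k + 1) := by nlinarith [show 2 * M + p - 1 + 1 = 2 * M + p by omega]
          have := Nat.lt_of_mul_lt_mul_left this
          omega
        have hb : k ≤ 2 * q + 1 := by
          have : p * k < p * (2 * q + 2) := by nlinarith [show 2 * M + p - 1 + 1 = 2 * M + p by omega]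
          have := Nat.lt_of_mul_lt_mul_left this
          omega
        omega
      have hq' : (2 * (M + 1) + p - 1) / (2 * p) = q + 1 := by
        apply Nat.div_eq_of_lt_le
        · subst hk1; have : 2 * (M + 1) + p - 1 = 2 * M + 1 + p := by omega
          rw [this, hk]; nlinarith
        · subst hk1; have : 2 * (M + 1) + p - 1 = 2 * M + 1 + p := by omega
          rw [this, hk]; nlinarith
      refine ⟨w, hw, ?_⟩
      rw [hq', oddProd_succ, oddProd_succ, h, hk, hk1]
      ring
    · have hq' : (2 * (M + 1) + p - 1) / (2 * p) = q := by
        apply Nat.div_eq_of_lt_le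
        · rw [mul_comm]; omega
        · by_contra hc
          apply hd
          refine ⟨2 * q + 1, ?_⟩
          have e1 : 2 * p * (q + 1) = p * (2 * q + 1) + p := by ring
          have e2 : (q + 1) * (2 * p) = p * (2 * q + 1) + p := by ring
          have : (p * (2 * q + 1)) % 2 = 1 := by
            rw [Nat.mul_mod, hodd]; omega
          omega
      refine ⟨w * (2 * M + 1), fun hc => (hp.dvd_mul.mp hc).elim hw hd, ?_⟩
      rw [hq', oddProd_succ, h]
      ring

lemma mul_padicValNat_oddProd_le {p : ℕ} (hp : p.Prime) (hp2 : 2 < p) (M : ℕ) :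
    p * padicValNat p (oddProd M) ≤ 2 * M - 1 := by
  have := Fact.mk hp
  induction M using Nat.strong_induction_on with
  | _ M ih =>
    obtain ⟨w, hw, h⟩ := oddProd_eq_pow_mul hp hp2 M
    set q := (2 * M + p - 1) / (2 * p) with hq
    have h1 : 2 * p * q ≤ 2 * M + p - 1 := Nat.mul_div_le _ _
    have hw0 : w ≠ 0 := by rintro rfl; simp at hw
    have hval : padicValNat p (oddProd M) = q + padicValNat p (oddProd q) := by
      rw [h, padicValNat.mul (mul_ne_zero (pow_ne_zero _ hp.ne_zero) (oddProd_pos q).ne') hw0,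
        padicValNat.mul (pow_ne_zero _ hp.ne_zero) (oddProd_pos q).ne', padicValNat.prime_pow,
        padicValNat.eq_zero_of_not_dvd hw, add_zero]
    rw [hval]
    rcases Nat.eq_zero_or_pos q with h0 | hqpos
    · simp [h0, oddProd]
    have hle : p * (2 * q - 1) ≤ 2 * M - 1 := by
      have : p * (2 * q - 1) + p = 2 * p * q := by
        obtain ⟨q', hq'⟩ := Nat.exists_eq_add_of_lt hqpos
        rw [hq', show 2 * (0 + q' + 1) - 1 = 2 * q' + 1 by omega]; ring
      omega
    refine le_trans ?_ hle
    obtain h1q | hq2 : q = 1 ∨ 2 ≤ q := by omega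
    · simp [h1q, oddProd]
    have hqM : q < M := by
      have : 3 * (2 * q - 1) ≤ p * (2 * q - 1) := Nat.mul_le_mul_right _ (by omega)
      omega
    have := ih q hqM
    obtain ⟨q', hq'⟩ := Nat.exists_eq_add_of_le hq2
    rw [hq', show 2 * (2 + q') - 1 = 2 * q' + 3 by omega] at this ⊢
    nlinarith

lemma mul_padicValNat_oddFact_le {p : ℕ} (hp : p.Prime) (hp2 : 2 < p) (t : ℕ) :
    p * padicValNat p (oddFact t) ≤ t :=
  (mul_padicValNat_oddProd_le hp hp2 _).trans (by omega)

/-- `t!` times the coefficient of `X ^ t` in `He n`. -/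
lemma factorial_mul_coeff_He_aux (N : ℕ) :
    (∀ t, (t.factorial : ℤ) * (He (2 * N)).coeff t =
      if t % 2 = 0 then
        (-1) ^ N * oddProd N * ((-2) ^ (t / 2) * (N.descFactorial (t / 2) : ℤ)) else 0) ∧
    (∀ t, (t.factorial : ℤ) * (He (2 * N + 1)).coeff t =
      if t % 2 = 1 then
        (-1) ^ N * oddProd (N + 1) * ((-2) ^ (t / 2) * (N.descFactorial (t / 2) : ℤ)) else 0) := by
  induction N with
  | zero =>
    constructor
    · intro t
      rcases t with _ | _ | t
      · simp [He, oddProd]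
      · simp [He, coeff_one]
      · have : (t + 1 + 1) / 2 = t / 2 + 1 := by omega
        simp [He, coeff_one, this]
    · intro t
      rcases t with _ | _ | t
      · simp [He]
      · simp [He, oddProd]
      · have : (t + 1 + 1) / 2 = t / 2 + 1 := by omega
        simp [He, coeff_X, this]
  | succ N ih =>
    obtain ⟨ih0, ih1⟩ := ih
    have key : ∀ n t, ((t + 1).factorial : ℤ) * (He (n + 2)).coeff (t + 1) =
        (t + 1) * (t.factorial * (He (n + 1)).coeff t) -
          (n + 1) * ((t + 1).factorial * (He n).coeff (t + 1)) := by
      intro n t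
      rw [He, coeff_sub, coeff_X_mul, coeff_C_mul, Nat.factorial_succ]
      push_cast
      ring
    have key0 : ∀ n, (He (n + 2)).coeff 0 = - (n + 1) * (He n).coeff 0 := by
      intro n
      rw [He, coeff_sub, coeff_C_mul, mul_coeff_zero, coeff_X_zero]
      ring
    have even_case : ∀ t, (t.factorial : ℤ) * (He (2 * (N + 1))).coeff t =
      if t % 2 = 0 then
        (-1) ^ (N + 1) * oddProd (N + 1) *
          ((-2) ^ (t / 2) * ((N + 1).descFactorial (t / 2) : ℤ)) else 0 := by
      intro t
      rw [show 2 * (N + 1) = 2 * N + 2 by ring]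
      rcases t with _ | t
      · have := ih0 0
        simp only [Nat.factorial_zero, Nat.cast_one, one_mul] at this ⊢
        rw [key0, this, oddProd_succ]
        simp [pow_succ]; ring
      · rw [key, ih1 t, ih0 (t + 1)]
        obtain ⟨k, rfl | rfl⟩ := Nat.even_or_odd' t
        · simp
        · rw [if_pos (by omega), if_pos (by omega), if_pos (by omega),
            show (2 * k + 1 + 1) / 2 = k + 1 by omega, show (2 * k + 1) / 2 = k by omega]
          have hd : ((N + 1).descFactorial (k + 1) : ℤ) =
              N.descFactorial (k + 1) + (k + 1) * N.descFactorial k := by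
            rw [Nat.succ_descFactorial_succ, Nat.descFactorial_succ]
            rcases le_or_gt k N with h | h
            · push_cast [Nat.cast_sub h]; ring
            · rw [Nat.descFactorial_eq_zero_iff_lt.mpr h]; simp
          rw [hd, oddProd_succ]
          push_cast
          ring
    refine ⟨even_case, ?_⟩
    intro t
    rw [show 2 * (N + 1) + 1 = (2 * N + 1) + 2 by ring]
    rcases t with _ | t
    · have := ih1 0
      simp only [Nat.factorial_zero, Nat.cast_one, one_mul] at this ⊢
      rw [key0, this]
      simp
    · rw [key, show 2 * N + 1 + 1 = 2 * (N + 1) by ring, even_case t, ih1 (t + 1)]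
      obtain ⟨k, rfl | rfl⟩ := Nat.even_or_odd' t
      · rw [if_pos (by omega), if_pos (by omega), if_pos (by omega),
          show (2 * k + 1) / 2 = k by omega, show 2 * k / 2 = k by omega]
        have hd : ((N : ℤ) + 1 - k) * ((N + 1).descFactorial k : ℤ) =
            (N + 1) * N.descFactorial k := by
          have := Nat.succ_descFactorial N k
          rcases le_or_gt k (N + 1) with h | h
          · zify [h] at this; exact this
          · rw [Nat.descFactorial_eq_zero_iff_lt.mpr h,
              Nat.descFactorial_eq_zero_iff_lt.mpr (by omega : N < k)]; simp
        rw [oddProd_succ (N + 1)]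
        push_cast
        linear_combination 2 * (-1) ^ N * (oddProd (N + 1) : ℤ) * (-2) ^ k * hd
      · simp [show (2 * k + 1 + 1) % 2 ≠ 1 by omega]

lemma factorial_mul_coeff_He (n t : ℕ) :
    (t.factorial : ℤ) * (He n).coeff t =
      if t % 2 = n % 2 then
        (-1) ^ (n / 2) * oddFact n * ((-2) ^ (t / 2) * ((n / 2).descFactorial (t / 2) : ℤ))
      else 0 := by
  obtain ⟨N, rfl | rfl⟩ := Nat.even_or_odd' n
  · rw [(factorial_mul_coeff_He_aux N).1, oddFact_two_mul, show 2 * N / 2 = N by omega,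
      Nat.mul_mod_right]
  · rw [(factorial_mul_coeff_He_aux N).2, oddFact_two_mul_add_one,
      show (2 * N + 1) / 2 = N by omega, show (2 * N + 1) % 2 = 1 by omega]

lemma coeff_He_eq_zero {n t : ℕ} (h : t % 2 ≠ n % 2) : (He n).coeff t = 0 := by
  have := factorial_mul_coeff_He n t
  rw [if_neg h] at this
  exact (mul_eq_zero.mp this).resolve_left (by exact_mod_cast t.factorial_ne_zero)

lemma coeff_He_eq_zero_of_lt {n t : ℕ} (h : n < t) : (He n).coeff t = 0 := by
  have := factorial_mul_coeff_He n t
  by_cases hp : t % 2 = n % 2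
  · rw [Nat.descFactorial_eq_zero_iff_lt.mpr (by omega : n / 2 < t / 2)] at this
    simp only [Nat.cast_zero, mul_zero, ite_self] at this
    exact (mul_eq_zero.mp this).resolve_left (by exact_mod_cast t.factorial_ne_zero)
  · exact coeff_He_eq_zero hp

/-- Divisibility of the coefficients of the `i`-th derivative of `He n` by the odd part of `n!`. -/
lemma oddFact_dvd_mul_coeff_He (n : ℕ) {i t : ℕ} (hit : i ≤ t) :
    (oddFact n : ℤ) ∣ oddFact (t - i) * ((t.descFactorial i : ℤ) * (He n).coeff t) := by
  by_cases hp : t % 2 = n % 2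
  swap
  · simp [coeff_He_eq_zero hp]
  have hH := factorial_mul_coeff_He n t
  rw [if_pos hp] at hH
  set u := t - i with hu
  have hut : u / 2 ≤ t / 2 := Nat.div_le_div_right (by omega)
  have h1 : (t.descFactorial i : ℤ) * u.factorial = t.factorial := by
    rw [mul_comm]; exact_mod_cast Nat.factorial_mul_descFactorial hit
  have h2 : (u.factorial : ℤ) = oddFact u * (2 ^ (u / 2) * (u / 2).factorial) := by
    exact_mod_cast factorial_eq_oddFact_mul u
  obtain ⟨z, hz⟩ : (u / 2).factorial ∣ (n / 2).descFactorial (t / 2) :=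
    (Nat.factorial_dvd_factorial hut).trans (Nat.factorial_dvd_descFactorial _ _)
  obtain ⟨k, hk⟩ := Nat.exists_eq_add_of_le hut
  rw [hz, hk, ← h1, h2] at hH
  refine ⟨(-1) ^ (n / 2) * (-1) ^ (u / 2) * (-2) ^ k * z, ?_⟩
  have hne : (2 ^ (u / 2) * ((u / 2).factorial : ℤ)) ≠ 0 := by positivity
  apply mul_right_cancel₀ hne
  rw [pow_add, show (-2 : ℤ) ^ (u / 2) = (-1) ^ (u / 2) * 2 ^ (u / 2) by
    rw [← mul_pow]; norm_num] at hH
  push_cast at hH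
  linear_combination hH

lemma card_mul_card_sub_one_le_two_mul_sum (s : Finset ℕ) :
    #s * (#s - 1) ≤ 2 * ∑ x ∈ s, x := by
  have h : ∑ x ∈ range #s, x ≤ ∑ x ∈ s, x := by
    have := sum_range_le_sum (s := s.map Nat.castEmbedding) (c := 0) (by simp)
    simp only [card_map, sum_map, zero_add, Nat.castEmbedding_apply] at this
    zify
    exact this
  have := sum_range_id_mul_two #s
  omega

lemma lt_card_of_two_mul_sum_eq {s : Finset ℕ} (hs : 2 * ∑ x ∈ s, x ≤ #s * (#s - 1)) {x : ℕ}
    (hx : x ∈ s) : x < #s := by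
  have h1 := card_mul_card_sub_one_le_two_mul_sum (s.erase x)
  rw [card_erase_of_mem hx] at h1
  have h2 : x + ∑ y ∈ s.erase x, y = ∑ y ∈ s, y := add_sum_erase s (fun y => y) hx
  have h3 : 0 < #s := card_pos.mpr ⟨x, hx⟩
  obtain ⟨k, hk⟩ := Nat.exists_eq_add_of_lt h3
  rw [hk] at h1 hs ⊢
  simp only [zero_add, Nat.add_sub_cancel] at h1 hs ⊢
  rcases k with _ | k
  · omega
  · simp only [Nat.add_sub_cancel] at h1
    by_contra hc
    nlinarith

lemma dStat_eq_sum {r : ℕ} (t : Fin r → ℕ) :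
    dStat t = ∑ i, if t i % 2 = 1 then (1 : ℤ) else -1 := by
  rw [dStat, sum_ite]
  simp [Nat.odd_iff, Nat.even_iff]
  ring

lemma dStat_comp_perm {r : ℕ} (t : Fin r → ℕ) (σ : Equiv.Perm (Fin r)) :
    dStat (t ∘ σ) = dStat t := by
  rw [dStat_eq_sum, dStat_eq_sum]
  exact Equiv.sum_comp σ fun i => if t i % 2 = 1 then (1 : ℤ) else -1

lemma dStat_congr {r : ℕ} {s t : Fin r → ℕ} (h : ∀ i, s i % 2 = t i % 2) :
    dStat s = dStat t := by
  simp [dStat_eq_sum, h]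

/-- The indices at which `t` has residue `b` modulo `2`. -/
def parityClass {r : ℕ} (t : Fin r → ℕ) (b : ℕ) : Finset (Fin r) :=
  univ.filter fun i => t i % 2 = b

@[simp] lemma mem_parityClass {r : ℕ} {t : Fin r → ℕ} {b : ℕ} {i : Fin r} :
    i ∈ parityClass t b ↔ t i % 2 = b := by
  simp [parityClass]

lemma sum_parityClass {r : ℕ} {M : Type*} [AddCommMonoid M] (t : Fin r → ℕ) (g : Fin r → M) :
    ∑ i, g i = ∑ i ∈ parityClass t 0, g i + ∑ i ∈ parityClass t 1, g i := by
  rw [← sum_filter_add_sum_filter_not univ (fun i => t i % 2 = 0)]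
  congr 1
  exact sum_congr (by ext; simp) fun _ _ => rfl

lemma card_parityClass {r : ℕ} (t : Fin r → ℕ) :
    (r : ℤ) = #(parityClass t 0) + #(parityClass t 1) := by
  have := sum_parityClass t fun _ => 1
  simp only [sum_const, card_univ, Fintype.card_fin, smul_eq_mul, mul_one] at this
  exact_mod_cast this

lemma dStat_eq_card_sub_card {r : ℕ} (t : Fin r → ℕ) :
    dStat t = #(parityClass t 1) - #(parityClass t 0) := by
  simp [dStat, parityClass, Nat.odd_iff, Nat.even_iff]

lemma two_mul_sum_eq {r : ℕ} (t : Fin r → ℕ) :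
    2 * ∑ i, (t i : ℤ) = 2 * (2 * ∑ i ∈ parityClass t 0, ((t i / 2 : ℕ) : ℤ)) +
      2 * (2 * ∑ i ∈ parityClass t 1, ((t i / 2 : ℕ) : ℤ)) + 2 * #(parityClass t 1) := by
  rw [sum_parityClass t]
  have h0 : ∑ i ∈ parityClass t 0, (t i : ℤ) = ∑ i ∈ parityClass t 0, 2 * ((t i / 2 : ℕ) : ℤ) :=
    sum_congr rfl fun i hi => by rw [mem_parityClass] at hi; omega
  have h1 : ∑ i ∈ parityClass t 1, (t i : ℤ) =
      ∑ i ∈ parityClass t 1, (2 * ((t i / 2 : ℕ) : ℤ) + 1) :=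
    sum_congr rfl fun i hi => by rw [mem_parityClass] at hi; omega
  rw [h0, h1, sum_add_distrib, ← mul_sum, ← mul_sum]
  simp
  ring

lemma injOn_half_parityClass {r : ℕ} {t : Fin r → ℕ} (ht : Function.Injective t) (b : ℕ) :
    Set.InjOn (fun i => t i / 2) (parityClass t b : Set (Fin r)) := by
  intro i hi j hj hij
  rw [mem_coe, mem_parityClass] at hi hj
  exact ht (by simp only at hij; omega)

lemma card_mul_pred_le_sum_parityClass {r : ℕ} {t : Fin r → ℕ} (ht : Function.Injective t)
    (b : ℕ) :
    (#(parityClass t b) * (#(parityClass t b) - 1) : ℤ) ≤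
      2 * ∑ i ∈ parityClass t b, ((t i / 2 : ℕ) : ℤ) := by
  have h := card_mul_card_sub_one_le_two_mul_sum ((parityClass t b).image fun i => t i / 2)
  rw [card_image_of_injOn (injOn_half_parityClass ht b),
    sum_image (injOn_half_parityClass ht b)] at h
  rcases Nat.eq_zero_or_pos #(parityClass t b) with h0 | h0
  · rw [h0]; simp only [Nat.cast_zero, zero_mul]; positivity
  · zify [h0] at h; push_cast; exact h

/-- Among injective sequences with given parity counts, the sum is minimised by the `2`-core. -/
lemma le_two_mul_sum_of_injective {r : ℕ} {t : Fin r → ℕ} (ht : Function.Injective t) :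
    (r : ℤ) * (r - 1) + dStat t * (dStat t + 1) ≤ 2 * ∑ i, (t i : ℤ) := by
  have h0 := card_mul_pred_le_sum_parityClass ht 0
  have h1 := card_mul_pred_le_sum_parityClass ht 1
  rw [two_mul_sum_eq, dStat_eq_card_sub_card, card_parityClass t]
  nlinarith

lemma half_lt_card_of_two_mul_sum_eq {r : ℕ} {t : Fin r → ℕ} (ht : Function.Injective t)
    (h : 2 * ∑ i, (t i : ℤ) = (r : ℤ) * (r - 1) + dStat t * (dStat t + 1)) (i : Fin r) :
    t i / 2 < #(parityClass t (t i % 2)) := by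
  have h0 := card_mul_pred_le_sum_parityClass ht 0
  have h1 := card_mul_pred_le_sum_parityClass ht 1
  rw [two_mul_sum_eq, dStat_eq_card_sub_card, card_parityClass t] at h
  have key : ∀ b, (2 * ∑ i ∈ parityClass t b, ((t i / 2 : ℕ) : ℤ)) ≤
      #(parityClass t b) * (#(parityClass t b) - 1) →
      ∀ i ∈ parityClass t b, t i / 2 < #(parityClass t b) := by
    intro b hb i hi
    have hc := card_image_of_injOn (injOn_half_parityClass ht b)
    have hpos : 1 ≤ #(parityClass t b) := card_pos.mpr ⟨i, hi⟩
    have := lt_card_of_two_mul_sum_eq (s := (parityClass t b).image fun i => t i / 2) (by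
      rw [hc, sum_image (injOn_half_parityClass ht b)]
      zify [hpos]
      push_cast at hb
      exact hb) (mem_image_of_mem _ hi)
    rwa [hc] at this
  refine key _ ?_ i (by simp)
  rcases Nat.mod_two_eq_zero_or_one (t i) with hb | hb <;> rw [hb] <;> nlinarith

/-- If an injective sequence dominates the identity off `{i | P i}`, then its values on
`{i | P i}` can be lowered below the identity keeping injectivity. -/
lemma exists_injective_le_of_le {r : ℕ} {t : Fin r → ℕ} (ht : Function.Injective t)
    (P : Fin r → Prop) [DecidablePred P] (h : ∀ i, ¬ P i → (i : ℕ) ≤ t i) :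
    ∃ s : Fin r → ℕ, Function.Injective s ∧ (∀ i, P i → s i ≤ i) ∧ ∀ i, ¬ P i → s i = t i := by
  let T : Finset ℕ := (univ.filter fun k => ¬ P k).image t
  obtain ⟨y, hy, hmem⟩ := (all_card_le_biUnion_card_iff_exists_injective
    (fun i : {i // P i} => range ((i : ℕ) + 1) \ T)).mp (by
    intro S
    rcases S.eq_empty_or_nonempty with rfl | hS
    · simp
    set i := S.max' hS
    refine le_trans ?_ (card_le_card (subset_biUnion_of_mem _ (S.max'_mem hS)))
    have hT : #(T ∩ range ((i : ℕ) + 1)) ≤ #((Iic i.1).filter fun k => ¬ P k) := by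
      refine (card_le_card (t := ((Iic i.1).filter fun k => ¬ P k).image t) ?_).trans card_image_le
      intro x hx
      simp only [T, mem_inter, mem_image, mem_filter, mem_univ, true_and, mem_range] at hx
      obtain ⟨⟨k, hk, rfl⟩, hx⟩ := hx
      have := h k hk
      exact mem_image_of_mem _ (mem_filter.mpr
        ⟨mem_Iic.mpr (Fin.le_def.mpr (by omega)), hk⟩)
    have hS' : #S ≤ #((Iic i.1).filter P) := by
      rw [← card_map (Function.Embedding.subtype P)]
      refine card_le_card fun x hx => ?_
      obtain ⟨k, hk, rfl⟩ := mem_map.mp hx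
      exact mem_filter.mpr ⟨mem_Iic.mpr (S.le_max' k hk), k.2⟩
    have hsum := card_filter_add_card_filter_not (s := Iic i.1) P
    rw [Fin.card_Iic] at hsum
    have hsd := card_sdiff (s := T) (t := range ((i : ℕ) + 1))
    rw [card_range] at hsd
    change _ ≤ #(range ((i : ℕ) + 1) \ T)
    omega)
  refine ⟨fun i => if hi : P i then y ⟨i, hi⟩ else t i, ?_, ?_, ?_⟩
  · intro i j hij
    by_cases hi : P i <;> by_cases hj : P j <;> simp only [hi, hj, dite_true, dite_false] at hij
    · simpa using hy hij
    · exact absurd (mem_image_of_mem t (by simpa using hj))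
        (hij ▸ (mem_sdiff.mp (hmem ⟨i, hi⟩)).2)
    · exact absurd (mem_image_of_mem t (by simpa using hi))
        (hij ▸ (mem_sdiff.mp (hmem ⟨j, hj⟩)).2)
    · exact ht hij
  · intro i hi
    have : y ⟨i, hi⟩ < (i : ℕ) + 1 := mem_range.mp (mem_sdiff.mp (hmem ⟨i, hi⟩)).1
    simp only [hi, dite_true]
    omega
  · intro i hi
    simp [hi]

/-- The sum bound behind the slope estimate. -/
lemma sum_ge_of_add_mul_le {r m p : ℕ} {t f : Fin r → ℕ} (ht : Function.Injective t)
    (hm : 1 ≤ m) (hd : dStat t = m ∨ dStat t = -m - 1)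
    (h : ∀ i : Fin r, (i : ℕ) + p * f i ≤ t i) :
    (r : ℤ) * (r - 1) + dStat t * (dStat t + 1) + 2 * ((p - (2 * m - 1)) * ∑ i, (f i : ℤ)) ≤
      2 * ∑ i, (t i : ℤ) := by
  obtain ⟨s, hs, hs1, hs2⟩ := exists_injective_le_of_le ht (fun i => f i ≠ 0)
    (fun i _ => le_trans (Nat.le_add_right _ _) (h i))
  have hsum : ∑ i, (s i : ℤ) + p * ∑ i, (f i : ℤ) ≤ ∑ i, (t i : ℤ) := by
    rw [mul_sum, ← sum_add_distrib]
    refine sum_le_sum fun i _ => ?_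
    by_cases hi : f i = 0
    · simp [hs2 i (not_not.mpr hi), hi]
    · have h1 := hs1 i hi
      have h2 := h i
      exact_mod_cast (by omega : s i + p * f i ≤ t i)
  obtain ⟨e, he, hea⟩ : ∃ e : ℤ, dStat s = dStat t + 2 * e ∧ |e| ≤ ∑ i, (f i : ℤ) := by
    refine ⟨∑ i, ((s i % 2 : ℕ) - (t i % 2 : ℕ) : ℤ), ?_, ?_⟩
    · rw [dStat_eq_sum, dStat_eq_sum, mul_sum, ← sum_add_distrib]
      refine sum_congr rfl fun i _ => ?_
      split_ifs <;> omega
    · refine (abs_sum_le_sum_abs _ _).trans (sum_le_sum fun i _ => ?_)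
      by_cases hi : f i = 0
      · simp [hs2 i (not_not.mpr hi), hi]
      · rw [abs_le]; omega
  have hmin := le_two_mul_sum_of_injective hs
  rw [he] at hmin
  rw [abs_le] at hea
  set F := ∑ i, (f i : ℤ)
  have hm' : (1 : ℤ) ≤ m := by exact_mod_cast hm
  suffices H : 0 ≤ 2 * (2 * m - 1) * F + 2 * e * (2 * dStat t + 1 + 2 * e) by nlinarith
  have quad : ∀ b : ℤ, b ≤ F → -F ≤ b → b * (2 * m + 1 - 2 * b) ≤ (2 * m - 1) * F := by
    intro b hb1 hb2
    rcases le_or_gt b 0 with hb | hb <;> nlinarith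
  rcases hd with hd | hd <;> rw [hd]
  · nlinarith [quad (-e) (by omega) (by omega)]
  · nlinarith [quad e (by omega) (by omega)]

/-- The Vandermonde-type determinant `det ((t_j)_i)` of falling factorials. -/
def fallingDet {r : ℕ} (t : Fin r → ℕ) : ℤ :=
  Matrix.det (Matrix.of fun i j : Fin r => ((t j).descFactorial i : ℤ))

lemma fallingDet_eq_zero {r : ℕ} {t : Fin r → ℕ} (ht : ¬ Function.Injective t) :
    fallingDet t = 0 := by
  obtain ⟨i, j, hij, hne⟩ : ∃ i j, t i = t j ∧ i ≠ j := by
    simpa [Function.Injective] using ht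
  exact Matrix.det_zero_of_column_eq hne fun k => by simp [hij]

lemma fallingDet_comp_perm {r : ℕ} (t : Fin r → ℕ) (π : Equiv.Perm (Fin r)) :
    fallingDet (t ∘ π) = Equiv.Perm.sign π * fallingDet t :=
  Matrix.det_permute' π (Matrix.of fun i j : Fin r => ((t j).descFactorial i : ℤ))

lemma fallingDet_eq_prod {r : ℕ} (t : Fin r → ℕ) :
    fallingDet t = ∏ i : Fin r, ∏ j ∈ Ioi i, ((t j : ℤ) - t i) := by
  rw [← Matrix.det_vandermonde, Matrix.det_eval_matrixOfPolynomials_eq_det_vandermonde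
    (fun i => (t i : ℤ)) (fun i => descPochhammer ℤ i)
    (fun i => descPochhammer_natDegree ℤ i) (fun i => monic_descPochhammer ℤ i),
    ← Matrix.det_transpose, fallingDet]
  congr 1
  ext i j
  simp [descPochhammer_eval_eq_descFactorial]

lemma fallingDet_dvd_of_strictMono {r : ℕ} {t : Fin r → ℕ} (ht : StrictMono t) :
    fallingDet t ∣ ∏ i, ((t i).factorial : ℤ) := by
  rw [fallingDet_eq_prod, prod_comm' (s' := fun j => Iio j) (t' := univ) (by simp)]
  refine prod_dvd_prod_of_dvd _ _ fun j _ => ?_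
  rw [← prod_Ico_id_eq_factorial]
  have hinj : Set.InjOn (fun i => t j - t i) (Iio j : Finset (Fin r)) := by
    intro a ha b hb hab
    have h1 := ht (mem_Iio.mp ha)
    have h2 := ht (mem_Iio.mp hb)
    exact ht.injective (by simp only at hab; omega)
  have : ∏ i ∈ Iio j, ((t j : ℤ) - t i) = ((∏ x ∈ (Iio j).image fun i => t j - t i, x : ℕ) : ℤ) := by
    rw [prod_image hinj]
    push_cast
    refine prod_congr rfl fun i hi => ?_
    rw [Nat.cast_sub (ht (mem_Iio.mp hi)).le]
  rw [this]
  refine Int.natCast_dvd_natCast.mpr (prod_dvd_prod_of_subset _ _ _ fun x hx => ?_)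
  obtain ⟨i, hi, rfl⟩ := mem_image.mp hx
  have := ht (mem_Iio.mp hi)
  exact mem_Ico.mpr (by omega)

lemma fallingDet_dvd_prod_factorial {r : ℕ} {t : Fin r → ℕ} (ht : Function.Injective t) :
    fallingDet t ∣ ∏ i, ((t i).factorial : ℤ) := by
  have hmono : StrictMono (t ∘ Tuple.sort t) :=
    (Tuple.monotone_sort t).strictMono_of_injective (ht.comp (Tuple.sort t).injective)
  have h := fallingDet_dvd_of_strictMono hmono
  rw [fallingDet_comp_perm] at h
  rw [← Equiv.prod_comp (Tuple.sort t)]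
  exact (dvd_mul_left _ _).trans h

lemma X_pow_mul_iterate_derivative (f : ℤ[X]) {B : ℕ} (hB : ∀ t, B ≤ t → f.coeff t = 0) (i : ℕ) :
    X ^ i * derivative^[i] f =
      ∑ t ∈ range B, C (f.coeff t) * X ^ t * C ((t.descFactorial i : ℕ) : ℤ) := by
  ext u
  have hR : ∀ t, (C (f.coeff t) * X ^ t * C ((t.descFactorial i : ℕ) : ℤ)).coeff u =
      if u = t then f.coeff t * t.descFactorial i else 0 := by
    intro t
    rw [coeff_mul_C, coeff_C_mul_X_pow]
    split_ifs <;> simp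
  rw [finsetSum_coeff, sum_congr rfl fun t _ => hR t, sum_ite_eq]
  rw [coeff_X_pow_mul', coeff_iterate_derivative]
  have hval : (if i ≤ u then (u - i + i).descFactorial i • f.coeff (u - i + i) else 0) =
      f.coeff u * (u.descFactorial i : ℤ) := by
    split_ifs with h
    · rw [Nat.sub_add_cancel h, nsmul_eq_mul, mul_comm]
    · rw [Nat.descFactorial_eq_zero_iff_lt.mpr (by omega)]; simp
  rw [hval]
  split_ifs with h
  · rfl
  · rw [hB u (by simpa using h), zero_mul]

lemma X_pow_mul_wronskHe {r : ℕ} (ns : Fin r → ℕ) {B : ℕ} (hB : ∀ j, ns j < B) :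
    X ^ (∑ i : Fin r, (i : ℕ)) * wronskHe ns =
      ∑ t ∈ Fintype.piFinset fun _ : Fin r => range B,
        C ((∏ j, (He (ns j)).coeff (t j)) * fallingDet t) * X ^ (∑ j, t j) := by
  have hentry : ∀ i j : Fin r, X ^ (i : ℕ) *
      (Matrix.of fun i j : Fin r =>
        (fun q : ℤ[X] => derivative q)^[(i : ℕ)] (He (ns j))) i j =
      ∑ t ∈ range B, C ((He (ns j)).coeff t) * X ^ t * C ((t.descFactorial i : ℕ) : ℤ) :=
    fun i j => X_pow_mul_iterate_derivative _
      (fun t ht => coeff_He_eq_zero_of_lt ((hB j).trans_le ht)) i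
  rw [wronskHe, ← prod_pow_eq_pow_sum, ← Matrix.det_mul_column, Matrix.det_apply']
  simp only [Matrix.of_apply] at hentry ⊢
  simp only [hentry, prod_univ_sum, mul_sum]
  rw [sum_comm]
  refine sum_congr rfl fun t _ => ?_
  rw [fallingDet, Matrix.det_apply', mul_sum, map_sum, sum_mul]
  refine sum_congr rfl fun σ _ => ?_
  simp only [prod_mul_distrib, prod_pow_eq_pow_sum, C_mul, map_prod, Matrix.of_apply,
    map_intCast]
  ring

lemma coeff_wronskHe {r : ℕ} (ns : Fin r → ℕ) {B : ℕ} (hB : ∀ j, ns j < B) (e : ℕ) :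
    (wronskHe ns).coeff e =
      ∑ t ∈ (Fintype.piFinset fun _ : Fin r => range B) with
        ∑ j, t j = e + ∑ i : Fin r, (i : ℕ),
        (∏ j, (He (ns j)).coeff (t j)) * fallingDet t := by
  rw [← coeff_X_pow_mul (wronskHe ns) (∑ i : Fin r, (i : ℕ)), X_pow_mul_wronskHe ns hB,
    finsetSum_coeff, sum_filter]
  refine sum_congr rfl fun t _ => ?_
  rw [coeff_C_mul_X_pow]
  simp only [eq_comm]

lemma det_eval_descPochhammer_ne_zero {F ι : Type*} [Field F] [Fintype ι] [DecidableEq ι]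
    {x : ι → F} (hx : Function.Injective x) {k : ι → ℕ} (hk : Function.Injective k)
    (hlt : ∀ i, k i < Fintype.card ι) :
    (Matrix.of fun i j => (descPochhammer F (k i)).eval (x j)).det ≠ 0 := by
  let e : ι ≃ Fin (Fintype.card ι) := Equiv.ofBijective (fun i => ⟨k i, hlt i⟩)
    ((Fintype.bijective_iff_injective_and_card _).mpr
      ⟨fun i j hij => hk (Fin.mk.inj hij), by simp⟩)
  rw [← Matrix.det_submatrix_equiv_self e.symm, ← Matrix.det_transpose]
  have hev : ((Matrix.of fun i j => (descPochhammer F (k i)).eval (x j)).submatrix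
      e.symm e.symm).transpose = Matrix.of fun i j : Fin (Fintype.card ι) =>
        (descPochhammer F j).eval (x (e.symm i)) := by
    ext i j
    have : k (e.symm j) = j := congrArg Fin.val (e.apply_symm_apply j)
    simp [this]
  rw [hev, ← Matrix.det_eval_matrixOfPolynomials_eq_det_vandermonde
    (fun i => x (e.symm i)) (fun i => descPochhammer F i)
    (fun i => descPochhammer_natDegree F i) (fun i => monic_descPochhammer F i),
    Matrix.det_vandermonde_ne_zero_iff]
  exact hx.comp e.symm.injective

/-- The number of earlier entries of the same parity. -/
def coreRank {r : ℕ} (ns : Fin r → ℕ) (j : Fin r) : ℕ :=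
  #{i ∈ Iio j | ns i % 2 = ns j % 2}

lemma coreRank_lt {r : ℕ} (ns : Fin r → ℕ) (j : Fin r) :
    coreRank ns j < #(parityClass ns (ns j % 2)) := by
  refine card_lt_card (ssubset_iff_of_subset (fun i hi => ?_) |>.mpr ⟨j, by simp, by simp⟩)
  simpa using (mem_filter.mp hi).2

lemma coreRank_lt_coreRank {r : ℕ} {ns : Fin r → ℕ} {i j : Fin r} (hij : i < j)
    (h : ns i % 2 = ns j % 2) : coreRank ns i < coreRank ns j := by
  refine card_lt_card (ssubset_iff_of_subset (fun k hk => ?_) |>.mpr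
    ⟨i, by simp [hij, h], by simp⟩)
  simp only [mem_filter, mem_Iio] at hk ⊢
  exact ⟨hk.1.trans hij, hk.2.trans h⟩

lemma injOn_coreRank {r : ℕ} (ns : Fin r → ℕ) (b : ℕ) :
    Set.InjOn (coreRank ns) (parityClass ns b : Set (Fin r)) := by
  intro i hi j hj hij
  rw [mem_coe, mem_parityClass] at hi hj
  rcases lt_trichotomy i j with h | h | h
  · exact absurd hij (coreRank_lt_coreRank h (hi.trans hj.symm)).ne
  · exact h
  · exact absurd hij (coreRank_lt_coreRank h (hj.trans hi.symm)).ne'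

lemma image_coreRank {r : ℕ} (ns : Fin r → ℕ) (b : ℕ) :
    (parityClass ns b).image (coreRank ns) = range #(parityClass ns b) := by
  refine eq_of_subset_of_card_le (fun x hx => ?_) ?_
  · obtain ⟨i, hi, rfl⟩ := mem_image.mp hx
    rw [mem_parityClass] at hi
    exact mem_range.mpr (hi ▸ coreRank_lt ns i)
  · rw [card_image_of_injOn (injOn_coreRank ns b), card_range]

/-- The arrangement of the degree sequence of the `2`-core whose parities agree with `ns`. -/
def coreSeq {r : ℕ} (ns : Fin r → ℕ) (j : Fin r) : ℕ :=
  2 * coreRank ns j + ns j % 2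

lemma coreSeq_mod_two {r : ℕ} (ns : Fin r → ℕ) (j : Fin r) : coreSeq ns j % 2 = ns j % 2 := by
  rw [coreSeq]; omega

lemma coreSeq_div_two {r : ℕ} (ns : Fin r → ℕ) (j : Fin r) :
    coreSeq ns j / 2 = coreRank ns j := by
  rw [coreSeq]; omega

lemma coreSeq_injective {r : ℕ} (ns : Fin r → ℕ) : Function.Injective (coreSeq ns) := by
  intro i j hij
  have h1 := coreSeq_mod_two ns i
  have h2 := coreSeq_div_two ns i
  rw [hij] at h1 h2
  rw [coreSeq_mod_two] at h1
  rw [coreSeq_div_two] at h2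
  exact injOn_coreRank ns (ns j % 2) (by simp [h1]) (by simp) h2.symm

lemma exists_coreSeq_eq {r : ℕ} {ns : Fin r → ℕ} {x : ℕ}
    (hx : x / 2 < #(parityClass ns (x % 2))) : ∃ k, coreSeq ns k = x := by
  rw [← mem_range, ← image_coreRank] at hx
  obtain ⟨k, hk, hkx⟩ := mem_image.mp hx
  rw [mem_parityClass] at hk
  exact ⟨k, by rw [coreSeq]; omega⟩

lemma two_mul_sum_coreSeq {r : ℕ} (ns : Fin r → ℕ) :
    2 * ∑ i, (coreSeq ns i : ℤ) = (r : ℤ) * (r - 1) + dStat ns * (dStat ns + 1) := by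
  have hcl : ∀ b, parityClass (coreSeq ns) b = parityClass ns b := fun b => by
    ext i; simp [coreSeq_mod_two]
  have hsum : ∀ b, 2 * ∑ i ∈ parityClass ns b, (coreRank ns i : ℤ) =
      #(parityClass ns b) * (#(parityClass ns b) - 1) := by
    intro b
    have h := sum_range_id_mul_two #(parityClass ns b)
    rw [← image_coreRank ns b, sum_image (injOn_coreRank ns b)] at h
    rw [mul_comm]
    rcases Nat.eq_zero_or_pos #(parityClass ns b) with h0 | h0
    · rw [card_eq_zero] at h0
      simp [h0]
    · zify [h0] at h
      exact h
  rw [two_mul_sum_eq, dStat_eq_card_sub_card, card_parityClass ns]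
  simp only [hcl, coreSeq_div_two, hsum]
  ring

lemma two_mul_sStat {r : ℕ} (ns : Fin r → ℕ) :
    2 * (sStat ns : ℤ) = dStat ns * (dStat ns + 1) := by
  have h1 : 0 ≤ dStat ns * (dStat ns + 1) := by
    rcases le_or_gt 0 (dStat ns) with h | h
    · positivity
    · nlinarith
  rw [sStat, Int.toNat_of_nonneg (by omega)]
  exact Int.two_mul_ediv_two_of_even (Int.even_mul_succ_self _)

lemma two_mul_sum_val (r : ℕ) : 2 * ∑ i : Fin r, ((i : ℕ) : ℤ) = (r : ℤ) * (r - 1) := by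
  rw [Fin.sum_univ_eq_sum_range (fun i => (i : ℤ))]
  induction r with
  | zero => simp
  | succ r ih => rw [sum_range_succ, mul_add, ih]; push_cast; ring

lemma sum_coreSeq {r : ℕ} (ns : Fin r → ℕ) :
    ∑ i, coreSeq ns i = sStat ns + ∑ i : Fin r, (i : ℕ) := by
  have h1 := two_mul_sum_coreSeq ns
  have h2 := two_mul_sStat ns
  have h3 := two_mul_sum_val r
  zify
  linarith

lemma exists_perm_of_sum_eq {r : ℕ} {ns t : Fin r → ℕ} (ht : Function.Injective t)
    (hpar : ∀ j, t j % 2 = ns j % 2) (hsum : ∑ j, t j = sStat ns + ∑ i : Fin r, (i : ℕ)) :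
    ∃ π : Equiv.Perm (Fin r), coreSeq ns ∘ π = t := by
  have hcl : ∀ b, parityClass t b = parityClass ns b := fun b => by ext i; simp [hpar]
  have h2 := two_mul_sStat ns
  have h3 := two_mul_sum_val r
  have h : 2 * ∑ i, (t i : ℤ) = (r : ℤ) * (r - 1) + dStat t * (dStat t + 1) := by
    rw [dStat_congr hpar]
    zify at hsum
    linarith
  choose π hπ using fun j => exists_coreSeq_eq (ns := ns) (x := t j)
    (hcl _ ▸ half_lt_card_of_two_mul_sum_eq ht h j)
  have hinj : Function.Injective π := fun i j hij => ht (by rw [← hπ i, ← hπ j, hij])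
  exact ⟨Equiv.ofBijective π (Finite.injective_iff_bijective.mp hinj), funext hπ⟩

lemma coeff_wronskHe_sStat {r : ℕ} (ns : Fin r → ℕ) :
    (wronskHe ns).coeff (sStat ns) = fallingDet (coreSeq ns) *
      (Matrix.of fun k j : Fin r => (He (ns j)).coeff (coreSeq ns k)).det := by
  let B := ∑ j, (ns j + coreSeq ns j) + 1
  have hB : ∀ j, ns j + coreSeq ns j < B := fun j => Nat.lt_succ_of_le
    (single_le_sum (f := fun j => ns j + coreSeq ns j) (fun _ _ => Nat.zero_le _) (mem_univ j))
  rw [coeff_wronskHe ns (B := B) (fun j => by have := hB j; omega)]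
  have hinj : Function.Injective fun π : Equiv.Perm (Fin r) => coreSeq ns ∘ π :=
    fun π π' h => Equiv.ext fun j => coreSeq_injective ns (congrFun h j)
  rw [← sum_subset (s₁ := univ.image fun π : Equiv.Perm (Fin r) => coreSeq ns ∘ π), sum_image
    (fun _ _ _ _ h => hinj h), Matrix.det_apply', mul_sum]
  · refine sum_congr rfl fun π _ => ?_
    rw [fallingDet_comp_perm]
    simp only [Function.comp_apply, Matrix.of_apply, Int.cast_id]
    ring
  · intro t ht
    obtain ⟨π, -, rfl⟩ := mem_image.mp ht
    refine mem_filter.mpr ⟨Fintype.mem_piFinset.mpr fun j => mem_range.mpr ?_, ?_⟩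
    · have := hB (π j)
      simp only [Function.comp_apply]
      omega
    · rw [← sum_coreSeq]
      exact Equiv.sum_comp π (coreSeq ns)
  · intro t ht hnot
    by_cases hi : Function.Injective t
    · by_cases hpar : ∀ j, t j % 2 = ns j % 2
      · obtain ⟨π, hπ⟩ := exists_perm_of_sum_eq hi hpar (mem_filter.mp ht).2
        exact absurd (mem_image.mpr ⟨π, mem_univ _, hπ⟩) hnot
      · obtain ⟨j, hj⟩ := not_forall.mp hpar
        rw [prod_eq_zero (mem_univ j) (coeff_He_eq_zero hj), zero_mul]
    · rw [fallingDet_eq_zero hi, mul_zero]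

/-- The matrix left after extracting factorials and odd parts from the lowest coefficient. -/
def coreMatrix {r : ℕ} (ns : Fin r → ℕ) : Matrix (Fin r) (Fin r) ℤ :=
  Matrix.of fun k j => if ns k % 2 = ns j % 2 then
    (-2) ^ coreRank ns k * ((ns j / 2).descFactorial (coreRank ns k) : ℤ) else 0

lemma prod_factorial_mul_det {r : ℕ} (ns : Fin r → ℕ) :
    (∏ k, ((coreSeq ns k).factorial : ℤ)) *
      (Matrix.of fun k j : Fin r => (He (ns j)).coeff (coreSeq ns k)).det =
    (∏ j, ((-1) ^ (ns j / 2) * (oddFact (ns j) : ℤ))) * (coreMatrix ns).det := by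
  rw [← Matrix.det_mul_column, ← Matrix.det_mul_row]
  congr 1
  ext k j
  simp only [Matrix.of_apply, coreMatrix]
  rw [factorial_mul_coeff_He, coreSeq_mod_two, coreSeq_div_two, mul_ite, mul_zero]

lemma ne_natCast_of_not_dvd_vand {r p : ℕ} {ns : Fin r → ℕ} (h : ¬ (p : ℤ) ∣ vand ns)
    {i j : Fin r} (hij : i ≠ j) : (ns i : ZMod p) ≠ ns j := by
  have key : ∀ a b : Fin r, a < b → (ns a : ZMod p) ≠ ns b := by
    intro a b hab he
    refine h (dvd_trans ?_ ((dvd_prod_of_mem (fun i => (ns b : ℤ) - ns i)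
      (mem_Iio.mpr hab)).trans (dvd_prod_of_mem
        (fun j => ∏ i ∈ Iio j, ((ns j : ℤ) - ns i)) (mem_univ b))))
    rw [← ZMod.intCast_zmod_eq_zero_iff_dvd]
    simp [he]
  rcases lt_or_gt_of_ne hij with h | h
  · exact key i j h
  · exact (key j i h).symm

lemma coreBlock_det_ne_zero {r p : ℕ} [Fact p.Prime] (hp2 : 2 < p) {ns : Fin r → ℕ}
    (hpd : ¬ (p : ℤ) ∣ vand ns) (P : Fin r → Prop) [DecidablePred P] {b : ℕ}
    (hP : ∀ i, P i ↔ ns i % 2 = b) :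
    (((coreMatrix ns).map (Int.castRingHom (ZMod p))).toSquareBlockProp P).det ≠ 0 := by
  have h2 : (2 : ZMod p) ≠ 0 := by
    intro h
    have := (ZMod.natCast_eq_zero_iff 2 p).mp (by exact_mod_cast h)
    exact absurd (Nat.le_of_dvd two_pos this) (by omega)
  have hev : ((coreMatrix ns).map (Int.castRingHom (ZMod p))).toSquareBlockProp P =
      Matrix.of fun k j : {i // P i} => (-2 : ZMod p) ^ coreRank ns k *
        (Matrix.of fun k j : {i // P i} => (descPochhammer (ZMod p) (coreRank ns k)).eval
          ((ns j / 2 : ℕ) : ZMod p)) k j := by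
    ext k j
    have hkj : ns k % 2 = ns j % 2 := ((hP _).mp k.2).trans ((hP _).mp j.2).symm
    simp [Matrix.toSquareBlockProp, coreMatrix, hkj, descPochhammer_eval_eq_descFactorial]
  rw [hev, Matrix.det_mul_column]
  refine mul_ne_zero (prod_ne_zero_iff.mpr fun k _ => pow_ne_zero _ (neg_ne_zero.mpr h2))
    (det_eval_descPochhammer_ne_zero (x := fun j : {i // P i} => ((ns j / 2 : ℕ) : ZMod p))
      (k := fun j : {i // P i} => coreRank ns j) ?_ ?_ ?_)
  · intro i j hij
    by_contra hne
    refine ne_natCast_of_not_dvd_vand hpd (fun h => hne (Subtype.ext h)) ?_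
    rw [← Nat.div_add_mod (ns i) 2, ← Nat.div_add_mod (ns j) 2, (hP _).mp i.2, (hP _).mp j.2]
    push_cast
    rw [show ((ns i / 2 : ℕ) : ZMod p) = ((ns j / 2 : ℕ) : ZMod p) from hij]
  · intro i j hij
    exact Subtype.ext (injOn_coreRank ns b (by simp [(hP _).mp i.2])
      (by simp [(hP _).mp j.2]) hij)
  · intro i
    have hc : Fintype.card {i // P i} = #(parityClass ns b) := by
      rw [Fintype.card_subtype]
      congr 1
      ext i
      simp [hP]
    rw [hc, ← (hP _).mp i.2]
    exact coreRank_lt ns i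

lemma not_dvd_det_coreMatrix {r p : ℕ} (hp : p.Prime) (hp2 : 2 < p) {ns : Fin r → ℕ}
    (hpd : ¬ (p : ℤ) ∣ vand ns) : ¬ (p : ℤ) ∣ (coreMatrix ns).det := by
  have := Fact.mk hp
  rw [← ZMod.intCast_zmod_eq_zero_iff_dvd, ← eq_intCast (Int.castRingHom (ZMod p)), RingHom.map_det,
    RingHom.mapMatrix_apply, Matrix.twoBlockTriangular_det _ (fun i => ns i % 2 = 0)]
  · exact mul_ne_zero (coreBlock_det_ne_zero hp2 hpd _ (b := 0) fun i => Iff.rfl)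
      (coreBlock_det_ne_zero hp2 hpd _ (b := 1) fun i => by omega)
  · intro i hi j hj
    have hij : ns i % 2 ≠ ns j % 2 := by omega
    simp [coreMatrix, hij]

lemma exists_coeff_sStat_dvd {r p : ℕ} (hp : p.Prime) (hp2 : 2 < p) {ns : Fin r → ℕ}
    (hpd : ¬ (p : ℤ) ∣ vand ns) :
    ∃ u : ℤ, ¬ (p : ℤ) ∣ u ∧
      (wronskHe ns).coeff (sStat ns) ∣ u * ∏ j, (oddFact (ns j) : ℤ) := by
  refine ⟨(coreMatrix ns).det, not_dvd_det_coreMatrix hp hp2 hpd, ?_⟩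
  obtain ⟨c, hc⟩ := fallingDet_dvd_prod_factorial (coreSeq_injective ns)
  have h := prod_factorial_mul_det ns
  have hsign : (∏ j, ((-1 : ℤ)) ^ (ns j / 2)) * ∏ j, (-1) ^ (ns j / 2) = 1 := by
    rw [← prod_mul_distrib]
    exact prod_eq_one fun j _ => by rw [← mul_pow]; simp
  rw [hc, prod_mul_distrib] at h
  rw [coeff_wronskHe_sStat]
  refine ⟨c * ∏ j, (-1) ^ (ns j / 2), ?_⟩
  linear_combination (-(∏ j, (-1 : ℤ) ^ (ns j / 2))) * h -
    ((coreMatrix ns).det * ∏ j, (oddFact (ns j) : ℤ)) * hsign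

lemma prod_eq_pow_sum_mul {ι : Type*} [Fintype ι] {p : ℕ} (hp : p.Prime) {g : ι → ℕ}
    (hg : ∀ i, g i ≠ 0) :
    ∃ w, ¬ p ∣ w ∧ ∏ i, g i = p ^ (∑ i, padicValNat p (g i)) * w := by
  refine ⟨∏ i, g i / p ^ (g i).factorization p, ?_, ?_⟩
  · rw [hp.prime.dvd_finsetProd_iff]
    rintro ⟨i, -, hi⟩
    exact Nat.not_dvd_ordCompl hp (hg i) hi
  · rw [← prod_pow_eq_pow_sum, ← prod_mul_distrib]
    refine prod_congr rfl fun i _ => ?_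
    rw [← Nat.factorization_def _ hp, Nat.ordProj_mul_ordCompl_eq_self]

lemma oddFact_ne_zero (t : ℕ) : oddFact t ≠ 0 := (oddProd_pos _).ne'

lemma pow_dvd_pow_mul_coeff_wronskHe {r p : ℕ} (hp : p.Prime) {ns : Fin r → ℕ} {q F e : ℕ}
    (hq : (p : ℤ) ^ q ∣ ∏ j, (oddFact (ns j) : ℤ))
    (hF : ∀ u : Fin r → ℕ, Function.Injective u → dStat u = dStat ns →
      ∑ i, u i = e + ∑ i : Fin r, (i : ℕ) → (∀ i : Fin r, (i : ℕ) ≤ u i) →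
      ∑ i : Fin r, padicValNat p (oddFact (u i - i)) ≤ F) :
    (p : ℤ) ^ q ∣ p ^ F * (wronskHe ns).coeff e := by
  rw [coeff_wronskHe ns (B := ∑ j, ns j + 1) fun j => Nat.lt_succ_of_le
    (single_le_sum (fun _ _ => Nat.zero_le _) (mem_univ j)), mul_sum]
  refine dvd_sum fun t ht => ?_
  by_cases hi : Function.Injective t
  swap
  · simp [fallingDet_eq_zero hi]
  by_cases hpar : ∀ j, t j % 2 = ns j % 2
  swap
  · obtain ⟨j, hj⟩ := not_forall.mp hpar
    rw [prod_eq_zero (mem_univ j) (coeff_He_eq_zero hj), zero_mul, mul_zero]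
    exact dvd_zero _
  rw [fallingDet, Matrix.det_apply', mul_sum, mul_sum]
  refine dvd_sum fun σ _ => ?_
  simp only [Matrix.of_apply]
  by_cases hle : ∀ j, (σ j : ℕ) ≤ t j
  swap
  · obtain ⟨j, hj⟩ := not_forall.mp hle
    rw [prod_eq_zero (i := j) (f := fun j => ((t j).descFactorial (σ j) : ℤ)) (mem_univ j)
      (by rw [Nat.descFactorial_eq_zero_iff_lt.mpr (by omega), Nat.cast_zero])]
    simp
  have hbound := hF (t ∘ σ.symm) (hi.comp σ.symm.injective)
    ((dStat_comp_perm t σ.symm).trans (dStat_congr hpar))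
    ((Equiv.sum_comp σ.symm t).trans (mem_filter.mp ht).2)
    (fun i => by simpa using hle (σ.symm i))
  obtain ⟨w, hw, hprod⟩ := prod_eq_pow_sum_mul hp
    (g := fun i : Fin r => oddFact ((t ∘ σ.symm) i - i)) fun i => oddFact_ne_zero _
  rw [← Equiv.prod_comp σ] at hprod
  simp only [Function.comp_apply, Equiv.symm_apply_apply] at hprod hbound
  have hdvd := hq.trans (prod_dvd_prod_of_dvd _ _ fun j (_ : j ∈ univ) =>
    oddFact_dvd_mul_coeff_He (ns j) (hle j))
  rw [prod_mul_distrib, prod_mul_distrib, ← Nat.cast_prod, hprod] at hdvd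
  have hcop : IsCoprime ((p : ℤ) ^ q) (w : ℤ) :=
    ((Nat.isCoprime_iff_coprime.mpr ((hp.coprime_iff_not_dvd).mpr hw)).pow_left)
  refine hcop.dvd_of_dvd_mul_left ?_
  obtain ⟨c, hc⟩ := Nat.exists_eq_add_of_le hbound
  rw [hc, pow_add]
  push_cast at hdvd
  refine (hdvd.mul_right (Equiv.Perm.sign σ * (p : ℤ) ^ c)).trans (dvd_of_eq ?_)
  simp only [Int.cast_id]
  ring

lemma mul_sum_padicValNat_le {r m p e j : ℕ} (hp : p.Prime) (hp2 : 2 < p)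
    (hpm : 2 * m - 1 < p) {ns u : Fin r → ℕ} (hd : dStat ns = m ∨ dStat ns = -m - 1)
    (he : e = sStat ns + j) (hu : Function.Injective u) (hdu : dStat u = dStat ns)
    (hsum : ∑ i, u i = e + ∑ i : Fin r, (i : ℕ)) (hle : ∀ i : Fin r, (i : ℕ) ≤ u i) :
    (p - (2 * m - 1)) * ∑ i : Fin r, padicValNat p (oddFact (u i - i)) ≤ j := by
  have hf : ∀ i : Fin r, (i : ℕ) + p * padicValNat p (oddFact (u i - i)) ≤ u i := fun i => by
    have := mul_padicValNat_oddFact_le hp hp2 (u i - i)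
    have := hle i
    omega
  have hs := two_mul_sStat ns
  have hM := two_mul_sum_val r
  rw [he] at hsum
  rcases Nat.eq_zero_or_pos m with rfl | hm
  · have h0 : sStat ns = 0 := by
      rcases hd with hd | hd <;> rw [hd] at hs <;> simp at hs <;> omega
    have h1 : ∑ i : Fin r, ((i : ℕ) + p * padicValNat p (oddFact (u i - i))) ≤ ∑ i, u i :=
      sum_le_sum fun i _ => hf i
    rw [sum_add_distrib, ← mul_sum] at h1
    rw [h0] at hsum
    simp only [mul_zero, zero_tsub, tsub_zero]
    linarith
  · have h1 := sum_ge_of_add_mul_le hu hm (by rwa [hdu]) hf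
    rw [hdu] at h1
    have hc : ((p - (2 * m - 1) : ℕ) : ℤ) = p - (2 * m - 1) := by omega
    zify
    rw [hc]
    zify at hsum
    push_cast at h1
    linarith

lemma mul_padicValInt_le {r m p : ℕ} (hp : p.Prime) (hp2 : 2 < p)
    (hpm : 2 * m - 1 < p) {ns : Fin r → ℕ} (hd : dStat ns = m ∨ dStat ns = -m - 1)
    (hpd : ¬ (p : ℤ) ∣ vand ns) {R : ℤ[X]}
    (hR : C (vand ns) * (X ^ sStat ns * R) = wronskHe ns)
    {j : ℕ} (hj : R.coeff j ≠ 0) :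
    ((p - (2 * m - 1) : ℕ) : ℤ) *
      ((padicValInt p (R.coeff 0) : ℤ) - padicValInt p (R.coeff j)) ≤ j := by
  have := Fact.mk hp
  have hpp : Prime (p : ℤ) := Nat.prime_iff_prime_int.mp hp
  have hcoeff : ∀ i, (wronskHe ns).coeff (sStat ns + i) = vand ns * R.coeff i := fun i => by
    rw [← hR, coeff_C_mul, add_comm, coeff_X_pow_mul]
  obtain ⟨u, hu, hdvd⟩ := exists_coeff_sStat_dvd hp hp2 hpd
  have h0 := hcoeff 0
  rw [add_zero] at h0
  rw [h0] at hdvd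
  have hq : (p : ℤ) ^ padicValInt p (R.coeff 0) ∣ ∏ j, (oddFact (ns j) : ℤ) :=
    hpp.pow_dvd_of_dvd_mul_left _ hu
      (((padicValInt_dvd (R.coeff 0)).trans (dvd_mul_left _ _)).trans hdvd)
  set c := p - (2 * m - 1)
  have hc : 0 < c := by omega
  have h1 := pow_dvd_pow_mul_coeff_wronskHe hp (F := j / c) (e := sStat ns + j) hq
    fun u hu hdu hsum hle => (Nat.le_div_iff_mul_le hc).mpr (by
      rw [mul_comm]; exact mul_sum_padicValNat_le hp hp2 hpm hd rfl hu hdu hsum hle)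
  rw [hcoeff, mul_left_comm] at h1
  have h2 := hpp.pow_dvd_of_dvd_mul_left _ hpd h1
  have hpF : (p : ℤ) ^ (j / c) ≠ 0 := pow_ne_zero _ hpp.ne_zero
  rw [padicValInt_dvd_iff, padicValInt.mul hpF hj] at h2
  have h3 : padicValInt p ((p : ℤ) ^ (j / c)) = j / c := by
    rw [← Nat.cast_pow, padicValInt.of_nat, padicValNat.prime_pow]
  rw [h3] at h2
  have h4 := h2.resolve_left (mul_ne_zero hpF hj)
  have h5 : (c : ℤ) * (j / c : ℕ) ≤ j := by exact_mod_cast Nat.mul_div_le j c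
  have h6 : (padicValInt p (R.coeff 0) : ℤ) - padicValInt p (R.coeff j) ≤ (j / c : ℕ) := by
    omega
  exact (mul_le_mul_of_nonneg_left h6 (by positivity)).trans h5

/-- Theorem `thm:slope`. Sharp upper bound for the slope of the
right-most edge of the Newton polygon of `R_λ` with respect to `p`, stated
coefficient-wise: writing `R_λ = Σ a_i X^i` (with `a_0 ≠ 0`), for all `1 ≤ j ≤ N`
(`N = n - s_λ`) with `a_j ≠ 0` (the case `a_j = 0` gives `ν_p(a_j) = ∞` and is vacuous):
(i) if `m = 0` then `ν_p(a_0) - ν_p(a_j) < j/(p-1)`, and moreover `≤ j/p` if `n < p²`;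
(ii) if `m ≥ 1` then `ν_p(a_0) - ν_p(a_j) ≤ j/(p-(2m-1))`.
Here `m = m_λ = max(d_λ, -d_λ-1)` is the parameter of the 2-core,
`p > max{2, 2m-1}` is a prime not dividing `Δ(n_λ)`. -/
theorem stmt3 (n r : ℕ) (lam : Fin r → ℕ) (hanti : Antitone lam)
    (hsum : ∑ i, lam i = n)
    (m : ℕ) (hm : (dStat (degSeq lam)) ⊔ (-(dStat (degSeq lam)) - 1) = (m : ℤ))
    (p : ℕ) (hp : p.Prime) (hp2 : (2 : ℤ) ⊔ (2 * (m : ℤ) - 1) < (p : ℤ))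
    (hpd : ¬ (p : ℤ) ∣ vand (degSeq lam))
    (HeL RL : Polynomial ℤ)
    (hHe : Polynomial.C (vand (degSeq lam)) * HeL = wronskHe (degSeq lam))
    (hR : HeL = Polynomial.X ^ sStat (degSeq lam) * RL)
    (hR0 : RL.coeff 0 ≠ 0) :
    (m = 0 →
      (∀ j : ℕ, 1 ≤ j → j ≤ n - sStat (degSeq lam) → RL.coeff j ≠ 0 →
        (padicValInt p (RL.coeff 0) : ℚ) - (padicValInt p (RL.coeff j) : ℚ)
          < (j : ℚ) / ((p : ℚ) - 1)) ∧
      (n < p ^ 2 →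
        ∀ j : ℕ, 1 ≤ j → j ≤ n - sStat (degSeq lam) → RL.coeff j ≠ 0 →
          (padicValInt p (RL.coeff 0) : ℚ) - (padicValInt p (RL.coeff j) : ℚ)
            ≤ (j : ℚ) / (p : ℚ))) ∧
    (1 ≤ m →
      ∀ j : ℕ, 1 ≤ j → j ≤ n - sStat (degSeq lam) → RL.coeff j ≠ 0 →
        (padicValInt p (RL.coeff 0) : ℚ) - (padicValInt p (RL.coeff j) : ℚ)
          ≤ (j : ℚ) / ((p : ℚ) - (2 * (m : ℚ) - 1))) := by
  have hp2' : 2 < p := by exact_mod_cast (max_lt_iff.mp hp2).1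
  have hpm : 2 * m - 1 < p := by have := (max_lt_iff.mp hp2).2; omega
  have hd : dStat (degSeq lam) = m ∨ dStat (degSeq lam) = -m - 1 := by
    rcases max_cases (dStat (degSeq lam)) (-dStat (degSeq lam) - 1) with h | h <;> omega
  have key : ∀ j : ℕ, RL.coeff j ≠ 0 → ((p - (2 * m - 1) : ℕ) : ℚ) *
      ((padicValInt p (RL.coeff 0) : ℚ) - padicValInt p (RL.coeff j)) ≤ j := fun j hj => by
    exact_mod_cast mul_padicValInt_le hp hp2' hpm hd hpd (by rw [← hR, hHe]) hj
  have hpQ : (2 : ℚ) < p := by exact_mod_cast hp2'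
  refine ⟨?_, fun hm1 j _ _ hj => ?_⟩
  · rintro rfl
    have hle : ∀ j : ℕ, RL.coeff j ≠ 0 →
        (padicValInt p (RL.coeff 0) : ℚ) - padicValInt p (RL.coeff j) ≤ j / p := fun j hj => by
      rw [le_div_iff₀ (by linarith), mul_comm]
      simpa using key j hj
    refine ⟨fun j hj1 _ hj => (hle j hj).trans_lt ?_, fun _ j _ _ hj => hle j hj⟩
    have hjQ : (0 : ℚ) < j := by exact_mod_cast hj1
    exact div_lt_div_of_pos_left hjQ (by linarith) (by linarith)
  · have hcast : ((p - (2 * m - 1) : ℕ) : ℚ) = p - (2 * m - 1) := by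
      rw [Nat.cast_sub hpm.le, Nat.cast_sub (by omega)]
      push_cast
      ring
    have hpos : (0 : ℚ) < p - (2 * m - 1) := by
      rw [← hcast]
      exact_mod_cast Nat.sub_pos_of_lt hpm
    rw [le_div_iff₀ hpos, mul_comm, ← hcast]
    exact key j hj
end
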